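/- arXiv:1409.5634 — 4 statements merged into one kernel-verified Lean document; each statement's English description precedes it below -/
import Mathlib

section
/- For every x ∈ E*, one has κ₁(x) − κ_{−1}(x) = q · χ₂(x) · χ₂(T(x)) (an identity in ℂ, where the integer difference on the left is coerced into ℂ, and χ₂ is applied to the image of T(x) in E; in particular both sides are 0 when T(x) = 0). -/
open scoped Classical


structure CubSetup (F E : Type*) [Field F] [Fintype F] [Field E] [Fintype E] [Algebra F E] where
  σ : E →+* E
  T : E → F
  hT : ∀ x, algebraMap F E (T x) = σ (σ x) + σ x + x
  h3 : ∀ x, σ (σ (σ x)) = x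
  hF : ∀ c : F, σ (algebraMap F E c) = algebraMap F E c
  hfix : ∀ x, σ x = x → ∃ c : F, algebraMap F E c = x
  hcard : Fintype.card E = Fintype.card F ^ 3
  h2 : (2 : E) ≠ 0
  hneg : ∃ j : E, j ^ 2 = -1
  hcube : ∀ a : E, a ^ 3 = 1 → a = 1

namespace CubSetup

variable {F E : Type*} [Field F] [Fintype F] [Field E] [Fintype E] [Algebra F E]

noncomputable def η (_S : CubSetup F E) (y : E) : ℂ := ((quadraticChar E y : ℤ) : ℂ)

local notation "ι" => algebraMap F E

set_option linter.unusedSectionVars false in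
theorem inj : Function.Injective (algebraMap F E) := (algebraMap F E).injective

theorem T_add (S : CubSetup F E) (x y : E) : S.T (x + y) = S.T x + S.T y := by
  apply inj (E := E); rw [map_add, S.hT, S.hT, S.hT]; simp only [map_add]; ring

theorem T_smul (S : CubSetup F E) (c : F) (x : E) : S.T (ι c * x) = c * S.T x := by
  apply inj (E := E); rw [map_mul, S.hT, S.hT]; simp only [map_mul, S.hF]; ring

theorem T_zero (S : CubSetup F E) : S.T 0 = 0 := by
  have := S.T_smul 0 0; simpa using this

theorem T_neg (S : CubSetup F E) (x : E) : S.T (-x) = - S.T x := by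
  have := S.T_smul (-1) x; simpa using this

theorem T_sub (S : CubSetup F E) (x y : E) : S.T (x - y) = S.T x - S.T y := by
  rw [sub_eq_add_neg, T_add, T_neg, sub_eq_add_neg]

theorem T_σ (S : CubSetup F E) (x : E) : S.T (S.σ x) = S.T x := by
  apply inj (E := E); rw [S.hT, S.hT, S.h3]; ring

theorem h2F (S : CubSetup F E) : (2 : F) ≠ 0 := by
  intro h; apply S.h2; have := congrArg (algebraMap F E) h; rwa [map_ofNat, map_zero] at this

theorem ringCharE (S : CubSetup F E) : ringChar E ≠ 2 := by
  intro h; apply S.h2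
  have := ringChar.Nat.cast_ringChar (R := E); rw [h] at this; exact_mod_cast this

theorem ringCharF (S : CubSetup F E) : ringChar F ≠ 2 := by
  intro h; apply S.h2F
  have := ringChar.Nat.cast_ringChar (R := F); rw [h] at this; exact_mod_cast this

theorem η_mul (S : CubSetup F E) (x y : E) : S.η (x * y) = S.η x * S.η y := by
  simp only [η, map_mul, Int.cast_mul]

theorem η_zero (S : CubSetup F E) : S.η 0 = 0 := by simp [η]

theorem η_sq (S : CubSetup F E) {x : E} (hx : x ≠ 0) : S.η (x ^ 2) = 1 := by
  simp only [η]; rw [quadraticChar_sq_one' hx]; simp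

theorem η_sq' (S : CubSetup F E) {x : E} (hx : x ≠ 0) : S.η x ^ 2 = 1 := by
  rw [← S.η_sq hx, sq, sq, η_mul]

theorem η_nonsq (S : CubSetup F E) {x : E} (hx : ¬ IsSquare x) : S.η x = -1 := by
  simp only [η]; rw [quadraticChar_neg_one_iff_not_isSquare.2 hx]; simp

theorem η_neg_one (S : CubSetup F E) : S.η (-1) = 1 := by
  obtain ⟨j, hj⟩ := S.hneg
  rw [← hj]; apply η_sq; rintro rfl; norm_num at hj

theorem η_neg (S : CubSetup F E) (x : E) : S.η (-x) = S.η x := by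
  rw [neg_eq_neg_one_mul, η_mul, η_neg_one, one_mul]

theorem isSq (S : CubSetup F E) {c : F} (h : IsSquare (ι c)) : IsSquare c := by
  obtain ⟨y, hy⟩ := h
  have h1 : S.σ y * S.σ y = y * y := by rw [← map_mul, ← hy, S.hF]
  rcases mul_self_eq_mul_self_iff.1 h1 with h | h
  · obtain ⟨d, rfl⟩ := S.hfix y h
    exact ⟨d, inj (E := E) (by rw [hy, map_mul])⟩
  · have := S.h3 y
    simp only [h, map_neg, neg_neg] at this
    have h0 : y = 0 := by
      have : 2 * y = 0 := by linear_combination -this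
      simpa [S.h2] using this
    rw [h0] at hy
    simp at hy
    rw [hy]; exact ⟨0, by simp⟩

theorem exists_nonsq (S : CubSetup F E) : ∃ n : F, n ≠ 0 ∧ S.η (ι n) = -1 := by
  obtain ⟨n, hn⟩ := FiniteField.exists_nonsquare S.ringCharF
  refine ⟨n, ?_, S.η_nonsq fun h => hn (S.isSq h)⟩
  rintro rfl; exact hn ⟨0, by simp⟩

theorem card_sqrt (S : CubSetup F E) (a : E) :
    (∑ w : E, if w ^ 2 = a then (1 : ℂ) else 0) = S.η a + 1 := by
  have := quadraticChar_card_sqrts S.ringCharE a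
  simp only [η]
  rw [Finset.sum_boole]
  have h2 : ((Finset.univ.filter fun w : E => w ^ 2 = a).card : ℤ) = quadraticChar E a + 1 := by
    rw [← this]; congr 2; ext; simp
  exact_mod_cast h2

noncomputable def h (S : CubSetup F E) (r : F) : ℂ := ∑ z : E, if S.T z = r then S.η z else 0

theorem h_scale (S : CubSetup F E) {c : F} (hc : c ≠ 0) (r : F) : S.h (c * r) = S.η (ι c) * S.h r := by
  have hc' : ι c ≠ 0 := by simpa using hc
  simp only [h]
  rw [Finset.mul_sum]
  symm
  apply Fintype.sum_equiv (Equiv.mulLeft₀ (ι c) hc')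
  intro z
  simp only [Equiv.mulLeft₀_apply, T_smul, mul_right_inj' hc, η_mul]
  split_ifs <;> simp

theorem h_zero (S : CubSetup F E) : S.h 0 = 0 := by
  obtain ⟨n, hn, h⟩ := S.exists_nonsq
  have := S.h_scale hn 0
  rw [h, mul_zero] at this
  linear_combination this / 2

theorem h_eq (S : CubSetup F E) (r : F) : S.h r = S.η (ι r) * S.h 1 := by
  by_cases hr : r = 0
  · rw [hr, h_zero, map_zero, η_zero, zero_mul]
  · rw [← S.h_scale hr, mul_one]

/-- number of `w` with `T(w^2)=r` -/
theorem count_sq (S : CubSetup F E) (r : F) :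
    (∑ w : E, if S.T (w ^ 2) = r then (1 : ℂ) else 0)
      = S.h r + ∑ z : E, if S.T z = r then (1 : ℂ) else 0 := by
  have : ∀ w : E, (if S.T (w ^ 2) = r then (1 : ℂ) else 0)
      = ∑ z : E, if w ^ 2 = z then (if S.T z = r then (1 : ℂ) else 0) else 0 := by
    intro w; simp
  simp only [this]
  rw [Finset.sum_comm, h, ← Finset.sum_add_distrib]
  apply Finset.sum_congr rfl
  intro z _
  by_cases hz : S.T z = r
  · simp only [hz, if_true, S.card_sqrt]
  · simp [hz]

theorem card_ker (S : CubSetup F E) :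
    Fintype.card F ^ 2 ≤ (Finset.univ.filter fun z : E => S.T z = 0).card := by
  have h1 := Finset.card_le_mul_card_image (f := S.T) (Finset.univ : Finset E)
    ((Finset.univ.filter fun z : E => S.T z = 0).card) (by
      intro b hb
      obtain ⟨z0, -, rfl⟩ := Finset.mem_image.1 hb
      apply Finset.card_le_card_of_injOn (fun z => z - z0)
      · intro z hz
        simp at hz ⊢
        rw [T_sub, hz, sub_self]
      · intro a _ b _ hab
        simpa using hab)
  rw [Finset.card_univ, S.hcard] at h1
  have h2 : (Finset.image S.T Finset.univ).card ≤ Fintype.card F := Finset.card_le_univ _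
  have h3 : 0 < Fintype.card F := Fintype.card_pos
  have h4 := h1.trans (Nat.mul_le_mul_left _ h2)
  have : Fintype.card F ^ 2 * Fintype.card F ≤ (Finset.univ.filter fun z : E => S.T z = 0).card * Fintype.card F := by
    rw [← pow_succ]; exact h4
  exact Nat.le_of_mul_le_mul_right this h3

theorem T_sq (S : CubSetup F E) (w : E) : S.T w ^ 2 = S.T (w ^ 2) + 2 * S.T (w * S.σ w) := by
  apply inj (E := E)
  simp only [map_pow, map_add, map_mul, S.hT, S.h3, map_ofNat]
  ring

theorem iso_fix (S : CubSetup F E) {w : E} (h1 : S.T w = 0) (h2 : S.T (w ^ 2) = 0) : S.σ w = w := by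
  by_cases hw : w = 0
  · simp [hw]
  have h3 : S.T (w * S.σ w) = 0 := by
    have := S.T_sq w
    rw [h1, h2] at this
    have h : 2 * S.T (w * S.σ w) = 0 := by linear_combination -this
    simpa [S.h2F] using h
  have e1 := S.hT w
  have e2 := S.hT (w * S.σ w)
  rw [h1, map_zero] at e1
  rw [h3, map_zero] at e2
  simp only [map_mul, S.h3] at e2
  -- w^3 = N
  have k1 : w ^ 3 = w * S.σ w * S.σ (S.σ w) := by
    linear_combination (-w^2) * e1 + w * e2
  have k2 : S.σ w ^ 3 = w * S.σ w * S.σ (S.σ w) := by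
    have := congrArg S.σ k1
    simp only [map_mul, map_pow, S.h3] at this
    rw [this]; ring
  have k3 : (S.σ w / w) ^ 3 = 1 := by
    rw [div_pow, k2, ← k1, div_self (pow_ne_zero _ hw)]
  have := S.hcube _ k3
  rwa [div_eq_one_iff_eq hw] at this

theorem exists_iso (S : CubSetup F E) : ∃ w : E, S.T (w ^ 2) = 0 ∧ S.T w ≠ 0 := by
  by_contra! hcon
  have h1 : (Finset.univ.filter fun w : E => S.T (w ^ 2) = 0).card ≤ Fintype.card F := by
    rw [← Finset.card_univ (α := F), ← Finset.card_image_of_injective _ (inj (F := F) (E := E))]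
    apply Finset.card_le_card
    intro w hw
    simp at hw ⊢
    exact S.hfix w (S.iso_fix (hcon w hw) hw)
  have h2 := S.count_sq 0
  rw [h_zero, zero_add, Finset.sum_boole, Finset.sum_boole] at h2
  have h2' := Nat.cast_injective h2
  have h3 := S.card_ker
  have h4 : 1 < Fintype.card F := Fintype.one_lt_card
  rw [← h2'] at h3
  nlinarith

theorem h_one (S : CubSetup F E) : S.h 1 = Fintype.card F := by
  obtain ⟨w, hw2, hw⟩ := S.exists_iso
  set t := S.T w with ht
  have hk : 2 * S.T (w * S.σ w) = t ^ 2 := by rw [ht, S.T_sq, hw2, zero_add]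
  let φ : F × F × F → E := fun v => ι v.1 * w + ι v.2.1 * S.σ w + ι v.2.2 * S.σ (S.σ w)
  have hT1 : ∀ v, S.T (φ v) = (v.1 + v.2.1 + v.2.2) * t := by
    intro v; simp only [φ, T_add, T_smul, T_σ, ← ht]; ring
  have hT2 : ∀ v, S.T (φ v ^ 2) = (v.1 * v.2.1 + v.2.1 * v.2.2 + v.1 * v.2.2) * t ^ 2 := by
    rintro ⟨a, b, c⟩
    have e : φ (a, b, c) ^ 2 = ι (a ^ 2) * w ^ 2 + ι (b ^ 2) * S.σ (w ^ 2) + ι (c ^ 2) * S.σ (S.σ (w ^ 2))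
       + ι (2 * a * b) * (w * S.σ w) + ι (2 * b * c) * S.σ (w * S.σ w)
       + ι (2 * a * c) * S.σ (S.σ (w * S.σ w)) := by
      simp only [φ, map_mul, map_pow, S.h3, map_ofNat]; ring
    rw [e]
    simp only [T_add, T_smul, T_σ, hw2]
    linear_combination (a * b + b * c + a * c) * hk
  have hφ : Function.Injective φ := by
    have hsub : ∀ v v', φ v - φ v' = φ (v - v') := by
      intro v v'; simp only [φ, Prod.fst_sub, Prod.snd_sub, map_sub]; ring
    have key : ∀ v, φ v = 0 → v = 0 := by
      rintro ⟨a, b, c⟩ hv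
      have hadd : ∀ u, φ ((a, b, c) + u) = φ u := by
        intro u
        have : φ ((a, b, c) + u) = φ (a, b, c) + φ u := by
          simp only [φ, Prod.fst_add, Prod.snd_add, map_add]; ring
        rw [this, hv, zero_add]
      have hQ : ∀ u : F × F × F, (a + u.1) * (b + u.2.1) + (b + u.2.1) * (c + u.2.2)
          + (a + u.1) * (c + u.2.2) = u.1 * u.2.1 + u.2.1 * u.2.2 + u.1 * u.2.2 := by
        intro u
        have h1 := hT2 ((a, b, c) + u)
        rw [hadd, hT2] at h1
        exact (mul_right_cancel₀ (pow_ne_zero 2 hw) h1).symm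
      have q0 := hQ (0, 0, 0)
      have q1 := hQ (1, 0, 0)
      have q2 := hQ (0, 1, 0)
      have q3 := hQ (0, 0, 1)
      simp only at q0 q1 q2 q3
      have two := S.h2F
      have za : a = 0 := mul_left_cancel₀ two (by linear_combination q2 + q3 - q1 - q0)
      have zb : b = 0 := mul_left_cancel₀ two (by linear_combination q1 + q3 - q2 - q0)
      have zc : c = 0 := mul_left_cancel₀ two (by linear_combination q1 + q2 - q3 - q0)
      rw [za, zb, zc]; rfl
    intro v v' hvv
    have := key (v - v') (by rw [← hsub, hvv, sub_self])
    exact sub_eq_zero.1 this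
  have hbij : Function.Bijective φ := by
    rw [Fintype.bijective_iff_injective_and_card]
    refine ⟨hφ, ?_⟩
    rw [S.hcard, Fintype.card_prod, Fintype.card_prod]; ring
  have htr : ∀ g : E → ℂ, ∑ w : E, g w = ∑ a : F, ∑ b : F, ∑ c : F, g (φ (a, b, c)) := by
    intro g
    rw [← Function.Bijective.sum_comp hbij g, Fintype.sum_prod_type]
    apply Finset.sum_congr rfl
    intro a _
    rw [Fintype.sum_prod_type]
  have c1 := S.count_sq 1
  rw [htr, htr] at c1
  simp only [hT1, hT2] at c1
  have r : ∀ a b : F, (∑ c : F, if (a + b + c) * t = 1 then (1 : ℂ) else 0) = 1 := by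
    intro a b
    rw [Finset.sum_eq_single (1 / t - a - b)]
    · rw [if_pos]; field_simp; ring
    · intro c _ hc
      rw [if_neg]; intro h; apply hc; field_simp; linear_combination h
    · simp
  have l : ∀ a b : F, (∑ c : F, if (a * b + b * c + a * c) * t ^ 2 = 1 then (1 : ℂ) else 0)
      = 1 + if b = -a then ((if -a ^ 2 * t ^ 2 = 1 then (Fintype.card F : ℂ) else 0) - 1) else 0 := by
    intro a b
    by_cases hb : b = -a
    · have : ∀ c : F, (a * b + b * c + a * c) * t ^ 2 = -a ^ 2 * t ^ 2 := by
        intro c; rw [hb]; ring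
      simp only [this, if_pos hb]
      split_ifs <;> simp
    · rw [if_neg hb]
      have hs : a + b ≠ 0 := fun h => hb (by linear_combination h)
      rw [Finset.sum_eq_single ((1 / t ^ 2 - a * b) / (a + b))]
      · rw [if_pos, add_zero]; field_simp; ring
      · intro c _ hc
        rw [if_neg]; intro h; apply hc; field_simp; linear_combination h
      · simp
  simp only [r, l] at c1
  have two : (∑ a : F, if -a ^ 2 * t ^ 2 = 1 then (Fintype.card F : ℂ) else 0) = 2 * Fintype.card F := by
    obtain ⟨j0, hj0⟩ := S.hneg
    obtain ⟨j, hj⟩ : IsSquare (-1 : F) := S.isSq ⟨j0, by rw [map_neg, map_one, ← hj0, sq]⟩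
    have hj00 : j ≠ 0 := by rintro rfl; norm_num at hj
    have hne : j / t ≠ -(j / t) := by
      intro h
      have h' : 2 * (j / t) = 0 := by linear_combination h
      rcases mul_eq_zero.1 h' with h' | h'
      · exact S.h2F h'
      · exact (div_ne_zero hj00 hw) h'
    have : ∀ a : F, (-a ^ 2 * t ^ 2 = 1) ↔ a ∈ ({j / t, -(j / t)} : Finset F) := by
      intro a
      rw [Finset.mem_insert, Finset.mem_singleton]
      constructor
      · intro h
        have : (a * t - j) * (a * t + j) = 0 := by linear_combination -h + hj
        rcases mul_eq_zero.1 this with h | h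
        · left; field_simp; linear_combination h
        · right; field_simp; linear_combination h
      · rintro (rfl | rfl)
        · field_simp; linear_combination hj
        · field_simp; linear_combination hj
    simp only [this]
    rw [Finset.sum_ite_mem, Finset.univ_inter, Finset.sum_pair hne]; ring
  simp only [Finset.sum_add_distrib, Finset.sum_ite_eq', Finset.mem_univ, if_true, Finset.sum_sub_distrib, two,
    Finset.sum_const, Finset.card_univ, nsmul_eq_mul] at c1
  linear_combination -c1

theorem salie (S : CubSetup F E) {v : E} (hv : v ≠ 0) (z : E) :
    (∑ y : E, if y + v ^ 2 / y = z then S.η y else 0) = S.η (z + 2 * v) + S.η (z - 2 * v) := by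
  have h2 := S.h2
  have h4 : S.η 4 = 1 := by
    rw [show (4 : E) = 2 ^ 2 by norm_num]; exact S.η_sq h2
  have e1 : ∀ y : E, (if y + v ^ 2 / y = z then S.η y else 0)
      = if (2 * y - z) ^ 2 = z ^ 2 - 4 * v ^ 2 then S.η y else 0 := by
    intro y
    by_cases hy : y = 0
    · simp [hy, η_zero]
    · congr 1
      rw [eq_iff_iff]
      constructor
      · rintro rfl; field_simp; ring
      · intro h
        field_simp
        have h44 : (4 : E) ≠ 0 := by
          rw [show (4 : E) = 2 ^ 2 by norm_num]; exact pow_ne_zero _ h2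
        apply mul_left_cancel₀ h44
        linear_combination h
  simp only [e1]
  by_cases hz : z + 2 * v = 0
  · have hz' : z = -(2 * v) := by linear_combination hz
    rw [Finset.sum_eq_single (-v)]
    · rw [if_pos (by rw [hz']; ring), hz, η_zero, hz',
        show -(2 * v) - 2 * v = 4 * (-v) by ring, η_mul, h4]; ring
    · intro y _ hy
      rw [if_neg]
      intro h
      apply hy
      have : (2 * (y + v)) ^ 2 = 0 := by rw [hz'] at h; linear_combination h
      have := pow_eq_zero_iff (two_ne_zero) |>.1 this
      rcases mul_eq_zero.1 this with h | h
      · exact absurd h h2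
      · linear_combination h
    · simp
  · have e2 : ∀ y : E, (if (2 * y - z) ^ 2 = z ^ 2 - 4 * v ^ 2 then S.η y else 0)
      = S.η (z + 2 * v) * if (2 * y - z) ^ 2 = z ^ 2 - 4 * v ^ 2 then 1 else 0 := by
      intro y
      split_ifs with h
      · have k : 4 * (y * (z + 2 * v)) = 4 * (y + v) ^ 2 := by linear_combination -h
        have k' : S.η y * S.η (z + 2 * v) = S.η ((y + v) ^ 2) := by
          have := congrArg S.η k
          rwa [η_mul, η_mul, η_mul, h4, one_mul, one_mul] at this
        have hyv : y + v ≠ 0 := by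
          intro h0
          rw [h0] at k
          have h44 : (4 : E) ≠ 0 := by
            rw [show (4 : E) = 2 ^ 2 by norm_num]; exact pow_ne_zero _ h2
          have hy0 : y = 0 := by simpa [h44, hz] using k
          rw [hy0, zero_add] at h0
          exact hv h0
        rw [S.η_sq hyv] at k'
        have := S.η_sq' hz
        linear_combination S.η (z + 2 * v) * k' - S.η y * this
      · simp
    simp only [e2]
    rw [← Finset.mul_sum]
    have e3 : (∑ y : E, if (2 * y - z) ^ 2 = z ^ 2 - 4 * v ^ 2 then (1 : ℂ) else 0)
        = S.η (z ^ 2 - 4 * v ^ 2) + 1 := by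
      rw [← S.card_sqrt]
      apply Fintype.sum_equiv ((Equiv.mulLeft₀ 2 h2).trans (Equiv.subRight z))
      intro y; simp
    rw [e3, show z ^ 2 - 4 * v ^ 2 = (z + 2 * v) * (z - 2 * v) by ring, η_mul]
    linear_combination S.η (z - 2 * v) * S.η_sq' hz

noncomputable def B (S : CubSetup F E) (x : E) (c : F) : ℂ :=
  ∑ y : E, if S.T y = c * S.T (x ^ 2 / y) then S.η y else 0

theorem B_sq (S : CubSetup F E) {x : E} (hx : x ≠ 0) {d : F} (hd : d ≠ 0) :
    S.B x (-d ^ 2) = S.h (2 * d * S.T x) + S.h (-(2 * d * S.T x)) := by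
  have hv : ι d * x ≠ 0 := mul_ne_zero (by simpa using hd) hx
  have e : ∀ y : E, (if S.T y = -d ^ 2 * S.T (x ^ 2 / y) then S.η y else 0)
      = ∑ z : E, if y + (ι d * x) ^ 2 / y = z then (if S.T z = 0 then S.η y else 0) else 0 := by
    intro y
    rw [Finset.sum_ite_eq, if_pos (Finset.mem_univ _)]
    congr 1
    rw [T_add, show (ι d * x) ^ 2 / y = ι (d ^ 2) * (x ^ 2 / y) by rw [map_pow]; ring, T_smul,
      eq_iff_iff]
    constructor <;> intro h <;> linear_combination h
  have sh : ∀ s : E, (∑ z : E, if S.T z = 0 then S.η (z + s) else 0) = S.h (S.T s) := by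
    intro s
    apply Fintype.sum_equiv (Equiv.addRight s)
    intro z
    simp [T_add]
  simp only [B, e]
  rw [Finset.sum_comm]
  have e2 : ∀ z : E, (∑ y : E, if y + (ι d * x) ^ 2 / y = z then (if S.T z = 0 then S.η y else 0) else 0)
     = (if S.T z = 0 then S.η (z + 2 * (ι d * x)) else 0) + (if S.T z = 0 then S.η (z + -(2 * (ι d * x))) else 0) := by
    intro z
    split_ifs with h
    · rw [S.salie hv z, sub_eq_add_neg]
    · simp
  simp only [e2]
  rw [Finset.sum_add_distrib, sh, sh, T_neg]
  rw [show 2 * (ι d * x) = ι (2 * d) * x by rw [map_mul, map_ofNat]; ring, T_smul]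

theorem B_nonsq (S : CubSetup F E) {x : E} (hx : x ≠ 0) {c : F} (hc : ¬ IsSquare (-c)) :
    S.B x c = 0 := by
  have hc0 : c ≠ 0 := by rintro rfl; simp at hc
  have hm : ι (-c) * x ^ 2 ≠ 0 := mul_ne_zero (by simpa using hc0) (pow_ne_zero _ hx)
  have hinv : Function.Involutive (fun y : E => ι (-c) * x ^ 2 / y) := by
    intro y
    by_cases hy : y = 0
    · simp [hy]
    · exact div_div_cancel₀ hm
  have : S.B x c = - S.B x c := by
    rw [B, ← Finset.sum_neg_distrib]
    apply Fintype.sum_equiv hinv.toPerm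
    intro y
    change _ = -(if S.T (ι (-c) * x ^ 2 / y) = c * S.T (x ^ 2 / (ι (-c) * x ^ 2 / y))
      then S.η (ι (-c) * x ^ 2 / y) else 0)
    by_cases hy : y = 0
    · simp [hy, η_zero]
    have h1 : x ^ 2 / (ι (-c) * x ^ 2 / y) = ι (-1 / c) * y := by
      have : ι c ≠ 0 := by simpa using hc0
      simp only [map_neg, map_div₀, map_one]
      field_simp
    have h2 : S.η (ι (-c) * x ^ 2 / y) = - S.η y := by
      have k : S.η (ι (-c) * x ^ 2 / y) * S.η y = -1 := by
        rw [← η_mul, div_mul_cancel₀ _ hy, η_mul, S.η_sq hx, mul_one]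
        exact S.η_nonsq fun h => hc (S.isSq h)
      linear_combination S.η y * k - S.η (ι (-c) * x ^ 2 / y) * S.η_sq' hy
    have h3 : S.T (ι (-c) * x ^ 2 / y) = -c * S.T (x ^ 2 / y) := by
      rw [mul_div_assoc, T_smul]
    simp only [h1, h2, h3, T_smul]
    have h4 : (S.T y = c * S.T (x ^ 2 / y)) ↔ (-c * S.T (x ^ 2 / y) = c * (-1 / c * S.T y)) := by
      rw [← mul_assoc, mul_div_cancel₀ _ hc0]
      constructor <;> intro h <;> linear_combination h
    by_cases h : S.T y = c * S.T (x ^ 2 / y)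
    · rw [if_pos h, if_pos (h4.1 h), neg_neg]
    · rw [if_neg h, if_neg (fun h' => h (h4.2 h')), neg_zero]
  linear_combination this / 2

theorem B_eq (S : CubSetup F E) {x : E} (hx : x ≠ 0) {c : F} (hc : c ≠ 0) :
    S.B x c = ∑ d : F, if -d ^ 2 = c then S.h (2 * d * S.T x) else 0 := by
  by_cases h : IsSquare (-c)
  · obtain ⟨d, hd⟩ := h
    have hd0 : d ≠ 0 := by rintro rfl; simp at hd; exact hc hd
    have hc' : c = - d ^ 2 := by linear_combination -hd
    rw [hc', S.B_sq hx hd0]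
    have hne : d ≠ -d := by
      intro h
      have h' : 2 * d = 0 := by linear_combination h
      rcases mul_eq_zero.1 h' with h' | h'
      · exact S.h2F h'
      · exact hd0 h'
    have : ∀ a : F, (-a ^ 2 = -d ^ 2) ↔ a ∈ ({d, -d} : Finset F) := by
      intro a
      rw [neg_inj, sq_eq_sq_iff_eq_or_eq_neg]; simp
    simp only [this]
    rw [Finset.sum_ite_mem, Finset.univ_inter, Finset.sum_pair hne]
    congr 2; ring
  · rw [S.B_nonsq hx h]
    symm
    apply Finset.sum_eq_zero
    intro d _
    rw [if_neg]
    rintro rfl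
    exact h ⟨d, by ring⟩

theorem main (S : CubSetup F E) (ψ : MulChar E ℂ) (hψ : ∀ y, ψ y ^ 2 = S.η y) {x : E} (hx : x ≠ 0) :
    ∑ y : E, S.η y * (ψ (ι (S.T y)) * ψ (ι (S.T (x ^ 2 / y)))⁻¹)
      = Fintype.card F * (Fintype.card F - 1) * S.η (ι (S.T x)) := by
  obtain ⟨n, hn, hηn⟩ := S.exists_nonsq
  have hsum0 : ∑ c : F, ψ (ι c) = 0 := by
    have hn1 : ψ (ι n) ≠ 1 := by
      intro h; have := hψ (ι n); rw [h, hηn] at this; norm_num at this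
    have : ψ (ι n) * ∑ c : F, ψ (ι c) = ∑ c : F, ψ (ι c) := by
      rw [Finset.mul_sum]
      apply Fintype.sum_equiv (Equiv.mulLeft₀ n hn)
      intro c; simp
    have : (ψ (ι n) - 1) * ∑ c : F, ψ (ι c) = 0 := by linear_combination this
    rcases mul_eq_zero.1 this with h | h
    · exact absurd (by linear_combination h) hn1
    · exact h
  have L : ∑ c : F, ψ (ι c) * S.B x c
      = ∑ y : E, S.η y * (ψ (ι (S.T y)) * ψ (ι (S.T (x ^ 2 / y)))⁻¹) := by
    simp only [B, Finset.mul_sum]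
    rw [Finset.sum_comm]
    apply Finset.sum_congr rfl
    intro y _
    by_cases h2 : S.T (x ^ 2 / y) = 0
    · simp only [h2, map_zero, inv_zero, mul_zero, MulChar.map_zero]
      by_cases h1 : S.T y = 0
      · simp only [h1, if_true]; rw [← Finset.sum_mul, hsum0, zero_mul]
      · simp [h1]
    · rw [Finset.sum_eq_single (S.T y / S.T (x ^ 2 / y))]
      · rw [if_pos (by field_simp), ← map_mul ψ, map_div₀, div_eq_mul_inv]; ring
      · intro c _ hc
        rw [if_neg, mul_zero]
        intro h; apply hc; field_simp; exact h.symm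
      · simp
  rw [← L]
  have R : ∀ c : F, ψ (ι c) * S.B x c
      = ∑ d : F, if -d ^ 2 = c then ψ (ι c) * S.h (2 * d * S.T x) else 0 := by
    intro c
    by_cases hc : c = 0
    · have z := MulChar.map_zero ψ
      simp [hc, z]
    · rw [S.B_eq hx hc, Finset.mul_sum]
      apply Finset.sum_congr rfl
      intro d _; split_ifs <;> simp
  simp only [R]
  rw [Finset.sum_comm]
  simp only [Finset.sum_ite_eq, Finset.mem_univ, if_true]
  obtain ⟨j, hj⟩ := S.hneg
  have hj0 : j ≠ 0 := by rintro rfl; norm_num at hj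
  have hm1 : ψ (-1) * S.η 2 = 1 := by
    have h1 : ψ (-1) = S.η j := by rw [← hj, map_pow, hψ]
    have hj1 : 1 + j ≠ 0 := by
      intro h
      have : j = -1 := by linear_combination h
      rw [this] at hj
      apply S.h2; linear_combination hj
    rw [h1, ← η_mul, show j * 2 = (1 + j) ^ 2 by linear_combination -hj, S.η_sq hj1]
  have term : ∀ d : F, ψ (ι (-d ^ 2)) * S.h (2 * d * S.T x)
     = Fintype.card F * S.η (ι (S.T x)) * (if d = 0 then 0 else 1) := by
    intro d
    split_ifs with hd
    · simp [hd, S.h_zero]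
    · have hd' : ι d ≠ 0 := by simpa using hd
      rw [h_eq, h_one, map_mul, map_mul, map_ofNat, η_mul, η_mul, map_neg, map_pow,
        neg_eq_neg_one_mul, map_mul, map_pow, hψ]
      linear_combination (Fintype.card F * S.η (ι (S.T x))) * (S.η (ι d) ^ 2 * hm1 + S.η_sq' hd')
  simp only [term]
  rw [← Finset.mul_sum]
  have : ∀ d : F, (if d = 0 then (0 : ℂ) else 1) = 1 - if d = 0 then 1 else 0 := by
    intro d; split_ifs <;> simp
  simp only [this, Finset.sum_sub_distrib]
  simp
  ring

end CubSetup

/-- Let `q = p^h` be a prime power with `q ≡ 1 (mod 4)` and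
`q ≢ 1 (mod 3)`, `E = 𝔽_{q³}`, `T x = x^{q²} + x^q + x` the relative trace,
`α` a generator of `E*`, `μ = α^{q−1}`, `χ₄` the quartic character of `E`
(`χ₄ 0 = 0`, `χ₄ (α^n) = i^n`) and `χ₂ = χ₄²` the quadratic character.  For
`z ∈ {1, i, −1, −i}` let `κ_z(x)` be the number of `0 ≤ i < q² + q + 1` with
`χ₄(T(μ^i x)) · conj(χ₄(T(μ^{−i} x))) = z`.  Then for every `x ∈ E*`,
`κ₁(x) − κ_{−1}(x) = q · χ₂(x) · χ₂(T x)` (identity in `ℂ`). -/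
theorem stmt_10 {p u q : ℕ} (hp : p.Prime) (hu : 0 < u) (hq : q = p ^ u)
    (hq4 : q % 4 = 1) (hq3 : q % 3 ≠ 1)
    {E : Type*} [Field E] [Fintype E] (hE : Fintype.card E = q ^ 3)
    (T : E → E) (hT : ∀ x, T x = x ^ q ^ 2 + x ^ q + x)
    (α : E) (hα : orderOf α = q ^ 3 - 1)
    (μ : E) (hμ : μ = α ^ (q - 1))
    (χ₄ : E → ℂ) (hχ₄0 : χ₄ 0 = 0) (hχ₄ : ∀ n : ℕ, χ₄ (α ^ n) = Complex.I ^ n)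
    (χ₂ : E → ℂ) (hχ₂ : ∀ x, χ₂ x = χ₄ x ^ 2)
    (κ : ℂ → E → ℕ)
    (hκ : ∀ z x, κ z x = ((Finset.range (q ^ 2 + q + 1)).filter fun i =>
        χ₄ (T (μ ^ i * x)) * (starRingEnd ℂ) (χ₄ (T (μ⁻¹ ^ i * x))) = z).card) :
    ∀ x : E, x ≠ 0 →
      (κ 1 x : ℂ) - (κ (-1) x : ℂ) = (q : ℂ) * χ₂ x * χ₂ (T x) := by
  have : Fact p.Prime := ⟨hp⟩
  have hcardp : Fintype.card E = p ^ (u * 3) := by rw [hE, hq, pow_mul]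
  have : CharP E p := charP_of_card_eq_prime_pow (hcardp)
  have hq5 : 5 ≤ q := by
    have h1 : 1 < q := by rw [hq]; exact Nat.one_lt_pow hu.ne' hp.one_lt
    omega
  set N := q ^ 2 + q + 1 with hN
  have hqN : q ^ 3 - 1 = (q - 1) * N := by
    obtain ⟨k, rfl⟩ : ∃ k, q = k + 1 := ⟨q - 1, by omega⟩
    rw [hN, Nat.add_sub_cancel]
    apply Nat.sub_eq_of_eq_add
    ring
  have hNpos : 0 < N := by omega
  have hM : 0 < (q - 1) * N := Nat.mul_pos (by omega) hNpos
  have hcop : Nat.Coprime (q - 1) N := by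
    obtain ⟨k, rfl⟩ : ∃ k, q = k + 1 := ⟨q - 1, by omega⟩
    rw [Nat.add_sub_cancel, hN, show (k + 1) ^ 2 + (k + 1) + 1 = 3 + k * (k + 3) by ring,
      Nat.coprime_add_mul_left_right]
    refine ((Nat.Prime.coprime_iff_not_dvd Nat.prime_three).2 ?_).symm
    intro h; omega
  rw [hqN] at hα
  have hα0 : α ≠ 0 := by
    rintro rfl
    rw [orderOf_zero] at hα; omega
  have hpinj : ∀ n m : ℕ, α ^ n = α ^ m ↔ n % ((q - 1) * N) = m % ((q - 1) * N) := by
    intro n m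
    have h1 : orderOf (Units.mk0 α hα0) = (q - 1) * N := by rw [← hα, ← orderOf_units]; rfl
    have h2 := pow_inj_mod (x := Units.mk0 α hα0) (n := n) (m := m)
    rw [h1, Units.ext_iff] at h2
    simpa using h2
  have hcard' : (Finset.univ.erase (0 : E)).card = (q - 1) * N := by
    rw [Finset.card_erase_of_mem (Finset.mem_univ _), Finset.card_univ, hE, hqN]
  have himg : Finset.image (fun n => α ^ n) (Finset.range ((q - 1) * N)) = Finset.univ.erase 0 := by
    apply Finset.eq_of_subset_of_card_le
    · intro y hy
      obtain ⟨n, -, rfl⟩ := Finset.mem_image.1 hy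
      simp [hα0]
    · rw [hcard', Finset.card_image_of_injOn, Finset.card_range]
      intro a ha b hb hab
      have this := (hpinj _ _).1 hab
      simp only [Finset.coe_range, Set.mem_Iio] at ha hb
      rwa [Nat.mod_eq_of_lt ha, Nat.mod_eq_of_lt hb] at this
  have hgen : ∀ y : E, y ≠ 0 → ∃ n < (q - 1) * N, α ^ n = y := by
    intro y hy
    have : y ∈ Finset.image (fun n => α ^ n) (Finset.range ((q - 1) * N)) := by
      rw [himg]; simp [hy]
    obtain ⟨n, hn, h⟩ := Finset.mem_image.1 this
    exact ⟨n, Finset.mem_range.1 hn, h⟩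
  have hpowE : ∀ y : E, y ^ q ^ 3 = y := by intro y; rw [← hE]; exact FiniteField.pow_card y
  -- the subfield
  let σ : E →+* E := iterateFrobenius E p u
  have hσ : ∀ y, σ y = y ^ q := by intro y; rw [hq]; rfl
  let K : Subfield E := 
    { carrier := {y | y ^ q = y}
      mul_mem' := by
        intro a b ha hb
        simp only [Set.mem_ofPred_eq, ← hσ] at *
        rw [map_mul, ha, hb]
      one_mem' := by simp
      add_mem' := by
        intro a b ha hb
        simp only [Set.mem_ofPred_eq, ← hσ] at *
        rw [map_add, ha, hb]
      zero_mem' := by simp; omega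
      neg_mem' := by
        intro a ha
        simp only [Set.mem_ofPred_eq, ← hσ] at *
        rw [map_neg, ha]
      inv_mem' := by
        intro a ha
        simp only [Set.mem_ofPred_eq, ← hσ] at *
        rw [map_inv₀, ha] }
  have hK : ∀ y, y ∈ K ↔ y ^ q = y := fun y => Iff.rfl
  have hωK : ∀ j, α ^ (N * j) ∈ K := by
    intro j
    rw [hK, ← pow_mul]
    rw [hpinj]
    have : N * j * q = N * j + (q - 1) * N * j := by
      obtain ⟨k, rfl⟩ : ∃ k, q = k + 1 := ⟨q - 1, by omega⟩
      rw [Nat.add_sub_cancel]; ring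
    rw [this, Nat.add_mul_mod_self_left]
  have hcardK : Fintype.card K = q := by
    have e : (Finset.univ.filter fun y => y ∈ K) =
        insert 0 (Finset.image (fun j => α ^ (N * j)) (Finset.range (q - 1))) := by
      ext y
      simp only [Finset.mem_filter, Finset.mem_univ, true_and, Finset.mem_insert, Finset.mem_image,
        Finset.mem_range]
      constructor
      · intro hy
        by_cases hy0 : y = 0
        · left; exact hy0
        right
        obtain ⟨n, hn, rfl⟩ := hgen y hy0
        rw [hK, ← pow_mul] at hy
        have h1 := (hpinj _ _).1 hy
        have h2 : (q - 1) * N ∣ (q - 1) * n := by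
          have h3 := (Nat.modEq_iff_dvd' (Nat.le_mul_of_pos_right n (by omega : 0 < q))).1 h1.symm
          have : n * q - n = (q - 1) * n := by
            obtain ⟨k, rfl⟩ : ∃ k, q = k + 1 := ⟨q - 1, by omega⟩
            rw [Nat.add_sub_cancel]
            apply Nat.sub_eq_of_eq_add; ring
          rwa [this] at h3
        obtain ⟨j, rfl⟩ := Nat.dvd_of_mul_dvd_mul_left (by omega) h2
        refine ⟨j, ?_, rfl⟩
        rw [mul_comm] at hn
        exact Nat.lt_of_mul_lt_mul_right hn
      · rintro (rfl | ⟨j, -, rfl⟩)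
        · exact K.zero_mem
        · exact hωK j
    rw [Fintype.card_subtype, e, Finset.card_insert_of_notMem, Finset.card_image_of_injOn,
      Finset.card_range]
    · omega
    · intro a ha b hb hab
      have this := (hpinj _ _).1 hab
      simp only [Finset.coe_range, Set.mem_Iio] at ha hb
      have h1 : N * a < (q - 1) * N := by rw [mul_comm]; exact Nat.mul_lt_mul_of_pos_right ha hNpos
      have h2 : N * b < (q - 1) * N := by rw [mul_comm]; exact Nat.mul_lt_mul_of_pos_right hb hNpos
      rw [Nat.mod_eq_of_lt h1, Nat.mod_eq_of_lt h2] at this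
      exact Nat.eq_of_mul_eq_mul_left hNpos this
    · simp [hα0]
  have hσ3 : ∀ y, σ (σ (σ y)) = y := by
    intro y
    rw [hσ, hσ, hσ, ← pow_mul, ← pow_mul]
    convert hpowE y using 2
    ring
  have hTσ : ∀ y, T y = σ (σ y) + σ y + y := by
    intro y; rw [hT, hσ, hσ, ← pow_mul, sq]
  have hTK : ∀ y, T y ∈ K := by
    intro y
    rw [hK, ← hσ, hTσ]
    simp only [map_add, hσ3]; ring
  let S : CubSetup K E :=
    { σ := σ
      T := fun y => ⟨T y, hTK y⟩
      hT := fun y => hTσ y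
      h3 := hσ3
      hF := fun c => by rw [hσ]; exact c.2
      hfix := fun y hy => ⟨⟨y, by rw [hK, ← hσ, hy]⟩, rfl⟩
      hcard := by rw [hcardK, hE]
      h2 := by
        intro h
        have h1 : p ∣ 2 := (CharP.cast_eq_zero_iff E p 2).1 (by exact_mod_cast h)
        have h2 : p = 2 := (Nat.prime_dvd_prime_iff_eq hp Nat.prime_two).1 h1
        have h3 : 2 ∣ q := by rw [hq, h2]; exact dvd_pow_self _ hu.ne'
        omega
      hneg := by
        have h : IsSquare (-1 : E) := by
          rw [FiniteField.isSquare_neg_one_iff, hE, Nat.pow_mod, hq4]; norm_num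
        obtain ⟨j, hj⟩ := h
        exact ⟨j, by rw [hj, sq]⟩
      hcube := by
        intro a ha
        have ha0 : a ≠ 0 := by rintro rfl; norm_num at ha
        have h1 : a ^ (q ^ 3 - 1) = 1 := by rw [← hE]; exact FiniteField.pow_card_sub_one_eq_one a ha0
        have h2 : Nat.gcd 3 (q ^ 3 - 1) = 1 := by
          refine (Nat.Prime.coprime_iff_not_dvd Nat.prime_three).2 ?_
          intro h
          have h3 : q ^ 3 % 3 = 1 := by
            have : 1 ≤ q ^ 3 := Nat.one_le_pow _ _ (by omega)
            omega
          have : q % 3 = 0 ∨ q % 3 = 2 := by omega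
          rcases this with h | h <;> · rw [Nat.pow_mod, h] at h3; norm_num at h3
        have h3 := pow_gcd_eq_one.2 ⟨ha, h1⟩
        rwa [h2, pow_one] at h3 }
  have hST : ∀ y, algebraMap K E (S.T y) = T y := fun y => rfl
  -- the character
  let ψ : MulChar E ℂ :=
    { toFun := χ₄
      map_one' := by have := hχ₄ 0; simpa using this
      map_mul' := by
        intro a b
        by_cases ha : a = 0
        · simp [ha, hχ₄0]
        by_cases hb : b = 0
        · simp [hb, hχ₄0]
        obtain ⟨n, -, rfl⟩ := hgen a ha
        obtain ⟨m, -, rfl⟩ := hgen b hb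
        rw [← pow_add, hχ₄, hχ₄, hχ₄, pow_add]
      map_nonunit' := by
        intro a ha
        have : a = 0 := by by_contra h; exact ha (isUnit_iff_ne_zero.2 h)
        rw [this, hχ₄0] }
  have hψ' : ∀ y, ψ y = χ₄ y := fun y => rfl
  have heven : 2 ∣ (q - 1) * N := Dvd.dvd.mul_right (by omega) _
  have hψ : ∀ y, ψ y ^ 2 = S.η y := by
    intro y
    by_cases hy : y = 0
    · rw [hy, S.η_zero, hψ', hχ₄0]; norm_num
    obtain ⟨n, -, rfl⟩ := hgen y hy
    rw [hψ', hχ₄]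
    rcases Nat.even_or_odd' n with ⟨m, rfl | rfl⟩
    · rw [show α ^ (2 * m) = (α ^ m) ^ 2 by rw [← pow_mul, mul_comm], S.η_sq (pow_ne_zero _ hα0),
        pow_mul, Complex.I_sq, ← pow_mul, mul_comm, pow_mul]
      norm_num
    · rw [S.η_nonsq]
      · rw [← pow_mul, mul_comm, pow_mul, Complex.I_sq, pow_succ, pow_mul]; norm_num
      · rintro ⟨z, hz⟩
        have hz0 : z ≠ 0 := by rintro rfl; simp [hα0] at hz
        obtain ⟨k, -, rfl⟩ := hgen z hz0
        rw [← pow_add] at hz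
        have h1 := (hpinj _ _).1 hz
        have h2 := Nat.ModEq.of_dvd heven h1
        unfold Nat.ModEq at h2
        omega
  have hconj : ∀ y, (starRingEnd ℂ) (χ₄ y) = ψ y⁻¹ := by
    intro y
    by_cases hy : y = 0
    · rw [hy, hχ₄0, inv_zero, hψ', hχ₄0, map_zero]
    have h1 : ψ y⁻¹ * ψ y = 1 := by rw [← map_mul, inv_mul_cancel₀ hy, map_one]
    have h2 : (starRingEnd ℂ) (χ₄ y) * ψ y = 1 := by
      obtain ⟨n, -, rfl⟩ := hgen y hy
      rw [hψ', hχ₄, map_pow, Complex.conj_I, ← mul_pow]; simp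
    have h3 : ψ y ≠ 0 := right_ne_zero_of_mul_eq_one h1
    exact mul_right_cancel₀ h3 (h2.trans h1.symm)
  intro x hx
  -- evaluation of the character sum
  let f : E → ℂ := fun y => S.η y * (ψ (T (y * x)) * ψ (T (y⁻¹ * x))⁻¹)
  have hf1 : ∑ y : E, f y = S.η x * (q * (q - 1) * S.η (T x)) := by
    have h1 := S.main ψ hψ hx
    rw [hcardK] at h1
    simp only [hST] at h1
    rw [← h1, Finset.mul_sum]
    apply Fintype.sum_equiv (Equiv.mulRight₀ x hx)
    intro y
    simp only [f, Equiv.mulRight₀_apply, S.η_mul]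
    have h2 : x ^ 2 / (y * x) = y⁻¹ * x := by
      by_cases hy : y = 0
      · simp [hy]
      · field_simp
    rw [h2]
    linear_combination (-S.η y * (ψ (T (y * x)) * ψ (T (y⁻¹ * x))⁻¹)) * S.η_sq' hx
  have hTc : ∀ c ∈ K, ∀ y, T (c * y) = c * T y := by
    intro c hc y
    have := congrArg (algebraMap K E) (S.T_smul ⟨c, hc⟩ y)
    exact this
  have hf2 : ∀ c ∈ K, c ≠ 0 → ∀ y, f (c * y) = f y := by
    intro c hc hc0 y
    simp only [f]
    rw [mul_inv, mul_assoc, mul_assoc, hTc c hc, hTc c⁻¹ (K.inv_mem hc), mul_inv, inv_inv, S.η_mul,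
      map_mul ψ, map_mul ψ]
    have h1 := hψ c
    have h2 := S.η_sq' hc0
    rw [← h1] at h2 ⊢
    linear_combination (S.η y * (ψ (T (y * x)) * ψ (T (y⁻¹ * x))⁻¹)) * h2
  have hf3 : ∀ i, f (μ ^ i) = χ₄ (T (μ ^ i * x)) * (starRingEnd ℂ) (χ₄ (T (μ⁻¹ ^ i * x))) := by
    intro i
    simp only [f]
    rw [hconj, inv_pow, hψ']
    have : S.η (μ ^ i) = 1 := by
      obtain ⟨k, hk⟩ : ∃ k, q - 1 = k * 2 := ⟨(q - 1) / 2, by omega⟩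
      rw [hμ, ← pow_mul, hk, show k * 2 * i = (k * i) * 2 by ring, pow_mul]
      exact S.η_sq (pow_ne_zero _ hα0)
    rw [this, one_mul]
  have hf4 : ∑ y : E, f y = (q - 1) * ∑ i ∈ Finset.range N, f (μ ^ i) := by
    have hinj : Set.InjOn (fun v : ℕ × ℕ => α ^ (N * v.1) * μ ^ v.2)
        ((Finset.range (q - 1) ×ˢ Finset.range N : Finset (ℕ × ℕ)) : Set (ℕ × ℕ)) := by
      rintro ⟨a, b⟩ hv ⟨a', b'⟩ hv' h
      simp only [Finset.coe_product, Finset.coe_range, Set.mem_prod, Set.mem_Iio] at hv hv'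
      simp only [hμ, ← pow_mul, ← pow_add] at h
      have h1 := (hpinj _ _).1 h
      change _ ≡ _ [MOD _] at h1
      have hb : b = b' := by
        have h2 := Nat.ModEq.of_dvd (Dvd.intro_left (q - 1) rfl : N ∣ (q - 1) * N) h1
        unfold Nat.ModEq at h2
        rw [Nat.mul_add_mod, Nat.mul_add_mod] at h2
        have h3 := Nat.ModEq.cancel_left_of_coprime (by rw [Nat.gcd_comm]; exact hcop) h2
        unfold Nat.ModEq at h3
        rwa [Nat.mod_eq_of_lt hv.2, Nat.mod_eq_of_lt hv'.2] at h3
      have ha : a = a' := by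
        have h2 := Nat.ModEq.of_dvd (Dvd.intro N rfl : (q - 1) ∣ (q - 1) * N) h1
        unfold Nat.ModEq at h2
        rw [Nat.add_mul_mod_self_left, Nat.add_mul_mod_self_left] at h2
        have h3 := Nat.ModEq.cancel_left_of_coprime hcop h2
        unfold Nat.ModEq at h3
        rwa [Nat.mod_eq_of_lt hv.1, Nat.mod_eq_of_lt hv'.1] at h3
      rw [ha, hb]
    have himg2 : Finset.image (fun v : ℕ × ℕ => α ^ (N * v.1) * μ ^ v.2)
        (Finset.range (q - 1) ×ˢ Finset.range N) = Finset.univ.erase 0 := by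
      apply Finset.eq_of_subset_of_card_le
      · intro y hy
        obtain ⟨n, -, rfl⟩ := Finset.mem_image.1 hy
        simp [hα0, hμ]
      · rw [hcard', Finset.card_image_of_injOn hinj, Finset.card_product, Finset.card_range,
          Finset.card_range]
    rw [← Finset.sum_erase Finset.univ (a := (0 : E)) (by simp only [f]; rw [S.η_zero, zero_mul]),
      ← himg2, Finset.sum_image hinj, Finset.sum_product]
    have : ∀ j i : ℕ, f (α ^ (N * j) * μ ^ i) = f (μ ^ i) := fun j i =>
      hf2 _ (hωK j) (pow_ne_zero _ hα0) _
    simp only [this]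
    rw [Finset.sum_const, Finset.card_range, nsmul_eq_mul, Nat.cast_sub (by omega), Nat.cast_one]
  have hq1 : (q : ℂ) - 1 ≠ 0 := by
    rw [sub_ne_zero]; norm_cast; omega
  have hS : ∑ i ∈ Finset.range N, f (μ ^ i) = q * S.η x * S.η (T x) := by
    apply mul_left_cancel₀ hq1
    rw [← hf4, hf1]; ring
  have hreal : ∀ y, (starRingEnd ℂ) (S.η y) = S.η y := by
    intro y; simp [CubSetup.η]
  have hval : ∀ y, χ₄ y = 0 ∨ χ₄ y = 1 ∨ χ₄ y = -1 ∨ χ₄ y = Complex.I ∨ χ₄ y = -Complex.I := by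
    intro y
    by_cases hy : y = 0
    · left; rw [hy, hχ₄0]
    right
    obtain ⟨n, -, rfl⟩ := hgen y hy
    rw [hχ₄, Complex.I_pow_eq_pow_mod]
    have : n % 4 < 4 := Nat.mod_lt _ (by norm_num)
    interval_cases n % 4 <;> simp
  have hI1 : Complex.I ≠ 1 := by intro h; have := congrArg Complex.re h; simp at this
  have hI2 : Complex.I ≠ -1 := by intro h; have := congrArg Complex.re h; simp at this
  have hI3 : -Complex.I ≠ 1 := by intro h; have := congrArg Complex.re h; simp at this
  have hterm : ∀ a b : E, (if χ₄ a * (starRingEnd ℂ) (χ₄ b) = 1 then (1 : ℂ) else 0)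
      - (if χ₄ a * (starRingEnd ℂ) (χ₄ b) = -1 then (1 : ℂ) else 0)
      = (χ₄ a * (starRingEnd ℂ) (χ₄ b) + (starRingEnd ℂ) (χ₄ a * (starRingEnd ℂ) (χ₄ b))) / 2 := by
    intro a b
    have h11 : (1 : ℂ) ≠ -1 := by norm_num
    have h12 : (-1 : ℂ) ≠ 1 := by norm_num
    rcases hval a with h | h | h | h | h <;> rcases hval b with h' | h' | h' | h' | h' <;>
      rw [h, h'] <;> simp [hI1, hI2, hI3, h11, h12]
  rw [hκ, hκ, hχ₂, hχ₂, ← hψ', ← hψ', hψ, hψ, ← hS]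
  rw [← Finset.sum_boole, ← Finset.sum_boole, ← Finset.sum_sub_distrib]
  simp only [hterm]
  simp only [← hf3]
  rw [← Finset.sum_div, Finset.sum_add_distrib, ← map_sum, hS]
  simp only [map_mul, hreal, map_natCast]
  ring
end

section
/- The set S = { a ∈ E : N(a) = 1 and T(a²) = 0 } has exactly q + 1 elements. -/
open scoped Classical

/-- Let `q = p^h` be a prime power with `q ≡ 1 (mod 4)` and
`q ≢ 1 (mod 3)`, `E = 𝔽_{q³}`, `T x = x^{q²} + x^q + x` the relative trace and
`N x = x^{q²+q+1}` the relative norm.  Then the set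
`S = {a ∈ E : N a = 1 and T (a²) = 0}` has exactly `q + 1` elements. -/
theorem stmt_12 {p h q : ℕ} (hp : p.Prime) (hh : 0 < h) (hq : q = p ^ h)
    (hq4 : q % 4 = 1) (hq3 : q % 3 ≠ 1)
    {E : Type*} [Field E] [Fintype E] (hE : Fintype.card E = q ^ 3)
    (T N : E → E)
    (hT : ∀ x, T x = x ^ q ^ 2 + x ^ q + x)
    (hN : ∀ x, N x = x ^ (q ^ 2 + q + 1)) :
    (Finset.univ.filter fun a : E => N a = 1 ∧ T (a ^ 2) = 0).card = q + 1 := by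
  obtain ⟨t, rfl⟩ : ∃ t, q = t + 1 := ⟨q - 1, by omega⟩
  have : Fact p.Prime := ⟨hp⟩
  have hcard : Fintype.card E = p ^ (h * 3) := by rw [hE, hq, pow_mul]
  have : CharP E p := charP_of_card_eq_prime_pow hcard
  set m := (t + 1) ^ 2 + (t + 1) + 1 with hm
  have hm1 : 1 < m := by rw [hm]; nlinarith
  -- coprimality
  have hcop : Nat.Coprime (2 * t) m := by
    apply Nat.Coprime.mul_left
    · rw [Nat.coprime_two_left, hm]
      have : Odd (t + 1) := by rw [Nat.odd_iff]; omega
      rw [Nat.odd_iff] at this ⊢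
      have h2 : (t + 1) ^ 2 % 2 = 1 := by rw [Nat.pow_mod, this]
      omega
    · have h3 : Nat.Coprime t 3 := by
        rw [Nat.coprime_comm, Nat.Prime.coprime_iff_not_dvd Nat.prime_three]
        omega
      have : m = 3 + (t + 3) * t := by rw [hm]; ring
      rw [this]
      exact (Nat.coprime_add_mul_right_right t 3 (t + 3)).mpr h3
  obtain ⟨l, -, hl⟩ := Nat.exists_mul_mod_eq_one_of_coprime hcop hm1
  have hkl : ∀ a : E, a ^ m = 1 → a ^ (2 * t * l) = a := by
    intro a ha
    rw [pow_eq_pow_mod _ ha, hl, pow_one]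
  let f : Polynomial E := Polynomial.X ^ (t + 2) + Polynomial.X + 1
  have hfdeg : f.natDegree = t + 2 := by
    have : f = Polynomial.X ^ (t + 2) + (Polynomial.X + Polynomial.C 1) := by
      simp [f, add_assoc]
    rw [this, Polynomial.natDegree_add_eq_left_of_natDegree_lt, Polynomial.natDegree_X_pow]
    rw [Polynomial.natDegree_X_pow, Polynomial.natDegree_X_add_C]
    omega
  have hf0 : f ≠ 0 := by
    intro h0; rw [h0] at hfdeg; simp at hfdeg
  have hfrob : f ^ (t + 1) = (Polynomial.X ^ (t + 2)) ^ (t + 1) + Polynomial.X ^ (t + 1) + 1 := by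
    simp only [f]
    rw [hq, add_pow_char_pow, add_pow_char_pow, one_pow]
  have hfm : f ∣ Polynomial.X ^ m - 1 := by
    have e : (Polynomial.X ^ m - 1 : Polynomial E) = Polynomial.X * f ^ (t + 1) - f := by
      rw [hfrob, hm]; simp only [f]; ring
    rw [e]
    exact dvd_sub (Dvd.dvd.mul_left (dvd_pow_self f (by omega)) _) dvd_rfl
  have hfE : f ∣ Polynomial.X ^ Fintype.card E - Polynomial.X := by
    have e : Fintype.card E = m * t + 1 := by rw [hE, hm]; ring
    have e2 : (Polynomial.X ^ Fintype.card E - Polynomial.X : Polynomial E)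
        = ((Polynomial.X ^ m) ^ t - 1 ^ t) * Polynomial.X := by
      rw [e]; ring
    rw [e2]
    exact (hfm.trans (sub_dvd_pow_sub_pow _ _ t)).mul_right _
  have hne : (Polynomial.X ^ Fintype.card E - Polynomial.X : Polynomial E) ≠ 0 :=
    FiniteField.X_pow_card_sub_X_ne_zero E Fintype.one_lt_card
  have hroots : (Polynomial.X ^ Fintype.card E - Polynomial.X : Polynomial E).roots
      = Finset.univ.val := FiniteField.roots_X_pow_card_sub_X E
  have hsplitbig : (Polynomial.X ^ Fintype.card E - Polynomial.X : Polynomial E).Splits := by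
    rw [Polynomial.splits_iff_card_roots, hroots,
      FiniteField.X_pow_card_sub_X_natDegree_eq E Fintype.one_lt_card]
    rfl
  have hsplit : f.Splits := hsplitbig.of_dvd hne hfE
  have hnodup : f.roots.Nodup := by
    refine Multiset.nodup_of_le (Polynomial.roots.le_of_dvd hne hfE) ?_
    rw [hroots]; exact Finset.univ.nodup
  have hcount : f.roots.toFinset.card = t + 2 := by
    rw [Multiset.toFinset_card_of_nodup hnodup, ← hfdeg]
    exact (Polynomial.splits_iff_card_roots.mp hsplit)
  have hmem : ∀ u : E, u ∈ f.roots.toFinset ↔ u ^ (t + 2) + u + 1 = 0 := by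
    intro u
    rw [Multiset.mem_toFinset, Polynomial.mem_roots hf0]
    simp [f, Polynomial.IsRoot]
  have hum : ∀ u : E, u ∈ f.roots.toFinset → u ^ m = 1 := by
    intro u hu
    rw [Multiset.mem_toFinset, Polynomial.mem_roots hf0] at hu
    have := hu.dvd hfm
    simpa [Polynomial.IsRoot, sub_eq_zero] using this
  have hTT : ∀ a : E, T (a ^ 2) = a ^ 2 * ((a ^ (2 * t)) ^ (t + 2) + a ^ (2 * t) + 1) := by
    intro a; rw [hT]; ring
  rw [show t + 1 + 1 = t + 2 from rfl, ← hcount]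
  refine Finset.card_bij' (fun a _ => a ^ (2 * t)) (fun u _ => u ^ l) ?_ ?_ ?_ ?_
  · intro a ha
    simp only [Finset.mem_filter, Finset.mem_univ, true_and, hN, hTT] at ha
    obtain ⟨h1, h2⟩ := ha
    have ha0 : a ≠ 0 := by
      rintro rfl
      rw [zero_pow (by omega)] at h1
      exact zero_ne_one h1
    rw [hmem]
    exact (mul_eq_zero.mp h2).resolve_left (pow_ne_zero 2 ha0)
  · intro u hu
    have h1 := hum u hu
    simp only [Finset.mem_filter, Finset.mem_univ, true_and, hN, hTT]
    refine ⟨?_, ?_⟩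
    · change (u ^ l) ^ m = 1
      rw [← pow_mul, mul_comm, pow_mul, h1, one_pow]
    · have : (u ^ l) ^ (2 * t) = u := by
        rw [← pow_mul, mul_comm l, hkl u h1]
      rw [this, (hmem u).mp hu, mul_zero]
  · intro a ha
    simp only [Finset.mem_filter, Finset.mem_univ, true_and, hN] at ha
    change (a ^ (2 * t)) ^ l = a
    rw [← pow_mul, hkl a ha.1]
  · intro u hu
    change (u ^ l) ^ (2 * t) = u
    rw [← pow_mul, mul_comm l, hkl u (hum u hu)]
end

section
/- Let a, b ∈ E* with N(a) = N(b) = 1 and T(a²) = T(b²) = 0. Then (i) κ₁(a², b²) = κ₃(a², b²), and (ii) κ₀(a², b²) − κ₂(a², b²) = q · χ₂(2·T(ab)) (an identity in ℂ, the integer difference on the left being coerced into ℂ and χ₂ applied to the image of 2·T(ab) in E). -/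
open scoped Classical

namespace Aux14

/-- relative trace -/
def Tr {E : Type*} [Field E] (q : ℕ) (x : E) : E := x ^ q ^ 2 + x ^ q + x

section salie
variable {E : Type*} [Field E] [Fintype E]

lemma salie_fiber (h2 : (2:E) ≠ 0) (hm1 : IsSquare (-1:E))
    (c h : E) (hc : c ≠ 0) :
    ∑ z : E, (if z ≠ 0 ∧ z + c^2 / z = h then quadraticChar E z else 0)
      = quadraticChar E (h - 2*c) + quadraticChar E (h + 2*c) := by
  have key : ∀ z : E, (z ≠ 0 ∧ z + c^2/z = h) ↔ z^2 - h*z + c^2 = 0 := by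
    intro z
    constructor
    · rintro ⟨hz, e⟩
      field_simp at e
      linear_combination e
    · intro e
      have hz : z ≠ 0 := by
        rintro rfl
        apply hc
        simpa using e
      refine ⟨hz, ?_⟩
      field_simp
      linear_combination e
  have h4 : ∀ x : E, quadraticChar E (2*(2*x)) = quadraticChar E x := by
    intro x
    have : 2*(2*x) = 2^2*x := by ring
    rw [this, map_mul, quadraticChar_sq_one' h2, one_mul]
  have hneg : quadraticChar E (-1) = 1 := by
    rw [quadraticChar_one_iff_isSquare (by simp)]; exact hm1
  rw [← Finset.sum_filter]
  by_cases hA : h = 2*c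
  · have : (Finset.univ.filter fun z : E => z ≠ 0 ∧ z + c^2/z = h) = {c} := by
      ext z
      simp only [Finset.mem_filter, Finset.mem_univ, true_and, Finset.mem_singleton, key]
      constructor
      · intro e
        have : (z - c)^2 = 0 := by rw [hA] at e; linear_combination e
        exact sub_eq_zero.mp (pow_eq_zero_iff (by norm_num) |>.mp this)
      · rintro rfl; rw [hA]; ring
    rw [this, hA]
    have e2 : 2*c+2*c = 2*(2*c) := by ring
    rw [e2, h4]; simp
  by_cases hB : h = -(2*c)
  · have : (Finset.univ.filter fun z : E => z ≠ 0 ∧ z + c^2/z = h) = {-c} := by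
      ext z
      simp only [Finset.mem_filter, Finset.mem_univ, true_and, Finset.mem_singleton, key]
      constructor
      · intro e
        have : (z + c)^2 = 0 := by rw [hB] at e; linear_combination e
        exact eq_neg_of_add_eq_zero_left (pow_eq_zero_iff (by norm_num) |>.mp this)
      · rintro rfl; rw [hB]; ring
    rw [this, hB]
    have e2 : -(2*c)-2*c = 2*(2*(-c)) := by ring
    rw [e2, h4]; simp
  have hA' : h - 2*c ≠ 0 := sub_ne_zero.mpr hA
  have hB' : h + 2*c ≠ 0 := fun e => hB (eq_neg_of_add_eq_zero_left e)
  have val1 : ∀ z : E, z ≠ 0 → z^2 - h*z + c^2 = 0 →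
      quadraticChar E z = quadraticChar E (h - 2*c) := by
    intro z hz e
    have e1 : z*(h-2*c) = (z-c)^2 := by linear_combination -e
    have hzc : z - c ≠ 0 := by
      intro h0; rw [h0] at e1
      exact mul_ne_zero hz hA' (by simpa using e1)
    have e3 : quadraticChar E z * quadraticChar E (h-2*c) = 1 := by
      rw [← map_mul, e1, quadraticChar_sq_one' hzc]
    rcases quadraticChar_dichotomy hz with h1 | h1 <;>
    rcases quadraticChar_dichotomy hA' with h3 | h3 <;> rw [h1, h3] at e3 <;> simp_all
  have val2 : ∀ z : E, z ≠ 0 → z^2 - h*z + c^2 = 0 →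
      quadraticChar E z = quadraticChar E (h + 2*c) := by
    intro z hz e
    have e1 : z*(h+2*c) = (z+c)^2 := by linear_combination -e
    have hzc : z + c ≠ 0 := by
      intro h0; rw [h0] at e1
      exact mul_ne_zero hz hB' (by simpa using e1)
    have e3 : quadraticChar E z * quadraticChar E (h+2*c) = 1 := by
      rw [← map_mul, e1, quadraticChar_sq_one' hzc]
    rcases quadraticChar_dichotomy hz with h1 | h1 <;>
    rcases quadraticChar_dichotomy hB' with h3 | h3 <;> rw [h1, h3] at e3 <;> simp_all
  have hprod : (h-2*c)*(h+2*c) ≠ 0 := mul_ne_zero hA' hB'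
  by_cases hd : IsSquare ((h-2*c)*(h+2*c))
  · obtain ⟨d, hd⟩ := hd
    have hd0 : d ≠ 0 := by rintro rfl; simp at hd; tauto
    have hr1 : ((h+d)/2)^2 - h*((h+d)/2) + c^2 = 0 := by
      field_simp
      linear_combination -hd
    have hr2 : ((h-d)/2)^2 - h*((h-d)/2) + c^2 = 0 := by
      field_simp
      linear_combination -hd
    have hne : (h+d)/2 ≠ (h-d)/2 := by
      intro e
      field_simp at e
      apply hd0
      have : 2 * d = 0 := by linear_combination e
      simpa [h2] using this
    have : (Finset.univ.filter fun z : E => z ≠ 0 ∧ z + c^2/z = h) = {(h+d)/2, (h-d)/2} := by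
      ext z
      simp only [Finset.mem_filter, Finset.mem_univ, true_and, Finset.mem_singleton, key,
        Finset.mem_insert]
      constructor
      · intro e
        have : (z - (h+d)/2) * (z - (h-d)/2) = 0 := by
          field_simp
          linear_combination 4*e+hd
        rcases mul_eq_zero.mp this with h1 | h1
        · left; exact sub_eq_zero.mp h1
        · right; exact sub_eq_zero.mp h1
      · rintro (rfl | rfl) <;> assumption
    rw [this, Finset.sum_pair hne, val1 _ ((key _).mpr hr1).1 hr1, val2 _ ((key _).mpr hr2).1 hr2]
  · have : (Finset.univ.filter fun z : E => z ≠ 0 ∧ z + c^2/z = h) = ∅ := by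
      ext z
      simp only [Finset.mem_filter, Finset.mem_univ, true_and, key, Finset.notMem_empty, iff_false]
      intro e
      apply hd
      exact ⟨2*z-h, by linear_combination -4*e⟩
    rw [this, Finset.sum_empty]
    have e3 : quadraticChar E (h-2*c) * quadraticChar E (h+2*c) = -1 := by
      rw [← map_mul]; exact quadraticChar_neg_one_iff_not_isSquare.mpr hd
    rcases quadraticChar_dichotomy hB' with h1 | h1 <;>
    rcases quadraticChar_dichotomy hA' with h3 | h3 <;> rw [h1, h3] at e3 ⊢ <;> simp_all

lemma salie (h2 : (2:E) ≠ 0) (hm1 : IsSquare (-1:E))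
    (a b : E) (ha : a ≠ 0) (hb : b ≠ 0) (P : E → Prop) :
    ∑ z ∈ Finset.univ.filter (fun z : E => z ≠ 0),
       (if P (z * a^2 + z⁻¹ * b^2) then quadraticChar E z else 0)
      = ∑ h : E, (if P (h + 2*(a*b)) then quadraticChar E h else 0)
        + ∑ h : E, (if P (h - 2*(a*b)) then quadraticChar E h else 0) := by
  have hab : a*b ≠ 0 := mul_ne_zero ha hb
  have ha2 : a^2 ≠ 0 := pow_ne_zero 2 ha
  have s1 : ∑ z ∈ Finset.univ.filter (fun z : E => z ≠ 0),
       (if P (z * a^2 + z⁻¹ * b^2) then quadraticChar E z else 0)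
      = ∑ z : E, (if z ≠ 0 ∧ P (z + (a*b)^2/z) then quadraticChar E z else 0) := by
    rw [Finset.sum_filter]
    refine Fintype.sum_equiv (Equiv.mulRight₀ (a^2) ha2) _ _ ?_
    intro z
    simp only [Equiv.mulRight₀_apply]
    by_cases hz : z = 0
    · simp [hz]
    have e : z * a^2 + (a*b)^2/(z*a^2) = z * a^2 + z⁻¹ * b^2 := by field_simp
    have e' : quadraticChar E (z*a^2) = quadraticChar E z := by
      rw [map_mul, quadraticChar_sq_one' ha, mul_one]
    rw [e, e']
    simp [hz, ha]
  have s2 : ∑ z : E, (if z ≠ 0 ∧ P (z + (a*b)^2/z) then quadraticChar E z else 0)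
     = ∑ h : E, (if P h then (quadraticChar E (h - 2*(a*b)) + quadraticChar E (h + 2*(a*b))) else 0) := by
    simp_rw [← salie_fiber h2 hm1 (a*b) _ hab]
    have : ∀ h : E, (if P h then ∑ z : E, (if z ≠ 0 ∧ z + (a*b)^2 / z = h then quadraticChar E z else 0) else 0)
       = ∑ z : E, (if z + (a*b)^2/z = h then (if z ≠ 0 ∧ P (z + (a*b)^2/z) then quadraticChar E z else 0) else 0) := by
      intro h
      split_ifs with hP
      · refine Finset.sum_congr rfl fun z _ => ?_
        by_cases e : z + (a*b)^2/z = h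
        · simp [e, hP]
        · simp [e]
      · symm
        refine Finset.sum_eq_zero fun z _ => ?_
        by_cases e : z + (a*b)^2/z = h
        · simp [e, hP]
        · simp [e]
    simp_rw [this]
    rw [Finset.sum_comm]
    simp
  rw [s1, s2]
  have : ∀ h : E, (if P h then (quadraticChar E (h - 2*(a*b)) + quadraticChar E (h + 2*(a*b))) else 0)
    = (if P h then (quadraticChar E (h - 2*(a*b))) else 0) + (if P h then (quadraticChar E (h + 2*(a*b))) else 0) := by
    intro h; split_ifs <;> simp
  simp_rw [this]
  rw [Finset.sum_add_distrib]
  congr 1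
  · symm
    refine Fintype.sum_equiv (Equiv.addRight (2*(a*b))) _ _ ?_
    intro h; simp
  · symm
    refine Fintype.sum_equiv (Equiv.subRight (2*(a*b))) _ _ ?_
    intro h; simp
end salie

section trace
variable {E : Type*} [Field E] [Fintype E] {q : ℕ}

lemma Tr_add (hadd : ∀ x y : E, (x+y)^q = x^q+y^q) (x y : E) :
    Tr q (x+y) = Tr q x + Tr q y := by
  have h2 : ∀ x y : E, (x+y)^q^2 = x^q^2+y^q^2 := by
    intro x y; rw [pow_two q, pow_mul, hadd, hadd, ← pow_mul, ← pow_mul]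
  simp only [Tr, h2, hadd]; ring

lemma Tr_smul (f x : E) (hf : f^q = f) : Tr q (f*x) = f * Tr q x := by
  have h2 : f^q^2 = f := by rw [pow_two q, pow_mul, hf, hf]
  simp only [Tr, mul_pow, h2, hf]; ring

lemma Tr_fix (hadd : ∀ x y : E, (x+y)^q = x^q+y^q) (hcube : ∀ x : E, x^q^3 = x) (x : E) :
    (Tr q x)^q = Tr q x := by
  simp only [Tr, hadd]
  have : (x^q^2)^q = x := by rw [← pow_mul]; exact hcube x
  have h3 : (x^q)^q = x^q^2 := by rw [← pow_mul, ← pow_two]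
  rw [this, h3]; ring

/-- character sum over a trace fibre -/
noncomputable def W (q : ℕ) (m : E) : ℤ := ∑ h : E, (if Tr q h = m then quadraticChar E h else 0)

lemma W_scale (f m : E) (hf : f^q = f) (hf0 : f ≠ 0) :
    W q (f*m) = quadraticChar E f * W q m := by
  unfold W
  rw [Finset.mul_sum]
  symm
  refine Fintype.sum_equiv (Equiv.mulLeft₀ f hf0) _ _ ?_
  intro x
  simp only [Equiv.mulLeft₀_apply, Tr_smul f x hf, map_mul, mul_right_inj' hf0]
  split_ifs <;> simp

lemma W_zero (w : E) (hw : w^q = w) (hw0 : w ≠ 0) (hc : quadraticChar E w = -1) :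
    W q (0:E) = 0 := by
  have := W_scale (q := q) w 0 hw hw0
  rw [mul_zero, hc] at this
  linarith

lemma fib_card (hadd : ∀ x y : E, (x+y)^q = x^q+y^q) (hcube : ∀ x : E, x^q^3 = x)
    (hq : 0 < q) (hE : Fintype.card E = q^3)
    (hK : (Finset.univ.filter fun f : E => f^q = f).card = q)
    (e : E) (he : Tr q e = 1) :
    (Finset.univ.filter fun h : E => Tr q h = 1).card = q^2 := by
  have h0 : ∀ m : E, m^q = m → (Finset.univ.filter fun h : E => Tr q h = m).card
      = (Finset.univ.filter fun h : E => Tr q h = 0).card := by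
    intro m hm
    symm
    refine Finset.card_bij (fun h _ => h + m*e) ?_ ?_ ?_
    · intro h hh
      simp only [Finset.mem_filter, Finset.mem_univ, true_and] at hh ⊢
      rw [Tr_add hadd, Tr_smul _ _ hm, hh, he]; ring
    · intro x _ y _ hxy; simpa using hxy
    · intro y hy
      simp only [Finset.mem_filter, Finset.mem_univ, true_and] at hy
      refine ⟨y + (-m)*e, ?_, by ring⟩
      simp only [Finset.mem_filter, Finset.mem_univ, true_and]
      have : Tr q y = Tr q (y + (-m)*e) + Tr q (m*e) := by
        rw [← Tr_add hadd]; congr 1; ring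
      rw [Tr_smul _ _ hm, hy, he] at this
      linear_combination -this
  have hs := Finset.card_eq_sum_card_fiberwise (s := (Finset.univ : Finset E))
    (t := Finset.univ.filter fun f : E => f^q = f) (f := Tr q)
    (by intro x _; simp [Tr_fix hadd hcube])
  rw [Finset.sum_congr rfl (g := fun _ => (Finset.univ.filter fun h : E => Tr q h = 0).card)
    (by intro m hm; exact h0 m (by simpa using hm))] at hs
  rw [Finset.sum_const, hK, smul_eq_mul, Finset.card_univ, hE] at hs
  rw [h0 1 (by simp)]
  have : q * (Finset.univ.filter fun h : E => Tr q h = 0).card = q * q^2 := by rw [← hs]; ring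
  exact Nat.eq_of_mul_eq_mul_left hq this

/-- Points of `xy = m` over the fixed field. -/
lemma hyp_card (hq : 0 < q) (K : Finset E) (hK' : ∀ f, f ∈ K ↔ f^q = f) (hK : K.card = q) (m : E)
    (hm : m ∈ K) :
    ((K ×ˢ K).filter fun xy => xy.1 * xy.2 = m).card = if m = 0 then 2*q-1 else q-1 := by
  have h0 : (0:E) ∈ K := by rw [hK']; simp [hq.ne']
  have hin : ∀ x y, x ∈ K → y ∈ K → x * y⁻¹ ∈ K := by
    intro x y hx hy; rw [hK'] at *; rw [mul_pow, inv_pow, hx, hy]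
  split_ifs with h
  · have : ((K ×ˢ K).filter fun xy => xy.1 * xy.2 = m)
      = (K.image fun x => (x, (0:E))) ∪ ((K.erase 0).image fun y => ((0:E), y)) := by
      ext ⟨x, y⟩
      simp only [Finset.mem_filter, Finset.mem_product, Finset.mem_union, Finset.mem_image,
        Finset.mem_erase, Prod.mk.injEq, h, mul_eq_zero]
      constructor
      · rintro ⟨⟨hx, hy⟩, h | h⟩
        · by_cases hy0 : y = 0
          · left; exact ⟨x, hx, rfl, hy0.symm⟩
          · right; exact ⟨y, ⟨hy0, hy⟩, h.symm, rfl⟩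
        · left; exact ⟨x, hx, rfl, h.symm⟩
      · rintro (⟨x', hx', rfl, rfl⟩ | ⟨y', ⟨h1, h2⟩, rfl, rfl⟩)
        · exact ⟨⟨hx', h0⟩, Or.inr rfl⟩
        · exact ⟨⟨h0, h2⟩, Or.inl rfl⟩
    rw [this, Finset.card_union_of_disjoint, Finset.card_image_of_injective,
      Finset.card_image_of_injective, Finset.card_erase_of_mem h0, hK]
    · omega
    · intro x y hxy; simpa using hxy
    · intro x y hxy; simpa using hxy
    · rw [Finset.disjoint_left]
      rintro ⟨x, y⟩ h1 h2
      simp only [Finset.mem_image, Prod.mk.injEq, Finset.mem_erase] at h1 h2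
      obtain ⟨_, _, _, rfl⟩ := h1
      obtain ⟨_, ⟨h3, _⟩, _, h4⟩ := h2
      exact h3 h4
  · rw [← hK, ← Finset.card_erase_of_mem h0]
    symm
    refine Finset.card_bij (fun x _ => (x, m * x⁻¹)) ?_ ?_ ?_
    · intro x hx
      rw [Finset.mem_erase] at hx
      simp only [Finset.mem_filter, Finset.mem_product]
      refine ⟨⟨hx.2, hin _ _ hm hx.2⟩, ?_⟩
      have := hx.1
      field_simp
    · intro x _ y _ hxy; simp only [Prod.mk.injEq] at hxy; exact hxy.1
    · rintro ⟨x, y⟩ hxy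
      simp only [Finset.mem_filter, Finset.mem_product] at hxy
      have hx0 : x ≠ 0 := by rintro rfl; simp at hxy; exact h hxy.2.symm
      refine ⟨x, by simp [hx0, hxy.1.1], ?_⟩
      simp only [Prod.mk.injEq, true_and]
      rw [← hxy.2]; field_simp

lemma quad_card (h2 : (2:E) ≠ 0) (hq : 5 ≤ q) (K : Finset E) (hK' : ∀ f, f ∈ K ↔ f^q = f)
    (hadd : ∀ x y : E, (x+y)^q = x^q+y^q) (hodd : Odd q)
    (hK : K.card = q) (i : E) (hi : i ∈ K) (hi2 : i^2 = -1) :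
    ((K ×ˢ (K ×ˢ K)).filter fun t => t.2.1 * t.2.2 - t.1^2 = 1).card = q^2+q := by
  have hneg : -i ∈ K := by rw [hK'] at *; rw [hodd.neg_pow, hi]
  have hine : i ≠ -i := by
    intro e
    have h1 : 2 * i = 0 := by linear_combination e
    have : i = 0 := by simpa [h2] using h1
    rw [this] at hi2; norm_num at hi2
  rw [Finset.card_filter, Finset.sum_product]
  have : ∀ z ∈ K, (∑ y ∈ K ×ˢ K, if (z, y).2.1 * (z, y).2.2 - (z, y).1^2 = 1 then 1 else 0)
      = (q - 1) + (if z = i ∨ z = -i then q else 0) := by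
    intro z hz
    rw [← Finset.card_filter]
    have hm : 1 + z^2 ∈ K := by
      rw [hK'] at *; rw [hadd, one_pow, ← pow_mul, mul_comm, pow_mul, hz]
    have := hyp_card (by omega) K hK' hK (1+z^2) hm
    have e1 : ((K ×ˢ K).filter fun xy => xy.1 * xy.2 = 1 + z^2) =
      ((K ×ˢ K).filter fun y => (z, y).2.1 * (z, y).2.2 - (z, y).1^2 = 1) := by
      refine Finset.filter_congr fun y _ => ?_
      exact sub_eq_iff_eq_add.symm
    rw [← e1, this]
    have e2 : 1 + z^2 = 0 ↔ z = i ∨ z = -i := by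
      rw [← sq_eq_sq_iff_eq_or_eq_neg, hi2]
      constructor
      · intro h; linear_combination h
      · intro h; rw [h]; ring
    simp only [e2]
    split_ifs <;> omega
  rw [Finset.sum_congr rfl this, Finset.sum_add_distrib, Finset.sum_const, hK, ← Finset.sum_filter]
  have e3 : K.filter (fun z => z = i ∨ z = -i) = {i, -i} := by
    ext z; simp only [Finset.mem_filter, Finset.mem_insert, Finset.mem_singleton]
    constructor
    · exact fun h => h.2
    · rintro (rfl | rfl)
      · exact ⟨hi, Or.inl rfl⟩
      · exact ⟨hneg, Or.inr rfl⟩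
  rw [e3, Finset.sum_pair hine]
  obtain ⟨r, rfl⟩ : ∃ r, q = r+1 := ⟨q-1, by omega⟩
  simp; ring

lemma sq_card (h2 : (2:E) ≠ 0) (hq : 5 ≤ q) (K : Finset E) (hK' : ∀ f, f ∈ K ↔ f^q = f)
    (hadd : ∀ x y : E, (x+y)^q = x^q+y^q) (hcube : ∀ x : E, x^q^3 = x) (hodd : Odd q)
    (hE : Fintype.card E = q^3)
    (hK : K.card = q) (i : E) (hi : i ∈ K) (hi2 : i^2 = -1)
    (a b : E) (ha : Tr q (a^2) = 0) (hb : Tr q (b^2) = 0) (hab : Tr q (a*b) ≠ 0) :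
    (Finset.univ.filter fun v : E => Tr q (v^2) = 1).card = q^2 + q := by
  set τ := Tr q (a*b) with hτ
  have hτK : τ^q = τ := Tr_fix hadd hcube _
  have hqne : (2:E)^q = 2 := by
    have := hadd 1 1
    simp only [one_pow] at this
    rw [one_add_one_eq_two] at this; exact this
  obtain ⟨g, hga, hgb, hgg⟩ : ∃ g : E, Tr q (g*a) = 0 ∧ Tr q (g*b) = 0 ∧ Tr q (g^2) = -τ^2 := by
    have hsub : ∀ x y : E, (x-y)^q = x^q-y^q := by
      intro x y; rw [sub_eq_add_neg, hadd, hodd.neg_pow]; ring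
    have hsub2 : ∀ x y : E, (x-y)^q^2 = x^q^2-y^q^2 := by
      intro x y; rw [pow_two q, pow_mul, hsub, hsub, ← pow_mul, ← pow_mul]
    have p1 : ∀ x : E, (x^q)^q = x^q^2 := by intro x; rw [← pow_mul, ← pow_two]
    have p2 : ∀ x : E, (x^q^2)^q = x := by intro x; rw [← pow_mul]; exact hcube x
    have p3 : ∀ x : E, (x^q)^q^2 = x := by
      intro x; rw [← pow_mul, ← pow_succ']; exact hcube x
    have p4 : ∀ x : E, (x^q^2)^q^2 = x^q := by
      intro x; rw [pow_two q, pow_mul, ← pow_two, p2]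
    have pp : ∀ (x : E) (n : ℕ), (x^2)^n = (x^n)^2 := by intro x n; rw [← pow_mul, ← pow_mul, mul_comm]
    refine ⟨a^q*b^q^2 - a^q^2*b^q, ?_, ?_, ?_⟩
    · simp only [Tr, mul_pow, hsub, hsub2, p1, p2, p3, p4]; ring
    · simp only [Tr, mul_pow, hsub, hsub2, p1, p2, p3, p4]; ring
    · simp only [Tr, pp] at ha hb
      simp only [hτ, Tr, pp, mul_pow, hsub, hsub2, p1, p2, p3, p4]
      linear_combination ha * ((b^q^2)^2 + (b^q)^2 + b^2)
  have cm : ∀ x y : E, Tr q (x*y) = Tr q (y*x) := fun x y => by rw [mul_comm]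
  let φ : E × (E × E) → E := fun t => (t.2.1 / (2*τ)) * a + t.2.2 * b + (t.1/τ) * g
  have hlin : ∀ t : E × (E × E), t ∈ K ×ˢ (K ×ˢ K) → ∀ w, Tr q (φ t * w) =
      (t.2.1 / (2*τ)) * Tr q (a*w) + t.2.2 * Tr q (b*w) + (t.1/τ) * Tr q (g*w) := by
    rintro ⟨z, x, y⟩ ht w
    simp only [Finset.mem_product, hK'] at ht
    obtain ⟨hz, hx, hy⟩ := ht
    have e : φ (z, x, y) * w = (x / (2*τ)) * (a*w) + y * (b*w) + (z/τ) * (g*w) := by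
      simp only [φ]; ring
    have f1 : (x / (2*τ))^q = x / (2*τ) := by rw [div_pow, mul_pow, hx, hτK, hqne]
    have f2 : (z/τ)^q = z/τ := by rw [div_pow, hz, hτK]
    rw [e, Tr_add hadd, Tr_add hadd, Tr_smul _ _ f1, Tr_smul _ _ hy, Tr_smul _ _ f2]
  have la : ∀ t ∈ K ×ˢ (K ×ˢ K), Tr q (φ t * a) = t.2.2 * τ := by
    intro t ht
    rw [hlin t ht, ← pow_two, ha, hga, cm b a]; ring
  have lb : ∀ t ∈ K ×ˢ (K ×ˢ K), Tr q (φ t * b) = t.2.1 / 2 := by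
    intro t ht
    rw [hlin t ht, ← pow_two, hb, hgb]; field_simp; rw [← hτ]; ring
  have lg : ∀ t ∈ K ×ˢ (K ×ˢ K), Tr q (φ t * g) = - (t.1 * τ) := by
    intro t ht
    rw [hlin t ht, ← pow_two, hgg, cm a g, cm b g, hga, hgb]; field_simp; ring
  have lsq : ∀ t ∈ K ×ˢ (K ×ˢ K), Tr q ((φ t)^2) = t.2.1 * t.2.2 - t.1^2 := by
    intro t ht
    rw [pow_two, hlin t ht, cm a, cm b, cm g, la t ht, lb t ht, lg t ht]; field_simp; ring
  have hinj : Set.InjOn φ ((K ×ˢ (K ×ˢ K) : Finset _) : Set (E × (E × E))) := by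
    intro s hs t ht e
    have hs' := Finset.mem_coe.mp hs
    have ht' := Finset.mem_coe.mp ht
    have e1 := la s hs'; rw [e, la t ht'] at e1
    have e2 := lb s hs'; rw [e, lb t ht'] at e2
    have e3 := lg s hs'; rw [e, lg t ht'] at e3
    have e1' := mul_right_cancel₀ hab e1
    have e2' : t.2.1 = s.2.1 := by field_simp at e2; exact e2
    have e3' := mul_right_cancel₀ hab (neg_injective e3)
    exact Prod.ext e3'.symm (Prod.ext e2'.symm e1'.symm)
  have himg : (K ×ˢ (K ×ˢ K)).image φ = Finset.univ := by
    apply Finset.eq_univ_of_card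
    rw [Finset.card_image_of_injOn hinj, Finset.card_product, Finset.card_product, hK, hE]; ring
  rw [← quad_card h2 hq K hK' hadd hodd hK i hi hi2]
  symm
  refine Finset.card_bij (fun t _ => φ t) ?_ ?_ ?_
  · intro t ht
    rw [Finset.mem_filter] at ht
    simp only [Finset.mem_filter, Finset.mem_univ, true_and]
    rw [lsq t ht.1, ht.2]
  · intro s hs t ht e
    exact hinj (Finset.mem_coe.mpr (Finset.mem_filter.mp hs).1)
      (Finset.mem_coe.mpr (Finset.mem_filter.mp ht).1) e
  · intro v hv
    have : v ∈ (K ×ˢ (K ×ˢ K)).image φ := by rw [himg]; simp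
    obtain ⟨t, ht, rfl⟩ := Finset.mem_image.mp this
    refine ⟨t, ?_, rfl⟩
    rw [Finset.mem_filter]
    refine ⟨ht, ?_⟩
    rw [← lsq t ht]; simpa using hv

lemma W_one (h2 : (2:E) ≠ 0) (hchar : ringChar E ≠ 2) (hq : 5 ≤ q) 
    (hadd : ∀ x y : E, (x+y)^q = x^q+y^q) (hcube : ∀ x : E, x^q^3 = x) (hodd : Odd q)
    (hE : Fintype.card E = q^3)
    (hK : (Finset.univ.filter fun f : E => f^q = f).card = q) (i : E) (hi : i^q = i) (hi2 : i^2 = -1)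
    (a b : E) (ha : Tr q (a^2) = 0) (hb : Tr q (b^2) = 0) (hab : Tr q (a*b) ≠ 0) :
    W q (1:E) = q := by
  have h1 := sq_card h2 hq _ (by simp) hadd hcube hodd hE hK i (by simpa using hi) hi2 a b ha hb hab
  have hτK : (Tr q (a*b))^q = Tr q (a*b) := Tr_fix hadd hcube _
  have h3 := fib_card hadd hcube (by omega) hE hK ((Tr q (a*b))⁻¹ * (a*b)) (by
    rw [Tr_smul _ _ (by rw [inv_pow, hτK]), inv_mul_cancel₀ hab])
  have h4 := Finset.card_eq_sum_card_fiberwise (s := (Finset.univ.filter fun v : E => Tr q (v^2) = 1))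
    (t := Finset.univ.filter fun h : E => Tr q h = 1) (f := fun v => v^2)
    (by intro x hx; simpa using hx)
  rw [h1] at h4
  have h5 : ∀ h ∈ (Finset.univ.filter fun h : E => Tr q h = 1),
     (((Finset.univ.filter fun v : E => Tr q (v^2) = 1).filter fun v => v^2 = h).card : ℤ)
       = quadraticChar E h + 1 := by
    intro h hh
    rw [← quadraticChar_card_sqrts hchar h]
    congr 2
    ext v
    simp only [Finset.mem_filter, Finset.mem_univ, true_and, Set.mem_toFinset, Set.mem_ofPred_eq] at hh ⊢
    constructor
    · exact fun h => h.2
    · intro e; rw [e]; exact ⟨hh, rfl⟩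
  have h6 : ((q^2+q : ℕ) : ℤ) = ∑ h ∈ (Finset.univ.filter fun h : E => Tr q h = 1), (quadraticChar E h + 1) := by
    rw [h4]; push_cast; exact Finset.sum_congr rfl h5
  rw [Finset.sum_add_distrib, Finset.sum_const, h3, Finset.sum_filter] at h6
  unfold W
  push_cast at h6
  simp only [nsmul_eq_mul, mul_one] at h6
  push_cast at h6
  linarith

end trace
section main
variable {E : Type*} [Field E] [Fintype E] {q : ℕ}

/-- solutions for a fixed ratio `-t` -/
noncomputable def M (q : ℕ) (A B t : E) : ℕ :=
  (Finset.univ.filter fun x : E => x^(q^2+q+1) = 1 ∧ Tr q (x*A) = -t * Tr q (x⁻¹*B)).card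

lemma M_inv (a b t : E) (ha0 : a ≠ 0) (hb0 : b ≠ 0) (ht : t ≠ 0) (ha : a^(q^2+q+1) = 1)
    (hb : b^(q^2+q+1) = 1) : M q a b t = M q a b t⁻¹ := by
  unfold M
  refine Finset.card_bij' (fun x _ => b * a⁻¹ * x⁻¹) (fun x _ => b * a⁻¹ * x⁻¹) ?_ ?_ ?_ ?_
  all_goals
    intro x hx
    simp only [Finset.mem_filter, Finset.mem_univ, true_and] at hx
    have hx0 : x ≠ 0 := by
      rintro rfl
      simp at hx
    have e1 : b * a⁻¹ * x⁻¹ * a = x⁻¹ * b := by field_simp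
    have e2 : (b * a⁻¹ * x⁻¹)⁻¹ * b = x * a := by field_simp
  · simp only [Finset.mem_filter, Finset.mem_univ, true_and, e1, e2]
    refine ⟨by simp [mul_pow, ha, hb, hx.1], ?_⟩
    rw [hx.2]; field_simp
  · simp only [Finset.mem_filter, Finset.mem_univ, true_and, e1, e2]
    refine ⟨by simp [mul_pow, ha, hb, hx.1], ?_⟩
    rw [hx.2]; field_simp
  · field_simp
  · field_simp

lemma gen (α : E) (hE : Fintype.card E = q^3) (hα : orderOf α = q^3-1) (hq : 5 ≤ q) (x : E)
    (hx : x ≠ 0) : ∃ n, x = α^n := by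
  have h1 : 5^3 ≤ q^3 := Nat.pow_le_pow_left hq 3
  have hα0 : α ≠ 0 := by
    rintro rfl
    rw [orderOf_zero] at hα; omega
  have : (Finset.range (q^3-1)).image (fun n => α^n) = Finset.univ.erase 0 := by
    apply Finset.eq_of_subset_of_card_le
    · intro y hy
      obtain ⟨n, _, rfl⟩ := Finset.mem_image.mp hy
      simp [hα0]
    · rw [Finset.card_erase_of_mem (Finset.mem_univ _), Finset.card_univ, hE,
        Finset.card_image_of_injOn, Finset.card_range]
      rw [← hα]
      intro i hi j hj e
      exact pow_injOn_Iio_orderOf (by simpa using hi) (by simpa using hj) e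
  have hx' : x ∈ (Finset.range (q^3-1)).image (fun n => α^n) := by rw [this]; simp [hx]
  obtain ⟨n, _, h⟩ := Finset.mem_image.mp hx'
  exact ⟨n, h.symm⟩

lemma cube_fac (hq : 5 ≤ q) : q^3 - 1 = (q-1)*(q^2+q+1) := by
  obtain ⟨r, rfl⟩ : ∃ r, q = r+1 := ⟨q-1, by omega⟩
  have : (r+1)^3 = r*((r+1)^2+(r+1)+1)+1 := by ring
  rw [this]; simp

lemma ord_ω (α : E) (hα : orderOf α = q^3-1) (hq : 5 ≤ q) : orderOf (α^(q^2+q+1)) = q-1 := by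
  rw [orderOf_pow_of_dvd (by omega) (by rw [hα, cube_fac hq]; exact dvd_mul_left _ _), hα,
    cube_fac hq, Nat.mul_div_cancel _ (by positivity)]

lemma ord_μ (α : E) (hα : orderOf α = q^3-1) (hq : 5 ≤ q) : orderOf (α^(q-1)) = q^2+q+1 := by
  rw [orderOf_pow_of_dvd (by omega) (by rw [hα, cube_fac hq]; exact dvd_mul_right _ _), hα,
    cube_fac hq, Nat.mul_div_cancel_left _ (by omega)]

lemma U_iff (α : E) (hE : Fintype.card E = q^3) (hα : orderOf α = q^3-1) (hq : 5 ≤ q) (x : E)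
    (hx : x^(q^2+q+1) = 1) : ∃ i < q^2+q+1, (α^(q-1))^i = x := by
  have hx0 : x ≠ 0 := by rintro rfl; simp at hx
  obtain ⟨n, rfl⟩ := gen α hE hα hq x hx0
  rw [← pow_mul] at hx
  have := orderOf_dvd_of_pow_eq_one hx
  rw [hα, cube_fac hq] at this
  obtain ⟨j, rfl⟩ := Nat.dvd_of_mul_dvd_mul_right (by positivity) this
  refine ⟨j % (q^2+q+1), Nat.mod_lt _ (by positivity), ?_⟩
  rw [← ord_μ α hα hq, pow_mod_orderOf, pow_mul]

lemma K_iff (α : E) (hE : Fintype.card E = q^3) (hα : orderOf α = q^3-1) (hq : 5 ≤ q) (x : E)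
    (hx0 : x ≠ 0) (hx : x^q = x) : ∃ i < q-1, (α^(q^2+q+1))^i = x := by
  obtain ⟨n, rfl⟩ := gen α hE hα hq x hx0
  have hx1 : (α^n)^(q-1) = 1 := by
    have : (α^n)^(q-1) * (α^n) = 1 * α^n := by
      rw [← pow_succ, Nat.sub_add_cancel (by omega), hx, one_mul]
    exact mul_right_cancel₀ hx0 this
  rw [← pow_mul] at hx1
  have := orderOf_dvd_of_pow_eq_one hx1
  rw [hα, cube_fac hq, mul_comm n] at this
  obtain ⟨j, rfl⟩ := Nat.dvd_of_mul_dvd_mul_left (by omega) this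
  refine ⟨j % (q-1), Nat.mod_lt _ (by omega), ?_⟩
  rw [← ord_ω α hα hq, pow_mod_orderOf, pow_mul]

lemma ω_fix (α : E) (hα : orderOf α = q^3-1) (hq : 5 ≤ q) : (α^(q^2+q+1))^q = α^(q^2+q+1) := by
  have := pow_orderOf_eq_one (α^(q^2+q+1))
  rw [ord_ω α hα hq] at this
  calc (α^(q^2+q+1))^q = (α^(q^2+q+1))^(q-1+1) := by rw [Nat.sub_add_cancel (by omega)]
    _ = _ := by rw [pow_succ, this, one_mul]

lemma card_K (α : E) (hα0 : α ≠ 0) (hE : Fintype.card E = q^3) (hα : orderOf α = q^3-1) (hq : 5 ≤ q) :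
    (Finset.univ.filter fun f : E => f^q = f).card = q := by
  have : (Finset.univ.filter fun f : E => f^q = f)
      = insert 0 ((Finset.range (q-1)).image fun i => (α^(q^2+q+1))^i) := by
    ext x
    simp only [Finset.mem_filter, Finset.mem_univ, true_and, Finset.mem_insert, Finset.mem_image,
      Finset.mem_range]
    constructor
    · intro h
      by_cases hx : x = 0
      · exact Or.inl hx
      · exact Or.inr (K_iff α hE hα hq x hx h)
    · rintro (rfl | ⟨i, _, rfl⟩)
      · exact zero_pow (by omega)
      · rw [← pow_mul, mul_comm, pow_mul, ω_fix α hα hq]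
  rw [this, Finset.card_insert_of_notMem, Finset.card_image_of_injOn, Finset.card_range]
  · omega
  · rw [← ord_ω α hα hq]
    intro i hi j hj e
    exact pow_injOn_Iio_orderOf (by simpa using hi) (by simpa using hj) e
  · simp [hα0]

lemma M_range (α : E) (hE : Fintype.card E = q^3) (hα : orderOf α = q^3-1) (hq : 5 ≤ q) (A B t : E) :
    ((Finset.range (q^2+q+1)).filter fun i => Tr q ((α^(q-1))^i * A)
      = -t * Tr q (((α^(q-1))⁻¹)^i * B)).card = M q A B t := by
  unfold M
  refine Finset.card_bij (fun i _ => (α^(q-1))^i) ?_ ?_ ?_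
  · intro i hi
    simp only [Finset.mem_filter, Finset.mem_univ, true_and, Finset.mem_range, inv_pow] at hi ⊢
    refine ⟨?_, hi.2⟩
    rw [← pow_mul, mul_comm, pow_mul]
    have := pow_orderOf_eq_one (α^(q-1))
    rw [ord_μ α hα hq] at this
    rw [← pow_mul, mul_comm, pow_mul, ← pow_mul, mul_comm i, pow_mul, this, one_pow]
  · intro i hi j hj e
    have h1 := (Finset.mem_filter.mp hi).1
    have h2 := (Finset.mem_filter.mp hj).1
    rw [← ord_μ α hα hq] at h1 h2
    exact pow_injOn_Iio_orderOf (by simpa using h1) (by simpa using h2) e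
  · intro x hx
    simp only [Finset.mem_filter, Finset.mem_univ, true_and] at hx
    obtain ⟨i, hi, rfl⟩ := U_iff α hE hα hq x hx.1
    refine ⟨i, ?_, rfl⟩
    simp only [Finset.mem_filter, Finset.mem_range, inv_pow]
    exact ⟨hi, hx.2⟩

/-- decomposition of the unit group -/
lemma decomp (α : E) (hα0 : α ≠ 0) (hE : Fintype.card E = q^3) (hα : orderOf α = q^3-1) (hq : 5 ≤ q)
    (hq3 : q % 3 ≠ 1) (G : E → ℤ) :
    ∑ z ∈ Finset.univ.filter (fun z : E => z ≠ 0), G z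
      = ∑ j ∈ Finset.range (q-1), ∑ x ∈ Finset.univ.filter (fun x : E => x^(q^2+q+1) = 1),
          G (x * ((α^(q^2+q+1))^j)⁻¹) := by
  have hcop : Nat.Coprime (q^2+q+1) (q-1) := by
    obtain ⟨r, rfl⟩ : ∃ r, q = r+1 := ⟨q-1, by omega⟩
    have h1 : (r+1)^2+(r+1)+1 = 3 + r*(r+3) := by ring
    simp only [Nat.add_sub_cancel]
    rw [h1, Nat.coprime_add_mul_left_left]
    rw [Nat.Prime.coprime_iff_not_dvd (by norm_num)]
    omega
  have hω := ord_ω α hα hq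
  have hω1 := pow_orderOf_eq_one (α^(q^2+q+1))
  rw [hω] at hω1
  set ω := α^(q^2+q+1) with hωd
  have hω0 : ω ≠ 0 := pow_ne_zero _ hα0
  have hU : (Finset.univ.filter (fun x : E => x^(q^2+q+1) = 1)).card = q^2+q+1 := by
    have h1 := M_range α hE hα hq (0:E) 0 0
    simp [M, Tr, show q ≠ 0 by omega] at h1
    exact h1.symm
  rw [← Finset.sum_product']
  symm
  have hinj : Set.InjOn (fun jx : ℕ × E => jx.2 * (ω^jx.1)⁻¹)
     ((Finset.range (q-1) ×ˢ Finset.univ.filter (fun x : E => x^(q^2+q+1) = 1) : Finset _) : Set (ℕ × E)) := by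
    rintro ⟨j, x⟩ h1 ⟨k, y⟩ h2 e
    simp only [Finset.coe_product, Set.mem_prod, Finset.mem_coe, Finset.mem_range,
      Finset.mem_filter, Finset.mem_univ, true_and] at h1 h2 e
    have e1 : ω^j = ω^k := by
      have e3 := congrArg (fun s => s^(q^2+q+1)) e
      simp only [mul_pow, h1.2, h2.2, one_mul, inv_pow] at e3
      have e4 := inv_injective e3
      rw [← pow_mul ω j, ← pow_mul ω k, mul_comm j, mul_comm k, pow_mul ω _ j, pow_mul ω _ k] at e4
      have ho : orderOf (ω^(q^2+q+1)) = q-1 := by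
        rw [Nat.Coprime.orderOf_pow (by rw [hω]; exact hcop.symm), hω]
      rw [← ho] at h1 h2
      have : j = k := pow_injOn_Iio_orderOf (by simpa using h1.1) (by simpa using h2.1) e4
      rw [this]
    have e2 : x = y := by
      rw [e1] at e
      exact mul_right_cancel₀ (inv_ne_zero (pow_ne_zero _ hω0)) e
    rw [← hω] at h1 h2
    have : j = k := pow_injOn_Iio_orderOf (by simpa using h1.1) (by simpa using h2.1) e1
    rw [this, e2]
  have himg : (Finset.range (q-1) ×ˢ Finset.univ.filter (fun x : E => x^(q^2+q+1) = 1)).image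
      (fun jx : ℕ × E => jx.2 * (ω^jx.1)⁻¹) = Finset.univ.filter (fun z : E => z ≠ 0) := by
    apply Finset.eq_of_subset_of_card_le
    · intro z hz
      obtain ⟨⟨j, x⟩, h, rfl⟩ := Finset.mem_image.mp hz
      simp only [Finset.mem_product, Finset.mem_filter, Finset.mem_univ, true_and] at h ⊢
      refine mul_ne_zero ?_ (inv_ne_zero (pow_ne_zero _ hω0))
      rintro rfl
      simp at h
    · rw [Finset.card_image_of_injOn hinj, Finset.card_product, hU, Finset.card_range, ← cube_fac hq,
        Finset.filter_ne', Finset.card_erase_of_mem (Finset.mem_univ _), Finset.card_univ, hE]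
  rw [← himg, Finset.sum_image hinj]

lemma alt_sum (f : ℕ → ℤ) (m : ℕ) (hper : ∀ j, f (j + 2*m) = f j) :
    ∑ j ∈ Finset.range (4*m), (-1:ℤ)^j * f j
      = 2 * (∑ k ∈ Finset.range m, f (2*k) - ∑ k ∈ Finset.range m, f (2*k+1)) := by
  have h1 : ∀ r, ∑ j ∈ Finset.range (2*r), (-1:ℤ)^j * f j
      = ∑ k ∈ Finset.range r, f (2*k) - ∑ k ∈ Finset.range r, f (2*k+1) := by
    intro r
    induction r with
    | zero => simp
    | succ r ih =>
      rw [show 2*(r+1) = 2*r+1+1 by ring, Finset.sum_range_succ, Finset.sum_range_succ, ih,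
        Finset.sum_range_succ, Finset.sum_range_succ]
      simp [pow_succ, pow_mul]; ring
  rw [show 4*m = 2*m+2*m by ring, Finset.sum_range_add, h1]
  have h2 : ∑ x ∈ Finset.range (2*m), (-1:ℤ)^(2*m+x) * f (2*m+x)
     = ∑ j ∈ Finset.range (2*m), (-1:ℤ)^j * f j := by
    refine Finset.sum_congr rfl fun j _ => ?_
    rw [add_comm (2*m) j, hper, pow_add, pow_mul]; simp
  rw [h2, h1]; ring

end main
end Aux14

open Aux14

theorem stmt_14 {p u q : ℕ} (hp : p.Prime) (hu : 0 < u) (hq : q = p ^ u)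
    (hq4 : q % 4 = 1) (hq3 : q % 3 ≠ 1)
    {E : Type*} [Field E] [Fintype E] (hE : Fintype.card E = q ^ 3)
    (T N : E → E)
    (hT : ∀ x, T x = x ^ q ^ 2 + x ^ q + x)
    (hN : ∀ x, N x = x ^ (q ^ 2 + q + 1))
    (α : E) (hα : orderOf α = q ^ 3 - 1)
    (ω : E) (hω : ω = α ^ (q ^ 2 + q + 1))
    (μ : E) (hμ : μ = α ^ (q - 1))
    (χ₄ : E → ℂ) (hχ₄0 : χ₄ 0 = 0) (hχ₄ : ∀ n : ℕ, χ₄ (α ^ n) = Complex.I ^ n)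
    (χ₂ : E → ℂ) (hχ₂ : ∀ x, χ₂ x = χ₄ x ^ 2)
    (κpair : ℕ → E → E → ℕ)
    (hκpair : ∀ s a b, κpair s a b =
      (((Finset.range ((q - 1) / 4)) ×ˢ (Finset.range (q ^ 2 + q + 1))).filter
        fun ki => T (μ ^ ki.2 * a) = -ω ^ (4 * ki.1 + s) * T (μ⁻¹ ^ ki.2 * b)).card) :
    ∀ a b : E, a ≠ 0 → b ≠ 0 → N a = 1 → N b = 1 →
      T (a ^ 2) = 0 → T (b ^ 2) = 0 →
      κpair 1 (a ^ 2) (b ^ 2) = κpair 3 (a ^ 2) (b ^ 2) ∧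
      (κpair 0 (a ^ 2) (b ^ 2) : ℂ) - (κpair 2 (a ^ 2) (b ^ 2) : ℂ)
        = (q : ℂ) * χ₂ (2 * T (a * b)) := by
  intro a b ha0 hb0 hNa hNb hTa hTb
  obtain rfl : T = Tr q := funext hT
  rw [hN] at hNa hNb
  haveI : Fact p.Prime := ⟨hp⟩
  have hq5 : 5 ≤ q := by
    have : q ≠ 1 := by
      rw [hq]
      exact (Nat.one_lt_pow hu.ne' hp.one_lt).ne'
    omega
  have hodd : Odd q := Nat.odd_iff.mpr (by omega)
  have hcharP : CharP E p := by
    refine charP_of_card_eq_prime_pow (f := u*3) ?_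
    rw [hE, hq, pow_mul]
  have hadd : ∀ x y : E, (x+y)^q = x^q+y^q := by
    intro x y; rw [hq]; exact add_pow_char_pow x y p u
  have hcube : ∀ x : E, x^q^3 = x := by
    intro x; rw [← hE]; exact FiniteField.pow_card x
  have hp2 : p ≠ 2 := by
    rintro rfl
    rw [hq] at hodd
    exact (Nat.not_odd_iff_even.mpr ((even_two).pow_of_ne_zero hu.ne')) hodd
  have hchar : ringChar E ≠ 2 := by rw [ringChar.eq E p]; exact hp2
  have h2 : (2:E) ≠ 0 := Ring.two_ne_zero hchar
  have hα0 : α ≠ 0 := by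
    rintro rfl
    rw [orderOf_zero] at hα
    have h1 : 5^3 ≤ q^3 := Nat.pow_le_pow_left hq5 3
    omega
  have hω0 : ω ≠ 0 := by rw [hω]; exact pow_ne_zero _ hα0
  have hωq : ω^q = ω := by rw [hω]; exact ω_fix α hα hq5
  have hωo : orderOf ω = q-1 := by rw [hω]; exact ord_ω α hα hq5
  have hω1 : ω^(q-1) = 1 := by rw [← hωo]; exact pow_orderOf_eq_one ω
  obtain ⟨m, hm⟩ : ∃ m, q = 4*m+1 := ⟨q/4, by omega⟩
  have hm' : (q-1)/4 = m := by omega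
  have hω4 : ω^(4*m) = 1 := by rw [show 4*m = q-1 by omega]; exact hω1
  -- square root of -1
  obtain ⟨i, hi, hi2⟩ : ∃ i : E, i^q = i ∧ i^2 = -1 := by
    refine ⟨ω^m, by rw [← pow_mul, mul_comm, pow_mul, hωq], ?_⟩
    have h1 : (ω^m)^2 * (ω^m)^2 = 1 := by
      rw [← hω4, ← pow_mul, ← pow_add]; congr 1; ring
    rcases mul_self_eq_one_iff.mp h1 with h3 | h3
    · exfalso
      rw [← pow_mul] at h3
      have := Nat.le_of_dvd (by omega) (orderOf_dvd_of_pow_eq_one h3)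
      omega
    · exact h3
  have hm1 : IsSquare (-1:E) := ⟨i, by rw [← hi2, pow_two]⟩
  have hneg : quadraticChar E (-1) = 1 := by
    rw [quadraticChar_one_iff_isSquare (by simp)]; exact hm1
  -- character values
  have hχα : quadraticChar E α = -1 := by
    rw [quadraticChar_neg_one_iff_not_isSquare]
    rintro ⟨β, hβ⟩
    have hβ0 : β ≠ 0 := by rintro rfl; simp at hβ; exact hα0 hβ
    have h1 : α^((q^3-1)/2) = 1 := by
      have h3 : 2 ∣ q^3-1 := by
        rw [cube_fac hq5]; exact Dvd.dvd.mul_right (by omega) _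
      rw [hβ, ← pow_two, ← pow_mul, Nat.mul_div_cancel' h3, ← hE]
      exact FiniteField.pow_card_sub_one_eq_one β hβ0
    have h5 : 5^3 ≤ q^3 := Nat.pow_le_pow_left hq5 3
    have := Nat.le_of_dvd (by omega) (orderOf_dvd_of_pow_eq_one h1)
    omega
  have hn_odd : Odd (q^2+q+1) := by
    have : Even (q^2+q) := by rw [pow_two]; exact Nat.even_mul_succ_self q
    exact this.add_one
  have hχω : quadraticChar E ω = -1 := by rw [hω, map_pow, hχα, hn_odd.neg_one_pow]
  have hχU : ∀ x : E, x^(q^2+q+1) = 1 → quadraticChar E x = 1 := by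
    intro x hx
    have hx0 : x ≠ 0 := by rintro rfl; simp at hx
    have h3 : (quadraticChar E x)^(q^2+q+1) = 1 := by rw [← map_pow, hx, map_one]
    rcases quadraticChar_dichotomy hx0 with h | h
    · exact h
    · rw [h, hn_odd.neg_one_pow] at h3; norm_num at h3
  have hχ2 : ∀ x, χ₂ x = ((quadraticChar E x : ℤ) : ℂ) := by
    intro x
    rw [hχ₂]
    by_cases hx : x = 0
    · simp [hx, hχ₄0]
    · obtain ⟨n, rfl⟩ := gen α hE hα hq5 x hx
      rw [hχ₄, map_pow, hχα, ← pow_mul, mul_comm, pow_mul, Complex.I_sq]; simp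
  -- kappa
  have hκ : ∀ s, κpair s (a^2) (b^2) = ∑ k ∈ Finset.range m, M q (a^2) (b^2) (ω^(4*k+s)) := by
    intro s
    rw [hκpair, hm', Finset.card_filter, Finset.sum_product]
    refine Finset.sum_congr rfl fun k _ => ?_
    rw [← M_range α hE hα hq5, ← hμ, Finset.card_filter]
  refine ⟨?_, ?_⟩
  · rw [hκ, hκ, ← Finset.sum_range_reflect]
    refine Finset.sum_congr rfl fun k hk => ?_
    rw [Finset.mem_range] at hk
    rw [M_inv _ _ _ (pow_ne_zero 2 ha0) (pow_ne_zero 2 hb0) (pow_ne_zero _ hω0)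
      (by rw [← pow_mul, mul_comm, pow_mul, hNa, one_pow])
      (by rw [← pow_mul, mul_comm, pow_mul, hNb, one_pow])]
    congr 1
    refine inv_eq_of_mul_eq_one_right ?_
    rw [← pow_add, ← hω4]
    congr 1; omega
  · have hS := salie h2 hm1 a b ha0 hb0 (fun h => Tr q h = 0)
    rw [decomp α hα0 hE hα hq5 hq3, ← hω] at hS
    have hL : ∀ j ∈ Finset.range (q-1), ∑ x ∈ Finset.univ.filter (fun x : E => x^(q^2+q+1) = 1),
        (if Tr q (x * (ω^j)⁻¹ * a^2 + (x * (ω^j)⁻¹)⁻¹ * b^2) = 0 then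
          quadraticChar E (x * (ω^j)⁻¹) else 0) = (-1)^j * (M q (a^2) (b^2) (ω^(2*j)) : ℤ) := by
      intro j _
      have hj0 : ω^j ≠ 0 := pow_ne_zero _ hω0
      have hjq : (ω^j)^q = ω^j := by rw [← pow_mul, mul_comm, pow_mul, hωq]
      have hjq' : ((ω^j)⁻¹)^q = (ω^j)⁻¹ := by rw [inv_pow, hjq]
      unfold M
      rw [← Finset.filter_filter, Finset.card_filter]
      push_cast
      rw [Finset.mul_sum]
      refine Finset.sum_congr rfl fun x hx => ?_
      have hxU : x^(q^2+q+1) = 1 := by simpa using hx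
      have hiff : Tr q (x * (ω^j)⁻¹ * a^2 + (x * (ω^j)⁻¹)⁻¹ * b^2) = 0 ↔
          Tr q (x * a^2) = -ω^(2*j) * Tr q (x⁻¹ * b^2) := by
        have e1 : x * (ω^j)⁻¹ * a^2 = (ω^j)⁻¹ * (x*a^2) := by ring
        have e2 : (x * (ω^j)⁻¹)⁻¹ * b^2 = ω^j * (x⁻¹*b^2) := by
          rw [mul_inv, inv_inv]; ring
        rw [Tr_add hadd, e1, e2, Tr_smul _ _ hjq, Tr_smul _ _ hjq', mul_comm 2 j, pow_mul]
        constructor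
        · intro h
          have := congrArg (fun s => ω^j * s) h
          simp only [mul_add, mul_zero, mul_inv_cancel_left₀ hj0] at this
          linear_combination this
        · intro h
          rw [h]; field_simp; ring
      have hv : quadraticChar E (x * (ω^j)⁻¹) = (-1)^j := by
        rw [map_mul, hχU x hxU, one_mul, ← inv_pow, map_pow]
        have : quadraticChar E ω⁻¹ = -1 := by
          have h3 : quadraticChar E ω * quadraticChar E ω⁻¹ = 1 := by
            rw [← map_mul, mul_inv_cancel₀ hω0, map_one]
          rw [hχω] at h3; linarith
        rw [this]
      simp only [hiff, hv]
      split_ifs <;> simp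
    rw [Finset.sum_congr rfl hL, show q-1 = 4*m by omega,
      alt_sum (fun j => (M q (a^2) (b^2) (ω^(2*j)) : ℤ)) m (by
        intro j
        rw [mul_add, pow_add, show 2*(2*m) = 4*m by ring, hω4, mul_one])] at hS
    have hτq : (Tr q (a*b))^q = Tr q (a*b) := Tr_fix hadd hcube _
    have hqne : (2:E)^q = 2 := by
      have := hadd 1 1
      simp only [one_pow] at this
      rw [one_add_one_eq_two] at this; exact this
    have hR1 : ∑ h : E, (if Tr q (h + 2*(a*b)) = 0 then quadraticChar E h else 0)
        = W q (-(2 * Tr q (a*b))) := by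
      unfold W
      simp only [Tr_add hadd, Tr_smul _ _ hqne, add_eq_zero_iff_eq_neg]
    have hR2 : ∑ h : E, (if Tr q (h - 2*(a*b)) = 0 then quadraticChar E h else 0)
        = W q (2 * Tr q (a*b)) := by
      unfold W
      refine Finset.sum_congr rfl fun h _ => ?_
      have : Tr q h = Tr q (h - 2*(a*b)) + 2 * Tr q (a*b) := by
        rw [← Tr_smul _ _ hqne, ← Tr_add hadd]; congr 1; ring
      rw [this]; simp
    have hfin : W q (-(2 * Tr q (a*b))) + W q (2 * Tr q (a*b))
        = 2 * ((q:ℤ) * quadraticChar E (2 * Tr q (a*b))) := by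
      by_cases hτ : Tr q (a*b) = 0
      · rw [hτ]; simp [W_zero ω hωq hω0 hχω]
      · have hne : 2 * Tr q (a*b) ≠ 0 := mul_ne_zero h2 hτ
        have hfx : (2 * Tr q (a*b))^q = 2 * Tr q (a*b) := by rw [mul_pow, hqne, hτq]
        have h1 := W_scale (q := q) (2 * Tr q (a*b)) 1 hfx hne
        have h3 := W_scale (q := q) (-1) (2 * Tr q (a*b)) hodd.neg_one_pow (by simp)
        have h4 := W_one h2 hchar hq5 hadd hcube hodd hE (card_K α hα0 hE hα hq5) i hi hi2 a b
          hTa hTb hτ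
        rw [mul_one] at h1
        rw [neg_one_mul, hneg, one_mul] at h3
        rw [h3, h1, h4]; ring
    rw [hR1, hR2, hfin] at hS
    have hS' := mul_left_cancel₀ (by norm_num : (2:ℤ) ≠ 0) hS
    rw [hκ, hκ, hχ2]
    have e0 : ∀ k, 2*(2*k) = 4*k+0 := fun k => by ring
    have e2 : ∀ k, 2*(2*k+1) = 4*k+2 := fun k => by ring
    simp only [e0, e2] at hS'
    exact_mod_cast hS'
end

section
/- Let q be a prime power with q ≡ 5 or 9 (mod 12). Let V = E × E as a 6-dimensional F-vector space with quadratic form Q((u,v)) = T(uv) and polar form B((u₁,v₁),(u₂,v₂)) = T(u₁v₂) + T(v₁u₂). Let 𝒬 be the set of projective points of PG(V) (1-dimensional F-subspaces of V) on which Q vanishes, let π₁ = {[(x,0)] : x ∈ E*} and π₂ = {[(0,y)] : y ∈ E*} (two disjoint generators of the hyperbolic quadric 𝒬 = Q⁺(5,q)). Then there exist disjoint subsets 𝒯₁ and 𝒯₂ of 𝒬, with 𝒬 equal to the disjoint union π₁ ∪ π₂ ∪ 𝒯₁ ∪ 𝒯₂, such that each 𝒯_m (m = 1, 2) is a ((q²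 − 1)/2)-tight set: for every point p ∈ 𝒬, the number of points r ∈ 𝒯_m with B vanishing on representatives of p and r equals ((q² − 1)/2)·(q + 1) + q²·[p ∈ 𝒯_m] (where [p ∈ 𝒯_m] is 1 if p ∈ 𝒯_m and 0 otherwise). Moreover 𝒯₁ and 𝒯₂ are isomorphic (mapped to each other by a projective similarity of the quadric). -/
open scoped Classical

namespace CL

section basic
variable {F E : Type*} [Field F] [Fintype F] [Field E] [Fintype E] [Algebra F E]

theorem ringChar_ne_two_of {K : Type*} [Field K] [Fintype K] (h : Fintype.card K % 2 = 1) :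
    ringChar K ≠ 2 := by
  intro h2
  have := FiniteField.even_card_iff_char_two.1 h2
  omega

theorem card_E (hdim : Module.finrank F E = 3) : Fintype.card E = Fintype.card F ^ 3 := by
  rw [Module.card_eq_pow_finrank (K := F) (V := E), hdim]

theorem card_E_odd (hq : Fintype.card F % 4 = 1) (hdim : Module.finrank F E = 3) :
    Fintype.card E % 2 = 1 := by
  rw [card_E hdim, Nat.pow_mod]
  have : Fintype.card F % 2 = 1 := by omega
  rw [this]

theorem eta_algebraMap (hq : Fintype.card F % 4 = 1) (hdim : Module.finrank F E = 3) (c : F) :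
    quadraticChar E (algebraMap F E c) = quadraticChar F c := by
  by_cases hc : c = 0
  · simp [hc]
  have hF2 : ringChar F ≠ 2 := ringChar_ne_two_of (by omega)
  have hE2 : ringChar E ≠ 2 := ringChar_ne_two_of (card_E_odd hq hdim)
  have hc' : algebraMap F E c ≠ 0 := by simpa using hc
  have key : c ^ (Fintype.card E / 2) = c ^ (Fintype.card F / 2) := by
    rw [card_E hdim]
    obtain ⟨m, hm⟩ : ∃ m, Fintype.card F = 4 * m + 1 := ⟨Fintype.card F / 4, by omega⟩
    have h1 : Fintype.card F ^ 3 / 2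
        = Fintype.card F / 2 + (Fintype.card F - 1) * (Fintype.card F * ((Fintype.card F + 1) / 2)) := by
      rw [hm]
      have e1 : (4 * m + 1) / 2 = 2 * m := by omega
      have e3 : (4 * m + 1 + 1) / 2 = 2 * m + 1 := by omega
      rw [e1, e3, Nat.add_sub_cancel]
      have e2 : (4 * m + 1) ^ 3 = 2 * (2 * m + 4 * m * ((4 * m + 1) * (2 * m + 1))) + 1 := by ring
      omega
    rw [h1, pow_add, pow_mul, FiniteField.pow_card_sub_one_eq_one c hc, one_pow, mul_one]
  have : IsSquare (algebraMap F E c) ↔ IsSquare c := by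
    rw [FiniteField.isSquare_iff hE2 hc', FiniteField.isSquare_iff hF2 hc, ← key, ← map_pow]
    constructor
    · intro h
      exact (algebraMap F E).injective (by rw [h, map_one])
    · intro h
      rw [h, map_one]
  rcases quadraticChar_dichotomy hc with h | h
  · rw [h, quadraticChar_one_iff_isSquare hc', this]
    exact (quadraticChar_one_iff_isSquare hc).1 h
  · rw [h, quadraticChar_neg_one_iff_not_isSquare, this]
    exact quadraticChar_neg_one_iff_not_isSquare.1 h

theorem chi_neg_one (hq : Fintype.card F % 4 = 1) : quadraticChar F (-1) = 1 := by
  rw [quadraticChar_one_iff_isSquare (by simp), FiniteField.isSquare_neg_one_iff]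
  omega

theorem chi_neg (hq : Fintype.card F % 4 = 1) (a : F) :
    quadraticChar F (-a) = quadraticChar F a := by
  rw [neg_eq_neg_one_mul, map_mul, chi_neg_one hq, one_mul]

theorem chi_inv {K : Type*} [Field K] [Fintype K] (a : K) :
    quadraticChar K (a⁻¹) = quadraticChar K a := by
  by_cases h : a = 0
  · simp [h]
  · have h1 : quadraticChar K (a⁻¹) * quadraticChar K a = 1 := by
      rw [← map_mul, inv_mul_cancel₀ h, map_one]
    rcases quadraticChar_dichotomy h with h2 | h2 <;> rw [h2] at h1 ⊢ <;> linarith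

theorem chi_mul {K : Type*} [Field K] [Fintype K] (a b : K) :
    quadraticChar K (a * b) = quadraticChar K a * quadraticChar K b := map_mul _ _ _

theorem chi_mul_self {K : Type*} [Field K] [Fintype K] {a : K} (h : a ≠ 0) :
    quadraticChar K a * quadraticChar K a = 1 := by
  rw [← sq]; exact quadraticChar_sq_one h

theorem two_ne (hq : Fintype.card F % 4 = 1) : (2 : F) ≠ 0 :=
  Ring.two_ne_zero (ringChar_ne_two_of (by omega))

/-- fibres of a linear map -/
theorem card_fiber {V W : Type*} [AddCommGroup V] [AddCommGroup W] [Fintype V] [Fintype W]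
    (L : V →+ W) (hL : Function.Surjective L) (w : W) :
    (Finset.univ.filter fun v => L v = w).card * Fintype.card W = Fintype.card V := by
  have h : ∀ w', (Finset.univ.filter fun v => L v = w').card
      = (Finset.univ.filter fun v => L v = w).card := by
    intro w'
    obtain ⟨x, hx⟩ := hL (w - w')
    refine Finset.card_bij (fun v _ => v + x) ?_ ?_ ?_
    · intro v hv
      simp only [Finset.mem_filter, Finset.mem_univ, true_and] at hv ⊢
      rw [map_add, hv, hx]; abel
    · intro a _ b _ hab
      simpa using hab
    · intro v hv
      simp only [Finset.mem_filter, Finset.mem_univ, true_and] at hv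
      refine ⟨v - x, ?_, by abel⟩
      simp only [Finset.mem_filter, Finset.mem_univ, true_and]
      rw [map_sub, hv, hx]; abel
  have h2 := Finset.card_eq_sum_card_fiberwise (f := L) (s := Finset.univ) (t := Finset.univ)
    (by intro x _; simp)
  rw [Finset.sum_congr rfl (fun w' _ => h w')] at h2
  rw [Finset.sum_const, smul_eq_mul] at h2
  rw [← Finset.card_univ (α := V), h2, Finset.card_univ, mul_comm]

theorem tr_nondeg {a : E} (h : ∀ b : E, Algebra.trace F E (a * b) = 0) : a = 0 := by
  have := (traceForm_nondegenerate F E).1 a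
  apply this
  intro b
  rw [Algebra.traceForm_apply]
  exact h b

theorem exists_tr_one {a : E} (h : a ≠ 0) : ∃ b, Algebra.trace F E (a * b) = 1 := by
  by_contra! hc
  apply h
  apply tr_nondeg (F := F)
  intro b
  by_contra hb
  apply hc ((Algebra.trace F E (a * b))⁻¹ • b)
  rw [mul_smul_comm, map_smul, smul_eq_mul, inv_mul_cancel₀ hb]

theorem exists_dual_pair {a u : E} (hu : u ≠ 0) (ha : ∀ l : F, a ≠ l • u) :
    ∃ b, Algebra.trace F E (u * b) = 0 ∧ Algebra.trace F E (a * b) = 1 := by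
  by_contra! hc
  have hc' : ∀ b, Algebra.trace F E (u * b) = 0 → Algebra.trace F E (a * b) = 0 := by
    intro b hb
    by_contra hb2
    apply hc ((Algebra.trace F E (a * b))⁻¹ • b)
    · rw [mul_smul_comm, map_smul, hb, smul_zero]
    · rw [mul_smul_comm, map_smul, smul_eq_mul, inv_mul_cancel₀ hb2]
  obtain ⟨b0, hb0⟩ := exists_tr_one (F := F) hu
  apply ha (Algebra.trace F E (a * b0))
  rw [← sub_eq_zero]
  apply tr_nondeg (F := F)
  intro b
  have := hc' (b - Algebra.trace F E (u * b) • b0) (by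
    rw [mul_sub, mul_smul_comm, map_sub, map_smul, hb0, smul_eq_mul, mul_one, sub_self])
  rw [mul_sub, mul_smul_comm, map_sub, map_smul, smul_eq_mul] at this
  rw [sub_mul, smul_mul_assoc, map_sub, map_smul, smul_eq_mul]
  linear_combination this

theorem card_plane (hdim : Module.finrank F E = 3) {a : E} (ha : a ≠ 0) (k : F) :
    (Finset.univ.filter fun b : E => Algebra.trace F E (a * b) = k).card = Fintype.card F ^ 2 := by
  have h := card_fiber ((Algebra.trace F E).toAddMonoidHom.comp (AddMonoidHom.mulLeft a)) (by
    intro w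
    obtain ⟨b, hb⟩ := exists_tr_one (F := F) ha
    refine ⟨w • b, ?_⟩
    simp [hb]) k
  rw [card_E hdim] at h
  have hpos : 0 < Fintype.card F := Fintype.card_pos
  apply Nat.eq_of_mul_eq_mul_right hpos
  rw [← pow_succ, ← h]
  rfl

theorem card_line (hdim : Module.finrank F E = 3) {a u : E} (hu : u ≠ 0) (ha : ∀ l : F, a ≠ l • u)
    (k : F) :
    (Finset.univ.filter fun b : E => Algebra.trace F E (a * b) = 0 ∧
      Algebra.trace F E (u * b) = k).card = Fintype.card F := by
  have h := card_fiber (((Algebra.trace F E).toAddMonoidHom.comp (AddMonoidHom.mulLeft a)).prod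
    ((Algebra.trace F E).toAddMonoidHom.comp (AddMonoidHom.mulLeft u))) (by
    rintro ⟨x, y⟩
    obtain ⟨b0, hb0⟩ := exists_tr_one (F := F) hu
    obtain ⟨b1, hb1, hb1'⟩ := exists_dual_pair (F := F) hu ha
    refine ⟨x • b1 + y • (b0 - Algebra.trace F E (a * b0) • b1), ?_⟩
    simp [mul_add, mul_sub, hb0, hb1, hb1']) (0, k)
  rw [card_E hdim, Fintype.card_prod] at h
  have hpos : 0 < Fintype.card F := Fintype.card_pos
  apply Nat.eq_of_mul_eq_mul_right (Nat.mul_pos hpos hpos)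
  have : Fintype.card F * (Fintype.card F * Fintype.card F) = Fintype.card F ^ 3 := by ring
  rw [this, ← h]
  congr 2
  ext b
  simp

end basic

section charsum
variable {F E : Type*} [Field F] [Fintype F] [Field E] [Fintype E] [Algebra F E]

/-- the number `A` : the sum of the quadratic character over the plane `tr y = 1`. -/
noncomputable def Asum (F E : Type*) [Field F] [Fintype F] [Field E] [Fintype E] [Algebra F E] : ℤ :=
  ∑ y : E, if Algebra.trace F E y = 1 then quadraticChar E y else 0

theorem plane_sum (hq : Fintype.card F % 4 = 1) (hdim : Module.finrank F E = 3)
    {s : E} (hs : s ≠ 0) (k : F) :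
    (∑ y : E, if Algebra.trace F E (s * y) = k then quadraticChar E y else 0)
      = quadraticChar E s * quadraticChar F k * Asum F E := by
  by_cases hk : k = 0
  · subst hk
    obtain ⟨c, hc⟩ := quadraticChar_exists_neg_one (F := F) (ringChar_ne_two_of (by omega))
    have hc0 : c ≠ 0 := by rintro rfl; simp at hc
    have hc0' : algebraMap F E c ≠ 0 := by simpa using hc0
    have h := Fintype.sum_equiv (Equiv.mulLeft₀ (algebraMap F E c) hc0')
      (fun y : E => if Algebra.trace F E (s * (algebraMap F E c * y)) = 0
        then quadraticChar E (algebraMap F E c * y) else 0)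
      (fun y : E => if Algebra.trace F E (s * y) = 0 then quadraticChar E y else 0)
      (fun y => rfl)
    have h2 : ∀ y : E, (if Algebra.trace F E (s * (algebraMap F E c * y)) = 0
        then quadraticChar E (algebraMap F E c * y) else 0)
        = - (if Algebra.trace F E (s * y) = 0 then quadraticChar E y else 0) := by
      intro y
      rw [← Algebra.smul_def, mul_smul_comm, map_smul, smul_eq_mul, Algebra.smul_def, chi_mul,
        eta_algebraMap hq hdim, hc]
      by_cases h : Algebra.trace F E (s * y) = 0
      · simp [h]
      · simp [h, hc0]
    rw [Finset.sum_congr rfl (fun y _ => h2 y), Finset.sum_neg_distrib] at h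
    rw [quadraticChar_zero]
    linarith
  · have hk' : algebraMap F E k ≠ 0 := by simpa using hk
    have h := Fintype.sum_equiv (Equiv.mulLeft₀ (algebraMap F E k * s⁻¹)
        (mul_ne_zero hk' (inv_ne_zero hs)))
      (fun y : E => if Algebra.trace F E (s * ((algebraMap F E k * s⁻¹) * y)) = k
        then quadraticChar E ((algebraMap F E k * s⁻¹) * y) else 0)
      (fun y : E => if Algebra.trace F E (s * y) = k then quadraticChar E y else 0)
      (fun y => rfl)
    rw [← h, Asum, Finset.mul_sum]
    refine Finset.sum_congr rfl fun y _ => ?_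
    have e : s * ((algebraMap F E k * s⁻¹) * y) = k • y := by
      rw [Algebra.smul_def]; field_simp
    rw [e, map_smul, smul_eq_mul, map_mul, map_mul, eta_algebraMap hq hdim, chi_inv]
    have : (k * Algebra.trace F E y = k) ↔ Algebra.trace F E y = 1 := by
      constructor
      · intro h
        exact mul_left_cancel₀ hk (by rw [h, mul_one])
      · intro h; rw [h, mul_one]
    simp only [this]
    split_ifs
    · ring
    · simp

theorem inner_sum (h2 : ringChar E ≠ 2) (r : E) :
    (∑ t : E, if t + t⁻¹ = r then quadraticChar E t else 0)
      = quadraticChar E (r + 2) + quadraticChar E (r - 2) := by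
  have two : (2 : E) ≠ 0 := Ring.two_ne_zero h2
  by_cases hex : ∃ t : E, t ≠ 0 ∧ t + t⁻¹ = r
  · obtain ⟨t, ht, rfl⟩ := hex
    have hiff : ∀ x : E, x ≠ 0 → (x + x⁻¹ = t + t⁻¹ ↔ x = t ∨ x = t⁻¹) := by
      intro x hx
      constructor
      · intro h
        have : (x - t) * (x - t⁻¹) = 0 := by
          have : (x - t) * (x - t⁻¹) = x * ((x + x⁻¹) - (t + t⁻¹)) := by field_simp; ring
          rw [this, h, sub_self, mul_zero]
        rcases mul_eq_zero.1 this with h | h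
        · left; exact sub_eq_zero.1 h
        · right; exact sub_eq_zero.1 h
      · rintro (rfl | rfl)
        · rfl
        · rw [inv_inv, add_comm]
    have e1 : quadraticChar E (t + t⁻¹ + 2) = quadraticChar E t * quadraticChar E (t + 1) ^ 2 := by
      have : t + t⁻¹ + 2 = t⁻¹ * (t + 1) ^ 2 := by field_simp; ring
      rw [this, map_mul, map_pow, chi_inv]
    have e2 : quadraticChar E (t + t⁻¹ - 2) = quadraticChar E t * quadraticChar E (t - 1) ^ 2 := by
      have : t + t⁻¹ - 2 = t⁻¹ * (t - 1) ^ 2 := by field_simp; ring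
      rw [this, map_mul, map_pow, chi_inv]
    have hsum : (∑ x : E, if x + x⁻¹ = t + t⁻¹ then quadraticChar E x else 0)
        = ∑ x ∈ ({t, t⁻¹} : Finset E), quadraticChar E x := by
      rw [← Finset.sum_filter]
      symm
      apply Finset.sum_subset_zero_on_sdiff
      · intro x hx
        have hx' : x = t ∨ x = t⁻¹ := by simpa using hx
        have hx0 : x ≠ 0 := by
          rcases hx' with rfl | rfl
          · exact ht
          · exact inv_ne_zero ht
        simp only [Finset.mem_filter, Finset.mem_univ, true_and]
        exact (hiff x hx0).2 hx'
      · intro x hx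
        simp only [Finset.mem_sdiff, Finset.mem_filter, Finset.mem_univ, true_and,
          Finset.mem_insert, Finset.mem_singleton] at hx
        by_cases hx0 : x = 0
        · simp [hx0]
        · exact absurd ((hiff x hx0).1 hx.1) hx.2
      · intro x _; rfl
    rw [hsum, e1, e2]
    by_cases htt : t = t⁻¹
    · rw [← htt]
      have : (t - 1) * (t + 1) = 0 := by
        have : t * t = 1 := by nth_rewrite 2 [htt]; exact mul_inv_cancel₀ ht
        linear_combination this
      simp only [Finset.pair_eq_singleton, Finset.sum_singleton]
      rcases mul_eq_zero.1 this with h | h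
      · have : t = 1 := sub_eq_zero.1 h
        subst this
        rw [sub_self, quadraticChar_zero]
        have : (1 + 1 : E) ≠ 0 := by rw [one_add_one_eq_two]; exact two
        rw [quadraticChar_sq_one this]
        simp
      · have : t = -1 := eq_neg_of_add_eq_zero_left h
        subst this
        have h3 : (-1 - 1 : E) ≠ 0 := by
          intro h; apply two; linear_combination -h
        rw [h, quadraticChar_zero, quadraticChar_sq_one h3]
        simp
    · rw [Finset.sum_pair htt, chi_inv]
      have hm : t - 1 ≠ 0 := by
        intro h; apply htt
        rw [sub_eq_zero.1 h, inv_one]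
      have hp : t + 1 ≠ 0 := by
        intro h; apply htt
        rw [eq_neg_of_add_eq_zero_left h, inv_neg, inv_one]
      rw [quadraticChar_sq_one hm, quadraticChar_sq_one hp]
      ring
  · have hz : ∀ t : E, (if t + t⁻¹ = r then quadraticChar E t else 0) = 0 := by
      intro t
      by_cases ht : t = 0
      · simp [ht]
      · rw [if_neg]
        intro h; exact hex ⟨t, ht, h⟩
    rw [Finset.sum_congr rfl (fun t _ => hz t), Finset.sum_const_zero]
    have hns : ¬ IsSquare ((r + 2) * (r - 2)) := by
      rintro ⟨m, hm⟩
      have hprod : ((r + m) / 2) * ((r - m) / 2) = 1 := by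
        field_simp
        linear_combination hm
      apply hex
      refine ⟨(r + m) / 2, ?_, ?_⟩
      · intro h; rw [h, zero_mul] at hprod; exact zero_ne_one hprod
      · rw [inv_eq_of_mul_eq_one_right hprod]
        field_simp; ring
    have h3 := quadraticChar_neg_one_iff_not_isSquare.2 hns
    rw [map_mul] at h3
    have hr1 : r + 2 ≠ 0 := by intro h; rw [h] at h3; simp at h3
    rcases quadraticChar_dichotomy hr1 with h | h <;> rw [h] at h3 ⊢ <;> linarith

theorem R_sum (hq : Fintype.card F % 4 = 1) (hdim : Module.finrank F E = 3) {s : E} (hs : s ≠ 0) :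
    (∑ t : E, if Algebra.trace F E (s * (t + t⁻¹)) = 0 then quadraticChar E t else 0)
      = 2 * quadraticChar E s * Asum F E * quadraticChar F 2 *
        quadraticChar F (Algebra.trace F E s) := by
  have hE2 : ringChar E ≠ 2 := ringChar_ne_two_of (card_E_odd hq hdim)
  have step1 : (∑ t : E, if Algebra.trace F E (s * (t + t⁻¹)) = 0 then quadraticChar E t else 0)
      = ∑ r : E, if Algebra.trace F E (s * r) = 0 then
          (∑ t : E, if t + t⁻¹ = r then quadraticChar E t else 0) else 0 := by
    have : ∀ r : E, (if Algebra.trace F E (s * r) = 0 then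
          (∑ t : E, if t + t⁻¹ = r then quadraticChar E t else 0) else 0)
        = ∑ t : E, if t + t⁻¹ = r then
          (if Algebra.trace F E (s * r) = 0 then quadraticChar E t else 0) else 0 := by
      intro r
      split_ifs <;> simp
    rw [Finset.sum_congr rfl (fun r _ => this r), Finset.sum_comm]
    refine Finset.sum_congr rfl fun t _ => ?_
    rw [Finset.sum_ite_eq]
    simp
  rw [step1]
  simp only [inner_sum hE2]
  have hsplit : ∀ r : E, (if Algebra.trace F E (s * r) = 0 then
      quadraticChar E (r + 2) + quadraticChar E (r - 2) else 0)
      = (if Algebra.trace F E (s * (r + 2)) = 2 * Algebra.trace F E s then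
          quadraticChar E (r + 2) else 0)
      + (if Algebra.trace F E (s * (r - 2)) = -(2 * Algebra.trace F E s) then
          quadraticChar E (r - 2) else 0) := by
    intro r
    have e1 : Algebra.trace F E (s * (r + 2)) = Algebra.trace F E (s * r)
        + 2 * Algebra.trace F E s := by
      rw [mul_add, map_add, mul_two, map_add]; ring
    have e2 : Algebra.trace F E (s * (r - 2)) = Algebra.trace F E (s * r)
        - 2 * Algebra.trace F E s := by
      rw [mul_sub, map_sub, mul_two, map_add]; ring
    rw [e1, e2]
    have c1 : (Algebra.trace F E (s * r) + 2 * Algebra.trace F E s = 2 * Algebra.trace F E s)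
      ↔ Algebra.trace F E (s * r) = 0 := by simp
    have c2 : (Algebra.trace F E (s * r) - 2 * Algebra.trace F E s = -(2 * Algebra.trace F E s))
      ↔ Algebra.trace F E (s * r) = 0 := by
      constructor
      · intro h; linear_combination h
      · intro h; linear_combination h
    simp only [c1, c2]
    split_ifs <;> simp
  rw [Finset.sum_congr rfl (fun r _ => hsplit r), Finset.sum_add_distrib]
  have s1 := Fintype.sum_equiv (Equiv.addRight (2 : E))
    (fun r : E => if Algebra.trace F E (s * (r + 2)) = 2 * Algebra.trace F E s then
          quadraticChar E (r + 2) else 0)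
    (fun y : E => if Algebra.trace F E (s * y) = 2 * Algebra.trace F E s then
          quadraticChar E y else 0) (fun y => rfl)
  have s2 := Fintype.sum_equiv (Equiv.subRight (2 : E))
    (fun r : E => if Algebra.trace F E (s * (r - 2)) = -(2 * Algebra.trace F E s) then
          quadraticChar E (r - 2) else 0)
    (fun y : E => if Algebra.trace F E (s * y) = -(2 * Algebra.trace F E s) then
          quadraticChar E y else 0) (fun y => rfl)
  rw [s1, s2, plane_sum hq hdim hs, plane_sum hq hdim hs, chi_neg hq, map_mul]
  ring

/-- the kernel sum -/
noncomputable def Ssum (F : Type*) {E : Type*} [Field F] [Fintype F] [Field E] [Fintype E]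
    [Algebra F E] (z w : E) : ℤ :=
  ∑ a : E, if Algebra.trace F E (z * a⁻¹ + w * a) = 0 then quadraticChar E a else 0

theorem Ssum_sq (hq : Fintype.card F % 4 = 1) (hdim : Module.finrank F E = 3) {z w s : E}
    (hw : w ≠ 0) (hs : s ≠ 0) (h : z * w = s ^ 2) :
    Ssum F z w = 2 * Asum F E * quadraticChar F 2 * quadraticChar E w *
      quadraticChar F (Algebra.trace F E s) := by
  have hsw : s * w⁻¹ ≠ 0 := mul_ne_zero hs (inv_ne_zero hw)
  have e := Fintype.sum_equiv (Equiv.mulLeft₀ (s * w⁻¹) hsw)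
    (fun t : E => if Algebra.trace F E (z * (s * w⁻¹ * t)⁻¹ + w * (s * w⁻¹ * t)) = 0 then
      quadraticChar E (s * w⁻¹ * t) else 0)
    (fun a : E => if Algebra.trace F E (z * a⁻¹ + w * a) = 0 then quadraticChar E a else 0)
    (fun y => rfl)
  rw [Ssum, ← e]
  have : ∀ t : E, (if Algebra.trace F E (z * (s * w⁻¹ * t)⁻¹ + w * (s * w⁻¹ * t)) = 0 then
      quadraticChar E (s * w⁻¹ * t) else 0) = quadraticChar E s * quadraticChar E w *
      (if Algebra.trace F E (s * (t + t⁻¹)) = 0 then quadraticChar E t else 0) := by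
    intro t
    have : z * (s * w⁻¹ * t)⁻¹ + w * (s * w⁻¹ * t) = s * (t + t⁻¹) := by
      have e1 : z * (s * w⁻¹ * t)⁻¹ = s * t⁻¹ := by
        rw [mul_inv, mul_inv, inv_inv]
        have : z * (s⁻¹ * w * t⁻¹) = (z * w) * s⁻¹ * t⁻¹ := by ring
        rw [this, h]; field_simp
      rw [e1]; field_simp; ring
    rw [this, chi_mul, chi_mul, chi_inv]
    split_ifs <;> simp
  rw [Finset.sum_congr rfl (fun t _ => this t), ← Finset.mul_sum, R_sum hq hdim hs]
  linear_combination (2 * quadraticChar E w * Asum F E * quadraticChar F 2 *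
    quadraticChar F (Algebra.trace F E s)) * (chi_mul_self hs)

theorem Ssum_nsq {z w : E} (h : quadraticChar E (z * w) = -1) : Ssum F z w = 0 := by
  have hzw : z * w ≠ 0 := by intro h0; rw [h0] at h; simp at h
  have hz : z ≠ 0 := left_ne_zero_of_mul hzw
  have hw : w ≠ 0 := right_ne_zero_of_mul hzw
  have e := Fintype.sum_equiv ((Equiv.inv E).trans (Equiv.mulLeft₀ (z * w⁻¹)
      (mul_ne_zero hz (inv_ne_zero hw))))
    (fun t : E => if Algebra.trace F E (z * (z * w⁻¹ * t⁻¹)⁻¹ + w * (z * w⁻¹ * t⁻¹)) = 0 then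
      quadraticChar E (z * w⁻¹ * t⁻¹) else 0)
    (fun a : E => if Algebra.trace F E (z * a⁻¹ + w * a) = 0 then quadraticChar E a else 0)
    (fun y => rfl)
  have : ∀ t : E, (if Algebra.trace F E (z * (z * w⁻¹ * t⁻¹)⁻¹ + w * (z * w⁻¹ * t⁻¹)) = 0 then
      quadraticChar E (z * w⁻¹ * t⁻¹) else 0) =
      - (if Algebra.trace F E (z * t⁻¹ + w * t) = 0 then quadraticChar E t else 0) := by
    intro t
    have e1 : z * (z * w⁻¹ * t⁻¹)⁻¹ + w * (z * w⁻¹ * t⁻¹) = z * t⁻¹ + w * t := by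
      rw [mul_inv, mul_inv, inv_inv, inv_inv]; field_simp; ring
    have e2 : quadraticChar E (z * w⁻¹ * t⁻¹) = - quadraticChar E t := by
      rw [map_mul, map_mul, chi_inv, chi_inv, ← map_mul, h]; ring
    rw [e1, e2]
    split_ifs <;> simp
  rw [Finset.sum_congr rfl (fun t _ => this t), Finset.sum_neg_distrib] at e
  rw [Ssum]; linarith

theorem Ssum_zero_left (hq : Fintype.card F % 4 = 1) (hdim : Module.finrank F E = 3) {w : E}
    (hw : w ≠ 0) : Ssum F 0 w = 0 := by
  have := plane_sum hq hdim hw (0 : F)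
  simp only [Ssum, zero_mul, zero_add]
  rw [this]; simp

theorem Ssum_zero_right (hq : Fintype.card F % 4 = 1) (hdim : Module.finrank F E = 3) {z : E}
    (hz : z ≠ 0) : Ssum F z 0 = 0 := by
  have := plane_sum hq hdim hz (0 : F)
  simp only [Ssum, zero_mul, add_zero]
  have e := Fintype.sum_equiv (Equiv.inv E)
    (fun a : E => if Algebra.trace F E (z * a⁻¹) = 0 then quadraticChar E a else 0)
    (fun a : E => if Algebra.trace F E (z * a) = 0 then quadraticChar E a else 0)
    (fun y => by rw [Equiv.inv_apply, chi_inv])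
  rw [e, this]; simp

end charsum

section conic
theorem tr_smul_mul {F E : Type*} [Field F] [Field E] [Algebra F E] (l : F) (x y : E) :
    Algebra.trace F E ((l • x) * y) = l * Algebra.trace F E (x * y) := by
  rw [smul_mul_assoc, map_smul, smul_eq_mul]

theorem tr_mul_smul {F E : Type*} [Field F] [Field E] [Algebra F E] (l : F) (x y : E) :
    Algebra.trace F E (x * (l • y)) = l * Algebra.trace F E (x * y) := by
  rw [mul_smul_comm, map_smul, smul_eq_mul]

variable {F E : Type*} [Field F] [Fintype F] [Field E] [Fintype E] [Algebra F E]

theorem exists_isotropic (hq : Fintype.card F % 4 = 1) (hdim : Module.finrank F E = 3) :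
    ∃ e : E, e ≠ 0 ∧ Algebra.trace F E (e * e) = 0 := by
  have hcard := card_plane (F := F) hdim (one_ne_zero (α := E)) 0
  have hF : 1 < Fintype.card F := Fintype.one_lt_card
  have h1 : 1 < (Finset.univ.filter fun b : E => Algebra.trace F E (1 * b) = 0).card := by
    rw [hcard]; nlinarith
  obtain ⟨z, hz, hz0⟩ := Finset.exists_mem_ne h1 0
  simp only [Finset.mem_filter, Finset.mem_univ, true_and, one_mul] at hz
  obtain ⟨c, hc⟩ := quadraticChar_exists_neg_one (F := F) (ringChar_ne_two_of (by omega))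
  have hc0 : c ≠ 0 := by rintro rfl; simp at hc
  rcases quadraticChar_dichotomy hz0 with h | h
  · obtain ⟨e, rfl⟩ := (quadraticChar_one_iff_isSquare hz0).1 h
    exact ⟨e, by rintro rfl; simp at hz0, hz⟩
  · have hcz : quadraticChar E (c • z) = 1 := by
      rw [Algebra.smul_def, chi_mul, eta_algebraMap hq hdim, hc, h]; rfl
    have hcz0 : c • z ≠ 0 := smul_ne_zero hc0 hz0
    obtain ⟨e, he⟩ := (quadraticChar_one_iff_isSquare hcz0).1 hcz
    refine ⟨e, ?_, ?_⟩
    · rintro rfl; rw [mul_zero] at he; exact hcz0 he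
    · rw [← he, map_smul, hz, smul_zero]

theorem exists_coords (hq : Fintype.card F % 4 = 1) (hdim : Module.finrank F E = 3) :
    ∃ (φ : (F × F × F) ≃ₗ[F] E) (d : F), d ≠ 0 ∧ ∀ X Y Z X' Y' Z' : F,
      Algebra.trace F E (φ (X, Y, Z) * φ (X', Y', Z')) = X * Y' + X' * Y + d * Z * Z' := by
  have two := two_ne hq
  obtain ⟨e0, he0, h00⟩ := exists_isotropic hq hdim
  obtain ⟨g, hg⟩ := exists_tr_one (F := F) he0
  obtain ⟨e1, h11, h01⟩ : ∃ e1 : E, Algebra.trace F E (e1 * e1) = 0 ∧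
      Algebra.trace F E (e0 * e1) = 1 := by
    refine ⟨g - (Algebra.trace F E (g * g) / 2) • e0, ?_, ?_⟩
    · have hg' : Algebra.trace F E (g * e0) = 1 := by rw [mul_comm]; exact hg
      simp only [mul_sub, sub_mul, map_sub, tr_smul_mul, tr_mul_smul, h00, hg, hg']
      field_simp; ring
    · simp only [mul_sub, map_sub, tr_mul_smul, h00, hg]; ring
  have h10 : Algebra.trace F E (e1 * e0) = 1 := by rw [mul_comm]; exact h01
  have hind : ∀ l : F, e1 ≠ l • e0 := by
    rintro l rfl
    rw [tr_smul_mul, h00] at h10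
    simp at h10
  have hcard := card_line (F := F) hdim he0 hind 0
  obtain ⟨e2, he2, he20⟩ := Finset.exists_mem_ne (by rw [hcard]; exact Fintype.one_lt_card) (0 : E)
  simp only [Finset.mem_filter, Finset.mem_univ, true_and] at he2
  obtain ⟨h12, h02⟩ := he2
  have h21 : Algebra.trace F E (e2 * e1) = 0 := by rw [mul_comm]; exact h12
  have h20 : Algebra.trace F E (e2 * e0) = 0 := by rw [mul_comm]; exact h02
  let φ₀ : (F × F × F) →ₗ[F] E :=
    { toFun := fun v => v.1 • e0 + v.2.1 • e1 + v.2.2 • e2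
      map_add' := by intro v w; simp only [Prod.fst_add, Prod.snd_add, add_smul]; abel
      map_smul' := by
        intro c v
        simp only [Prod.smul_fst, Prod.smul_snd, smul_add, smul_smul, smul_eq_mul,
          RingHom.id_apply] }
  have hφ₀ : ∀ X Y Z, φ₀ (X, Y, Z) = X • e0 + Y • e1 + Z • e2 := fun _ _ _ => rfl
  have hinj : Function.Injective φ₀ := by
    rw [← LinearMap.ker_eq_bot, LinearMap.ker_eq_bot']
    rintro ⟨X, Y, Z⟩ h
    rw [hφ₀] at h
    have a1 : Algebra.trace F E ((X • e0 + Y • e1 + Z • e2) * e1) = 0 := by rw [h]; simp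
    have a0 : Algebra.trace F E ((X • e0 + Y • e1 + Z • e2) * e0) = 0 := by rw [h]; simp
    simp only [add_mul, map_add, tr_smul_mul, h00, h01, h10, h11, h20, h21] at a0 a1
    have hX : X = 0 := by linear_combination a1
    have hY : Y = 0 := by linear_combination a0
    subst hX; subst hY
    simp only [zero_smul, zero_add, smul_eq_zero, he20, or_false] at h
    simp [h]
  let φ := LinearEquiv.ofInjectiveOfFinrankEq φ₀ hinj (by simp [hdim])
  have hφ : ∀ X Y Z, φ (X, Y, Z) = X • e0 + Y • e1 + Z • e2 := fun _ _ _ => rfl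
  have hform : ∀ X Y Z X' Y' Z' : F,
      Algebra.trace F E (φ (X, Y, Z) * φ (X', Y', Z'))
        = X * Y' + X' * Y + Algebra.trace F E (e2 * e2) * Z * Z' := by
    intro X Y Z X' Y' Z'
    simp only [hφ, add_mul, mul_add, map_add, tr_smul_mul, tr_mul_smul, h00, h01, h10, h11, h20,
      h21, h02, h12]
    ring
  refine ⟨φ, Algebra.trace F E (e2 * e2), ?_, hform⟩
  intro hd
  apply he20
  apply tr_nondeg (F := F)
  intro b
  obtain ⟨⟨X, Y, Z⟩, rfl⟩ := φ.surjective b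
  rw [hφ]
  simp only [mul_add, map_add, tr_mul_smul, h20, h21, hd]
  ring

theorem count_quadric (hq : Fintype.card F % 4 = 1) (d k : F) :
    (Finset.univ.filter fun v : F × F × F => 2 * v.1 * v.2.1 + d * v.2.2 * v.2.2 = k).card
      = Fintype.card F * (Fintype.card F - 1) + Fintype.card F *
        (Finset.univ.filter fun Z : F => d * Z * Z = k).card := by
  have two := two_ne hq
  rw [← Finset.card_filter_add_card_filter_not (fun v : F × F × F => v.1 ≠ 0)]
  congr 1
  · rw [Finset.filter_filter]
    have : ((Finset.univ : Finset F) ×ˢ (Finset.univ.erase (0 : F))).card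
        = Fintype.card F * (Fintype.card F - 1) := by
      rw [Finset.card_product, Finset.card_erase_of_mem (Finset.mem_univ _), Finset.card_univ]
    rw [← this]
    symm
    refine Finset.card_bij (fun (p : F × F) _ => (p.2, (k - d * p.1 * p.1) / (2 * p.2), p.1)) ?_ ?_ ?_
    · rintro ⟨Z, X⟩ h
      simp only [Finset.mem_product, Finset.mem_univ, true_and, Finset.mem_erase, and_true] at h
      simp only [Finset.mem_filter, Finset.mem_univ, true_and]
      refine ⟨?_, h⟩
      field_simp; ring
    · rintro ⟨Z, X⟩ _ ⟨Z', X'⟩ _ h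
      simp only [Prod.mk.injEq] at h ⊢
      exact ⟨h.2.2, h.1⟩
    · rintro ⟨X, Y, Z⟩ h
      simp only [Finset.mem_filter, Finset.mem_univ, true_and] at h
      refine ⟨(Z, X), by simp [h.2], ?_⟩
      have hX := h.2
      simp only [Prod.mk.injEq, true_and, and_true]
      rw [← h.1]
      field_simp; ring
  · rw [Finset.filter_filter]
    have : ((Finset.univ : Finset F) ×ˢ (Finset.univ.filter fun Z : F => d * Z * Z = k)).card
        = Fintype.card F * (Finset.univ.filter fun Z : F => d * Z * Z = k).card := by
      rw [Finset.card_product, Finset.card_univ]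
    rw [← this]
    symm
    refine Finset.card_bij (fun (p : F × F) _ => (0, p)) ?_ ?_ ?_
    · rintro ⟨Y, Z⟩ h
      simpa using h
    · rintro ⟨Z, X⟩ _ ⟨Z', X'⟩ _ h
      simpa using h
    · rintro ⟨X, Y, Z⟩ h
      simp only [Finset.mem_filter, Finset.mem_univ, true_and, not_not] at h
      obtain ⟨h, rfl⟩ := h
      exact ⟨(Y, Z), by simpa using h, rfl⟩

theorem sum_sqrt {K : Type*} [Field K] [Fintype K] (h2 : ringChar K ≠ 2) {c : K} (hc : c ≠ 0)
    (G : K → ℤ) :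
    ∑ y : K, G (c * y ^ 2) = ∑ z : K, (1 + quadraticChar K z * quadraticChar K c) * G z := by
  have h1 : ∀ y : K, G (c * y ^ 2) = ∑ z : K, if z = c * y ^ 2 then G z else 0 := by
    intro y; simp
  rw [Finset.sum_congr rfl (fun y _ => h1 y), Finset.sum_comm]
  refine Finset.sum_congr rfl fun z _ => ?_
  rw [← Finset.sum_filter, Finset.sum_const, nsmul_eq_mul]
  congr 1
  have h3 := quadraticChar_card_sqrts h2 (z * c⁻¹)
  rw [chi_mul, chi_inv] at h3
  rw [add_comm, ← h3]
  norm_cast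
  congr 1
  ext y
  simp only [Finset.mem_filter, Finset.mem_univ, true_and, Set.mem_toFinset, Set.mem_ofPred_eq]
  constructor
  · rintro rfl; field_simp
  · intro h; rw [h]; field_simp

theorem exists_h (hq : Fintype.card F % 4 = 1) (hdim : Module.finrank F E = 3) :
    ∃ (h : E → ℤ) (δ : ℤ), Asum F E = δ * Fintype.card F ∧ δ * δ = 1 ∧ h 0 = 0 ∧
      (∀ (l : F) (x : E), h (l • x) = quadraticChar F l * h x) ∧
      (∀ x : E, x ≠ 0 → Algebra.trace F E (x * x) = 0 → h x = 1 ∨ h x = -1) ∧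
      (∀ x y : E, x ≠ 0 → y ≠ 0 → Algebra.trace F E (x * x) = 0 →
        Algebra.trace F E (y * y) = 0 → (∀ l : F, y ≠ l • x) →
        h y * quadraticChar F (Algebra.trace F E (x * y)) = δ * quadraticChar F 2 * h x) ∧
      (Finset.univ.filter fun x : E => Algebra.trace F E (x * x) = 0).card
        = Fintype.card F ^ 2 := by
  have two := two_ne hq
  have hF2 : ringChar F ≠ 2 := ringChar_ne_two_of (by omega)
  have hE2 : ringChar E ≠ 2 := ringChar_ne_two_of (card_E_odd hq hdim)
  obtain ⟨φ, d, hd, hφ⟩ := exists_coords hq hdim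
  have hcount : ∀ k : F, (Finset.univ.filter fun x : E => Algebra.trace F E (x * x) = k).card
      = Fintype.card F * (Fintype.card F - 1) + Fintype.card F *
        (Finset.univ.filter fun Z : F => d * Z * Z = k).card := by
    intro k
    rw [← count_quadric hq d k]
    symm
    refine Finset.card_bij (fun v _ => φ v) ?_ ?_ ?_
    · rintro ⟨X, Y, Z⟩ h
      simp only [Finset.mem_filter, Finset.mem_univ, true_and] at h ⊢
      rw [hφ, ← h]; ring
    · intro a _ b _ h
      exact φ.injective h
    · intro x hx
      obtain ⟨⟨X, Y, Z⟩, rfl⟩ := φ.surjective x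
      simp only [Finset.mem_filter, Finset.mem_univ, true_and] at hx
      refine ⟨(X, Y, Z), ?_, rfl⟩
      simp only [Finset.mem_filter, Finset.mem_univ, true_and]
      rw [← hx, hφ]; ring
  have hpos : 1 ≤ Fintype.card F := Fintype.card_pos
  let hc : F × F × F → ℤ := fun v =>
    if v.1 ≠ 0 then quadraticChar F v.1 else quadraticChar F (2 * d) * quadraticChar F v.2.1
  have key : ∀ X Y Z X' Y' Z' : F, (X, Y, Z) ≠ 0 → (X', Y', Z') ≠ 0 →
      2 * X * Y + d * Z * Z = 0 → 2 * X' * Y' + d * Z' * Z' = 0 →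
      (∀ l : F, (X', Y', Z') ≠ l • (X, Y, Z)) →
      hc (X', Y', Z') * quadraticChar F (X * Y' + X' * Y + d * Z * Z')
        = quadraticChar F (2 * d) * hc (X, Y, Z) := by
    intro X Y Z X' Y' Z' hv hv' hQ hQ' hl
    have h2d : (2 * d) ≠ 0 := mul_ne_zero two hd
    by_cases hX : X = 0
    · subst hX
      have hZ : Z = 0 := by
        have : d * Z * Z = 0 := by linear_combination hQ
        simpa [hd] using this
      subst hZ
      have hY : Y ≠ 0 := by rintro rfl; exact hv rfl
      by_cases hX' : X' = 0
      · subst hX'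
        have hZ' : Z' = 0 := by
          have : d * Z' * Z' = 0 := by linear_combination hQ'
          simpa [hd] using this
        subst hZ'
        exfalso
        apply hl (Y' / Y)
        simp [hY]
      · simp only [hc, ne_eq, hX', not_false_eq_true, if_true, not_true_eq_false, if_false]
        have : 0 * Y' + X' * Y + d * 0 * Z' = X' * Y := by ring
        rw [this, chi_mul X' Y, ← mul_assoc, chi_mul_self hX', one_mul, ← mul_assoc,
          chi_mul_self h2d, one_mul]
    · by_cases hX' : X' = 0
      · subst hX'
        have hZ' : Z' = 0 := by
          have : d * Z' * Z' = 0 := by linear_combination hQ'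
          simpa [hd] using this
        subst hZ'
        have hY' : Y' ≠ 0 := by rintro rfl; exact hv' rfl
        simp only [hc, ne_eq, hX, not_false_eq_true, if_true, not_true_eq_false, if_false]
        have : X * Y' + 0 * Y + d * Z * 0 = X * Y' := by ring
        rw [this, chi_mul X Y']
        linear_combination (quadraticChar F (2 * d) * quadraticChar F X) * chi_mul_self hY'
      · simp only [hc, ne_eq, hX', hX, not_false_eq_true, if_true]
        have hne : X * Z' - X' * Z ≠ 0 := by
          intro h0
          apply hl (X' / X)
          have hZ' : Z' = X' / X * Z := by field_simp; linear_combination h0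
          have hY : Y = - (d * Z * Z) / (2 * X) := by field_simp; linear_combination hQ
          have hY' : Y' = - (d * Z' * Z') / (2 * X') := by field_simp; linear_combination hQ'
          simp only [Prod.smul_mk, smul_eq_mul, Prod.mk.injEq]
          refine ⟨by field_simp, ?_, hZ'⟩
          rw [hY', hY, hZ']; field_simp
        have hid : (2 * d) * X * X' * (X * Y' + X' * Y + d * Z * Z')
            = - (d * (X * Z' - X' * Z)) ^ 2 := by
          linear_combination (d * X ^ 2) * hQ' + (d * X' ^ 2) * hQ
        have hid2 := congrArg (quadraticChar F) hid
        rw [chi_neg hq, quadraticChar_sq_one' (mul_ne_zero hd hne), chi_mul, chi_mul, chi_mul] at hid2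
        have hA := chi_mul_self h2d
        have hB := chi_mul_self hX
        have hC := chi_mul_self hX'
        generalize quadraticChar F (X * Y' + X' * Y + d * Z * Z') = t at *
        generalize quadraticChar F (2 * d) = a at *
        generalize quadraticChar F X = b at *
        generalize quadraticChar F X' = c at *
        have : a * b * (a * b * c * t) = a * b := by rw [hid2, mul_one]
        linear_combination this - (b * b * c * t) * hA - c * t * hB
  refine ⟨fun x => hc (φ.symm x), quadraticChar F d, ?_, chi_mul_self hd, ?_, ?_, ?_, ?_, ?_⟩
  · have h1 := hcount 1
    have h2 : ((Finset.univ.filter fun Z : F => d * Z * Z = 1).card : ℤ) = quadraticChar F d + 1 := by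
      have := quadraticChar_card_sqrts hF2 (d⁻¹)
      rw [chi_inv] at this
      rw [← this]
      norm_cast
      congr 1
      ext y
      simp only [Finset.mem_filter, Finset.mem_univ, true_and, Set.mem_toFinset, Set.mem_ofPred_eq]
      constructor
      · intro h; field_simp; linear_combination h
      · intro h; rw [mul_assoc, ← sq, h]; field_simp
    have h3 := sum_sqrt hE2 (one_ne_zero (α := E))
      (fun z => if Algebra.trace F E z = 1 then 1 else 0)
    have h4 := card_plane (F := F) hdim (one_ne_zero (α := E)) 1
    have h5 : ∑ z : E, (1 + quadraticChar E z * quadraticChar E 1) *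
        (if Algebra.trace F E z = 1 then 1 else 0) = (Fintype.card F : ℤ) ^ 2 + Asum F E := by
      have : ∀ z : E, (1 + quadraticChar E z * quadraticChar E 1) *
          (if Algebra.trace F E z = 1 then (1 : ℤ) else 0)
          = (if Algebra.trace F E (1 * z) = 1 then 1 else 0)
            + (if Algebra.trace F E z = 1 then quadraticChar E z else 0) := by
        intro z
        rw [map_one, one_mul]
        split_ifs <;> simp
      rw [Finset.sum_congr rfl (fun z _ => this z), Finset.sum_add_distrib, ← Asum,
        Finset.sum_boole, h4]
      push_cast; rfl
    rw [h5] at h3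
    simp only [one_mul, sq (M := E)] at h3
    rw [Finset.sum_boole, h1] at h3
    push_cast [Nat.cast_sub hpos] at h3
    rw [h2] at h3
    linear_combination -h3
  · simp [hc]
  · rintro l x
    simp only [map_smul]
    obtain ⟨⟨X, Y, Z⟩, rfl⟩ := φ.surjective x
    rw [LinearEquiv.symm_apply_apply]
    by_cases hl : l = 0
    · subst hl; simp [hc]
    · by_cases hX : X = 0
      · subst hX
        have e1 : hc (l • (0, Y, Z)) = quadraticChar F (2 * d) * quadraticChar F (l * Y) := by
          simp only [hc, Prod.smul_mk, smul_eq_mul, mul_zero, ne_eq, not_true_eq_false, if_false]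
        have e2 : hc (0, Y, Z) = quadraticChar F (2 * d) * quadraticChar F Y := by
          simp only [hc, ne_eq, not_true_eq_false, if_false]
        rw [e1, e2, chi_mul l Y]
        ring
      · simp only [hc, hX, Prod.smul_mk, smul_eq_mul, ne_eq, mul_eq_zero, hl, or_self,
          not_false_eq_true, if_true, chi_mul l X]
  · intro x hx0 hx
    obtain ⟨⟨X, Y, Z⟩, rfl⟩ := φ.surjective x
    simp only [LinearEquiv.symm_apply_apply]
    rw [hφ] at hx
    by_cases hX : X = 0
    · subst hX
      have hZ : Z = 0 := by
        have : d * Z * Z = 0 := by linear_combination hx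
        simpa [hd] using this
      subst hZ
      have hY : Y ≠ 0 := by
        rintro rfl; exact hx0 (map_zero φ)
      simp only [hc, ne_eq, not_true_eq_false, if_false]
      rw [← chi_mul]
      exact quadraticChar_dichotomy (mul_ne_zero (mul_ne_zero two hd) hY)
    · simp only [hc, ne_eq, hX, not_false_eq_true, if_true]
      exact quadraticChar_dichotomy hX
  · intro x y hx0 hy0 hx hy hl
    obtain ⟨⟨X, Y, Z⟩, rfl⟩ := φ.surjective x
    obtain ⟨⟨X', Y', Z'⟩, rfl⟩ := φ.surjective y
    rw [hφ] at hx hy ⊢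
    simp only [LinearEquiv.symm_apply_apply]
    rw [key X Y Z X' Y' Z' (by rintro h; rw [h] at hx0; exact hx0 (map_zero φ))
      (by rintro h; rw [h] at hy0; exact hy0 (map_zero φ)) (by linear_combination hx)
      (by linear_combination hy) (by intro l h; apply hl l; rw [h, map_smul]), chi_mul]
    ring
  · rw [hcount 0]
    have : (Finset.univ.filter fun Z : F => d * Z * Z = 0) = {0} := by
      ext Z; simp [hd]
    rw [this, Finset.card_singleton]
    obtain ⟨m, hm⟩ : ∃ m, Fintype.card F = m + 1 := ⟨Fintype.card F - 1, by omega⟩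
    rw [hm, Nat.add_sub_cancel]; ring

end conic

section mainsum
variable {F E : Type*} [Field F] [Fintype F] [Field E] [Fintype E] [Algebra F E]

theorem exists_f (hq : Fintype.card F % 4 = 1) (hdim : Module.finrank F E = 3) :
    ∃ f : E → ℤ, f 0 = 0 ∧ (∀ (l : F) (z : E), f ((l * l) • z) = quadraticChar F l * f z) ∧
      (∀ z : E, z ≠ 0 → Algebra.trace F E z = 0 → f z = 1 ∨ f z = -1) ∧
      (∀ u v : E, (u ≠ 0 ∨ v ≠ 0) → Algebra.trace F E (u * v) = 0 →
        (∑ z : E, if Algebra.trace F E z = 0 then f z * Ssum F (u * z) v else 0)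
          = ((Fintype.card F : ℤ) - 1) * (Fintype.card F : ℤ) ^ 2 * (quadraticChar E u * f (u * v))) := by
  have hE2 : ringChar E ≠ 2 := ringChar_ne_two_of (card_E_odd hq hdim)
  obtain ⟨h, δ, hA, hδ, h0, hl, hpm, hpair, hcard⟩ := exists_h (F := F) (E := E) hq hdim
  obtain ⟨c, hc⟩ := quadraticChar_exists_neg_one (F := F) (ringChar_ne_two_of (by omega))
  have hc0 : c ≠ 0 := by rintro rfl; simp at hc
  have hηc : quadraticChar E (algebraMap F E c) = -1 := by rw [eta_algebraMap hq hdim, hc]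
  have hc0' : algebraMap F E c ≠ 0 := by simpa using hc0
  have hneg : ∀ x : E, h (-x) = h x := by
    intro x
    have := hl (-1) x
    rwa [chi_neg_one hq, one_mul, neg_one_smul] at this
  let f : E → ℤ := fun z => if hz : ∃ x : E, z = x ^ 2 then h hz.choose else
    if hz : ∃ x : E, z = algebraMap F E c * x ^ 2 then h hz.choose else 0
  have hf1 : ∀ x, f (x ^ 2) = h x := by
    intro x
    have hz : ∃ y : E, x ^ 2 = y ^ 2 := ⟨x, rfl⟩
    have e : f (x ^ 2) = h hz.choose := by simp only [f]; rw [dif_pos hz]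
    rw [e]
    rcases sq_eq_sq_iff_eq_or_eq_neg.1 hz.choose_spec with h1 | h1
    · rw [← h1]
    · conv_rhs => rw [h1, hneg]
  have hf2 : ∀ x, f (algebraMap F E c * x ^ 2) = h x := by
    intro x
    by_cases hx : x = 0
    · subst hx
      have := hf1 0
      simpa using this
    have hz : ∃ y : E, algebraMap F E c * x ^ 2 = algebraMap F E c * y ^ 2 := ⟨x, rfl⟩
    have hn : ¬ ∃ y : E, algebraMap F E c * x ^ 2 = y ^ 2 := by
      rintro ⟨y, hy⟩
      have hy0 : y ≠ 0 := by
        rintro rfl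
        rw [zero_pow two_ne_zero] at hy
        exact mul_ne_zero hc0' (pow_ne_zero 2 hx) hy
      have := congrArg (quadraticChar E) hy
      rw [chi_mul, hηc, quadraticChar_sq_one' hx, quadraticChar_sq_one' hy0] at this
      norm_num at this
    have e : f (algebraMap F E c * x ^ 2) = h hz.choose := by
      simp only [f]; rw [dif_neg hn, dif_pos hz]
    rw [e]
    have hs := mul_left_cancel₀ hc0' hz.choose_spec
    rcases sq_eq_sq_iff_eq_or_eq_neg.1 hs with h1 | h1
    · rw [← h1]
    · conv_rhs => rw [h1, hneg]
  have hrep : ∀ w : E, ∃ (c' : F) (x : E), c' ≠ 0 ∧ w = algebraMap F E c' * x ^ 2 ∧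
      (∀ y, f (algebraMap F E c' * y ^ 2) = h y) := by
    intro w
    by_cases hw : IsSquare w
    · obtain ⟨x, hx⟩ := hw
      exact ⟨1, x, one_ne_zero, by rw [map_one, one_mul, hx, sq], by
        intro y; rw [map_one, one_mul]; exact hf1 y⟩
    · have h1 : quadraticChar E ((algebraMap F E c)⁻¹ * w) = 1 := by
        rw [chi_mul, chi_inv, hηc, quadraticChar_neg_one_iff_not_isSquare.2 hw]; rfl
      have hw0 : w ≠ 0 := by rintro rfl; exact hw ⟨0, by simp⟩
      obtain ⟨x, hx⟩ := (quadraticChar_one_iff_isSquare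
        (mul_ne_zero (inv_ne_zero hc0') hw0)).1 h1
      exact ⟨c, x, hc0, by rw [sq, ← hx]; field_simp, hf2⟩
  have hf0 : f 0 = 0 := by
    have := hf1 0
    rwa [zero_pow two_ne_zero, h0] at this
  refine ⟨f, hf0, ?_, ?_, ?_⟩
  · intro l z
    obtain ⟨c', x, hc', rfl, hfc⟩ := hrep z
    have : (l * l) • (algebraMap F E c' * x ^ 2) = algebraMap F E c' * (l • x) ^ 2 := by
      simp only [Algebra.smul_def, map_mul]; ring
    rw [this, hfc, hfc, hl]
  · intro z hz htr
    obtain ⟨c', x, hc', rfl, hfc⟩ := hrep z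
    rw [hfc]
    apply hpm
    · rintro rfl; simp at hz
    · rw [← Algebra.smul_def, map_smul, smul_eq_zero, sq] at htr
      exact htr.resolve_left hc'
  · intro u v huv htr
    by_cases hu : u = 0
    · subst hu
      have hv : v ≠ 0 := by simpa using huv
      simp only [zero_mul, Ssum_zero_left hq hdim hv, hf0, mul_zero, ite_self,
        Finset.sum_const_zero]
    by_cases hv : v = 0
    · subst hv
      rw [mul_zero, hf0, mul_zero, mul_zero]
      apply Finset.sum_eq_zero
      intro z _
      by_cases hz : z = 0
      · simp [hz, hf0]
      · rw [Ssum_zero_right hq hdim (mul_ne_zero hu hz)]; simp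
    obtain ⟨c', x, hc', hw, hfc⟩ := hrep (u * v)
    have hc1 : algebraMap F E c' ≠ 0 := by simpa using hc'
    have hw0 : u * v ≠ 0 := mul_ne_zero hu hv
    have hx : x ≠ 0 := by
      rintro rfl
      rw [hw] at hw0; simp at hw0
    have hxx : Algebra.trace F E (x * x) = 0 := by
      rw [hw, ← Algebra.smul_def, map_smul, smul_eq_zero, sq] at htr
      exact htr.resolve_left hc'
    have hηw : quadraticChar E u * quadraticChar E v = quadraticChar F c' := by
      rw [← chi_mul, hw, chi_mul, quadraticChar_sq_one' hx, mul_one, eta_algebraMap hq hdim]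
    have hfw : f (u * v) = h x := by rw [hw, hfc]
    set G : E → ℤ := fun z => if Algebra.trace F E z = 0 then f z * Ssum F (u * z) v else 0 with hG
    have hsum := sum_sqrt hE2 hc1 G
    have e1 : ∀ z : E, (1 + quadraticChar E z * quadraticChar E (algebraMap F E c')) * G z
        = 2 * G z := by
      intro z
      by_cases hz : z = 0
      · subst hz; simp [hG, hf0]
      rw [eta_algebraMap hq hdim, ← hηw]
      have hzz : quadraticChar E (u * z * v)
          = quadraticChar E z * (quadraticChar E u * quadraticChar E v) := by
        rw [chi_mul, chi_mul]; ring
      rcases quadraticChar_dichotomy (mul_ne_zero (mul_ne_zero hu hz) hv) with h1 | h1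
      · rw [← hzz, h1]; norm_num
      · have : G z = 0 := by
          simp only [hG]; rw [Ssum_nsq h1, mul_zero, ite_self]
        rw [this]; simp
    rw [Finset.sum_congr rfl (fun z _ => e1 z), ← Finset.mul_sum] at hsum
    have e2 : ∀ y : E, G (algebraMap F E c' * y ^ 2)
        = if (Algebra.trace F E (y * y) = 0 ∧ ¬ ∃ l : F, y = l • x) then
          2 * (Fintype.card F : ℤ) * (quadraticChar E u * h x) else 0 := by
      intro y
      simp only [hG]
      have t1 : Algebra.trace F E (algebraMap F E c' * y ^ 2) = 0
          ↔ Algebra.trace F E (y * y) = 0 := by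
        rw [← Algebra.smul_def, map_smul, smul_eq_zero, sq]
        simp [hc']
      simp only [t1]
      by_cases hyy : Algebra.trace F E (y * y) = 0
      · simp only [hyy, if_true, true_and]
        by_cases hy : y = 0
        · have : ∃ l : F, y = l • x := ⟨0, by rw [hy, zero_smul]⟩
          simp only [this, not_true_eq_false, if_false, hfc]
          rw [hy, h0, zero_mul]
        · have hs : algebraMap F E c' * (x * y) ≠ 0 := mul_ne_zero hc1 (mul_ne_zero hx hy)
          have hS := Ssum_sq (F := F) (z := u * (algebraMap F E c' * y ^ 2)) (w := v)
            (s := algebraMap F E c' * (x * y)) hq hdim hv hs (by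
              linear_combination (algebraMap F E c' * y ^ 2) * hw)
          rw [hS, hfc, ← Algebra.smul_def, map_smul, smul_eq_mul, chi_mul c', ← hηw]
          by_cases hex : ∃ l : F, y = l • x
          · simp only [hex, not_true_eq_false, if_false]
            obtain ⟨l, rfl⟩ := hex
            rw [tr_mul_smul, hxx, mul_zero, quadraticChar_zero]
            ring
          · simp only [hex, not_false_eq_true, if_true]
            have hp := hpair x y hx hy hxx hyy (by push Not at hex; exact hex)
            have hv2 := chi_mul_self hv
            have h22 := chi_mul_self (two_ne (F := F) hq)
            rw [hA]
            generalize quadraticChar F (Algebra.trace F E (x * y)) = T at *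
            generalize quadraticChar F 2 = t at *
            generalize quadraticChar E v = a at *
            generalize quadraticChar E u = b at *
            generalize (Fintype.card F : ℤ) = Q at *
            have : h y * (2 * (δ * Q) * t * a * (b * a * T))
              = 2 * Q * b * δ * t * (a * a) * (h y * T) := by ring
            rw [this, hp, hv2]
            linear_combination (2 * Q * b * h x * (t * t)) * hδ + (2 * Q * b * h x) * h22
      · simp [hyy]
    rw [Finset.sum_congr rfl (fun y _ => e2 y), ← Finset.sum_filter, Finset.sum_const,
      nsmul_eq_mul] at hsum
    have hcnt : ((Finset.univ.filter fun y : E => Algebra.trace F E (y * y) = 0 ∧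
        ¬ ∃ l : F, y = l • x).card : ℤ) = (Fintype.card F : ℤ) ^ 2 - Fintype.card F := by
      have h1 := Finset.card_filter_add_card_filter_not
        (s := Finset.univ.filter fun y : E => Algebra.trace F E (y * y) = 0)
        (fun y : E => ∃ l : F, y = l • x)
      rw [hcard, Finset.filter_filter, Finset.filter_filter] at h1
      have h2 : (Finset.univ.filter fun y : E => Algebra.trace F E (y * y) = 0 ∧
          ∃ l : F, y = l • x).card = Fintype.card F := by
        rw [← Finset.card_univ]
        symm
        refine Finset.card_bij (fun l _ => l • x) ?_ ?_ ?_
        · intro l _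
          simp only [Finset.mem_filter, Finset.mem_univ, true_and]
          refine ⟨?_, l, rfl⟩
          rw [tr_smul_mul, tr_mul_smul, hxx]; ring
        · intro a _ b _ hab
          exact smul_left_injective F hx hab
        · intro y hy
          simp only [Finset.mem_filter, Finset.mem_univ, true_and] at hy
          obtain ⟨_, l, rfl⟩ := hy
          exact ⟨l, Finset.mem_univ _, rfl⟩
      rw [h2] at h1
      have h3 : ((Fintype.card F + (Finset.univ.filter fun y : E => Algebra.trace F E (y * y) = 0 ∧
        ¬ ∃ l : F, y = l • x).card : ℕ) : ℤ) = ((Fintype.card F ^ 2 : ℕ) : ℤ) := by rw [h1]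
      push_cast at h3
      linarith
    rw [hcnt] at hsum
    rw [hfw]
    linarith

/-- the sign function -/
noncomputable def eps (F : Type*) {E : Type*} [Field F] [Fintype F] [Field E] [Fintype E]
    [Algebra F E] (f : E → ℤ) (w : E × E) : ℤ :=
  if Algebra.trace F E (w.1 * w.2) = 0 then quadraticChar E w.1 * f (w.1 * w.2) else 0

theorem eps_sum (f : E → ℤ) (u v : E) :
    (∑ w : E × E, if Algebra.trace F E (u * w.2) + Algebra.trace F E (v * w.1) = 0 then
      eps F f w else 0)
      = ∑ z : E, if Algebra.trace F E z = 0 then f z * Ssum F (u * z) v else 0 := by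
  rw [Fintype.sum_prod_type]
  have h1 : ∀ a : E, (∑ b : E, if Algebra.trace F E (u * b) + Algebra.trace F E (v * a) = 0 then
      eps F f (a, b) else 0) = ∑ z : E, if Algebra.trace F E z = 0 then
        f z * (if Algebra.trace F E (u * z * a⁻¹ + v * a) = 0 then quadraticChar E a else 0)
        else 0 := by
    intro a
    by_cases ha : a = 0
    · subst ha
      simp [eps]
    · refine Fintype.sum_equiv (Equiv.mulLeft₀ a ha) _ _ ?_
      intro b
      simp only [Equiv.mulLeft₀_apply, eps]
      have : u * (a * b) * a⁻¹ = u * b := by field_simp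
      rw [this, map_add]
      split_ifs <;> ring
  rw [Finset.sum_congr rfl (fun a _ => h1 a), Finset.sum_comm]
  refine Finset.sum_congr rfl fun z _ => ?_
  rw [Ssum, Finset.mul_sum]
  split_ifs <;> simp

end mainsum

section counting
variable {F E : Type*} [Field F] [Fintype F] [Field E] [Fintype E] [Algebra F E]

theorem count_aux (hdim : Module.finrank F E = 3) {u v : E}
    (hu : u ≠ 0) (huv : Algebra.trace F E (u * v) = 0) :
    ((Finset.univ.filter fun w : E × E => w.1 ≠ 0 ∧ w.2 ≠ 0 ∧ Algebra.trace F E (w.1 * w.2) = 0 ∧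
      Algebra.trace F E (u * w.2) + Algebra.trace F E (v * w.1) = 0).card : ℤ)
    = ((Fintype.card F : ℤ) - 1) * (((Fintype.card F : ℤ) ^ 2 - 1) * (Fintype.card F + 1) +
      (Fintype.card F : ℤ) ^ 2 * (if u * v ≠ 0 then 1 else 0)) := by
  have hE : (Fintype.card E : ℤ) = (Fintype.card F : ℤ) ^ 3 := by rw [card_E hdim]; push_cast; rfl
  have hrow : ∀ a : E, (∑ b : E, if (a ≠ 0 ∧ b ≠ 0 ∧ Algebra.trace F E (a * b) = 0 ∧
      Algebra.trace F E (u * b) + Algebra.trace F E (v * a) = 0) then (1 : ℤ) else 0)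
      = (Fintype.card F : ℤ)
        + (if ∃ l : F, a = l • u then (Fintype.card F : ℤ) ^ 2 - Fintype.card F else 0)
        - (if a = 0 then (Fintype.card F : ℤ) ^ 2 - 1 else 0)
        - (if Algebra.trace F E (v * a) = 0 then 1 else 0) := by
    intro a
    by_cases ha : a = 0
    · have h1 : ∃ l : F, a = l • u := ⟨0, by rw [ha, zero_smul]⟩
      simp only [h1, if_true]
      simp [ha]
    · have hsplit : ∀ b : E, (if (a ≠ 0 ∧ b ≠ 0 ∧ Algebra.trace F E (a * b) = 0 ∧
          Algebra.trace F E (u * b) + Algebra.trace F E (v * a) = 0) then (1 : ℤ) else 0)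
          = (if (Algebra.trace F E (a * b) = 0 ∧
            Algebra.trace F E (u * b) = - Algebra.trace F E (v * a)) then 1 else 0)
            - (if b = 0 then (if Algebra.trace F E (v * a) = 0 then 1 else 0) else 0) := by
        intro b
        rw [← eq_neg_iff_add_eq_zero]
        by_cases hb : b = 0
        · subst hb
          simp [ha, eq_comm]
        · simp [ha, hb]
      rw [Finset.sum_congr rfl (fun b _ => hsplit b), Finset.sum_sub_distrib, Finset.sum_ite_eq',
        Finset.sum_boole]
      simp only [Finset.mem_univ, if_true, ha, if_false, sub_zero]
      congr 1
      by_cases hex : ∃ l : F, a = l • u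
      · simp only [hex, if_true]
        obtain ⟨l, rfl⟩ := hex
        have hl : l ≠ 0 := by rintro rfl; simp at ha
        have h1 := card_plane (F := F) hdim hu 0
        have h2 : (Finset.univ.filter fun b : E => Algebra.trace F E ((l • u) * b) = 0 ∧
            Algebra.trace F E (u * b) = - Algebra.trace F E (v * (l • u)))
            = (Finset.univ.filter fun b : E => Algebra.trace F E (u * b) = 0) := by
          ext b
          simp only [Finset.mem_filter, Finset.mem_univ, true_and]
          rw [tr_smul_mul, tr_mul_smul, mul_comm v u, huv]
          simp [hl]
        rw [h2, h1]; push_cast; ring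
      · simp only [hex, if_false, add_zero]
        rw [card_line hdim hu (by push Not at hex; exact hex)]
  rw [← Finset.sum_boole, Fintype.sum_prod_type]
  simp only []
  rw [Finset.sum_congr rfl (fun a _ => hrow a)]
  rw [Finset.sum_sub_distrib, Finset.sum_sub_distrib, Finset.sum_add_distrib, Finset.sum_const,
    ← Finset.sum_filter, Finset.sum_const, Finset.sum_ite_eq', Finset.sum_boole, nsmul_eq_mul,
    nsmul_eq_mul, Finset.card_univ, hE]
  have h1 : (Finset.univ.filter fun a : E => ∃ l : F, a = l • u).card = Fintype.card F := by
    rw [← Finset.card_univ]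
    symm
    refine Finset.card_bij (fun l _ => l • u) ?_ ?_ ?_
    · intro l _
      simp only [Finset.mem_filter, Finset.mem_univ, true_and]
      exact ⟨l, rfl⟩
    · intro a _ b _ hab
      exact smul_left_injective F hu hab
    · intro y hy
      simp only [Finset.mem_filter, Finset.mem_univ, true_and] at hy
      obtain ⟨l, rfl⟩ := hy
      exact ⟨l, Finset.mem_univ _, rfl⟩
  rw [h1]
  by_cases hv : v = 0
  · subst hv
    simp only [zero_mul, map_zero, Finset.filter_true, Finset.card_univ, hE, mul_zero, ne_eq,
      not_true_eq_false, if_false, Finset.mem_univ, if_true]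
    ring
  · rw [card_plane hdim hv]
    simp only [ne_eq, mul_eq_zero, hu, hv, or_self, not_false_eq_true, if_true, Finset.mem_univ]
    push_cast
    ring

theorem count_main (hdim : Module.finrank F E = 3) {u v : E}
    (hu : u ≠ 0 ∨ v ≠ 0) (huv : Algebra.trace F E (u * v) = 0) :
    ((Finset.univ.filter fun w : E × E => w.1 ≠ 0 ∧ w.2 ≠ 0 ∧ Algebra.trace F E (w.1 * w.2) = 0 ∧
      Algebra.trace F E (u * w.2) + Algebra.trace F E (v * w.1) = 0).card : ℤ)
    = ((Fintype.card F : ℤ) - 1) * (((Fintype.card F : ℤ) ^ 2 - 1) * (Fintype.card F + 1) +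
      (Fintype.card F : ℤ) ^ 2 * (if u * v ≠ 0 then 1 else 0)) := by
  by_cases h : u = 0
  · have hv : v ≠ 0 := hu.resolve_left (by simpa using h)
    have := count_aux (F := F) hdim (u := v) (v := u) hv (by rw [mul_comm]; exact huv)
    rw [mul_comm u v, ← this]
    norm_cast
    refine Finset.card_bij (fun w _ => (w.2, w.1)) ?_ ?_ ?_
    · rintro ⟨a, b⟩ hw
      simp only [Finset.mem_filter, Finset.mem_univ, true_and] at hw ⊢
      rw [mul_comm b a, add_comm]
      tauto
    · rintro ⟨a, b⟩ _ ⟨a', b'⟩ _ h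
      simp only [Prod.mk.injEq] at h ⊢
      tauto
    · rintro ⟨a, b⟩ hw
      refine ⟨(b, a), ?_, rfl⟩
      simp only [Finset.mem_filter, Finset.mem_univ, true_and] at hw ⊢
      rw [mul_comm b a, add_comm]
      tauto
  · exact count_aux hdim h huv

theorem proj_count {V : Type*} [AddCommGroup V] [Module F V] [Fintype V] (D : Finset V)
    (h0 : (0 : V) ∉ D) (hD : ∀ (l : F) (w : V), l ≠ 0 → w ∈ D → l • w ∈ D) :
    {R : Submodule F V | Module.finrank F R = 1 ∧ ∀ w ∈ R, w ≠ 0 → w ∈ D}.ncard *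
      (Fintype.card F - 1) = D.card := by
  have hfin : {R : Submodule F V | Module.finrank F R = 1 ∧ ∀ w ∈ R, w ≠ 0 → w ∈ D}.Finite :=
    Set.toFinite _
  rw [Set.ncard_eq_toFinset_card _ hfin]
  have h := Finset.card_eq_sum_card_fiberwise (f := fun w : V => Submodule.span F {w}) (s := D)
    (t := hfin.toFinset) (by
      intro w hw
      have hw0 : w ≠ 0 := by rintro rfl; exact h0 hw
      simp only [Set.Finite.coe_toFinset, Set.mem_ofPred_eq]
      refine ⟨finrank_span_singleton hw0, ?_⟩
      intro x hx hx0
      obtain ⟨l, rfl⟩ := Submodule.mem_span_singleton.1 hx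
      exact hD l w (by rintro rfl; simp at hx0) hw)
  rw [h]
  rw [Finset.sum_congr rfl (g := fun _ => Fintype.card F - 1), Finset.sum_const, smul_eq_mul]
  intro R hR
  simp only [Set.Finite.mem_toFinset, Set.mem_ofPred_eq] at hR
  obtain ⟨hR1, hR2⟩ := hR
  obtain ⟨⟨w, hwR⟩, hw0, hw⟩ := finrank_eq_one_iff'.1 hR1
  have hw0' : w ≠ 0 := by rintro rfl; exact hw0 rfl
  rw [← Finset.card_univ, ← Finset.card_erase_of_mem (Finset.mem_univ (0 : F))]
  symm
  refine Finset.card_bij (fun l _ => l • w) ?_ ?_ ?_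
  · intro l hl
    simp only [Finset.mem_erase, Finset.mem_univ, and_true] at hl
    simp only [Finset.mem_filter]
    refine ⟨hR2 _ (R.smul_mem l hwR) (smul_ne_zero hl hw0'), ?_⟩
    apply le_antisymm
    · rw [Submodule.span_singleton_le_iff_mem]
      exact R.smul_mem l hwR
    · intro x hx
      obtain ⟨m, hm⟩ := hw ⟨x, hx⟩
      have hm' : m • w = x := congrArg Subtype.val hm
      rw [Submodule.mem_span_singleton]
      exact ⟨m * l⁻¹, by rw [smul_smul, inv_mul_cancel_right₀ hl, hm']⟩
  · intro a _ b _ hab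
    exact smul_left_injective F hw0' hab
  · intro x hx
    simp only [Finset.mem_filter] at hx
    have hxR : x ∈ R := by rw [← hx.2]; exact Submodule.mem_span_singleton_self x
    obtain ⟨m, hm⟩ := hw ⟨x, hxR⟩
    have hm' : m • w = x := congrArg Subtype.val hm
    refine ⟨m, ?_, hm'⟩
    simp only [Finset.mem_erase, Finset.mem_univ, and_true]
    rintro rfl
    rw [zero_smul] at hm'
    exact h0 (hm' ▸ hx.1)

end counting

/-- the two sets -/
def Tset {V F : Type*} [Field F] [AddCommGroup V] [Module F V] (ε : V → ℤ) (σ : ℤ) :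
    Set (Submodule F V) :=
  {R | Module.finrank F R = 1 ∧ ∀ w ∈ R, w ≠ 0 → ε w = σ}

section final
variable {F E : Type*} [Field F] [Fintype F] [Field E] [Fintype E] [Algebra F E]

theorem eps_smul (hq : Fintype.card F % 4 = 1) (hdim : Module.finrank F E = 3) (f : E → ℤ)
    (hf : ∀ (l : F) (z : E), f ((l * l) • z) = quadraticChar F l * f z)
    {l : F} (hl : l ≠ 0) (w : E × E) : eps F f (l • w) = eps F f w := by
  have e : (l • w).1 * (l • w).2 = (l * l) • (w.1 * w.2) := by
    rw [Prod.smul_fst, Prod.smul_snd, smul_mul_smul_comm]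
  simp only [eps, e, hf, map_smul, smul_eq_mul, mul_eq_zero, hl, false_or]
  rw [Prod.smul_fst, Algebra.smul_def, chi_mul, eta_algebraMap hq hdim]
  split_ifs
  · linear_combination (quadraticChar E w.1 * f (w.1 * w.2)) * chi_mul_self hl
  · rfl

theorem eps_cases (f : E → ℤ) (hf0 : f 0 = 0)
    (hf : ∀ z : E, z ≠ 0 → Algebra.trace F E z = 0 → f z = 1 ∨ f z = -1) (w : E × E) :
    (eps F f w = 0 ∧ ¬ (w.1 ≠ 0 ∧ w.2 ≠ 0 ∧ Algebra.trace F E (w.1 * w.2) = 0)) ∨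
    ((eps F f w = 1 ∨ eps F f w = -1) ∧
      (w.1 ≠ 0 ∧ w.2 ≠ 0 ∧ Algebra.trace F E (w.1 * w.2) = 0)) := by
  by_cases ht : Algebra.trace F E (w.1 * w.2) = 0
  · by_cases h1 : w.1 = 0
    · left; simp [eps, h1]
    · by_cases h2 : w.2 = 0
      · left; simp [eps, h2, hf0]
      · right
        refine ⟨?_, h1, h2, ht⟩
        simp only [eps, ht, if_true]
        rcases hf _ (mul_ne_zero h1 h2) ht with h | h <;>
          rcases quadraticChar_dichotomy h1 with h' | h' <;> rw [h, h'] <;> simp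
  · left; exact ⟨by simp [eps, ht], fun h => ht h.2.2⟩

theorem tight (hq : Fintype.card F % 4 = 1) (hdim : Module.finrank F E = 3) (f : E → ℤ)
    (hf0 : f 0 = 0) (hf : ∀ (l : F) (z : E), f ((l * l) • z) = quadraticChar F l * f z)
    (hfpm : ∀ z : E, z ≠ 0 → Algebra.trace F E z = 0 → f z = 1 ∨ f z = -1)
    (hsum : ∀ u v : E, (u ≠ 0 ∨ v ≠ 0) → Algebra.trace F E (u * v) = 0 →
        (∑ z : E, if Algebra.trace F E z = 0 then f z * Ssum F (u * z) v else 0)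
          = ((Fintype.card F : ℤ) - 1) * (Fintype.card F : ℤ) ^ 2 *
            (quadraticChar E u * f (u * v)))
    {σ : ℤ} (hσ : σ = 1 ∨ σ = -1) (P : Submodule F (E × E)) (hP : Module.finrank F P = 1)
    (hPQ : ∀ w ∈ P, Algebra.trace F E (w.1 * w.2) = 0) :
    {R ∈ Tset (F := F) (eps F f) σ | ∀ u ∈ P, ∀ w ∈ R,
      Algebra.trace F E (u.1 * w.2) + Algebra.trace F E (u.2 * w.1) = 0}.ncard
      = (Fintype.card F ^ 2 - 1) / 2 * (Fintype.card F + 1)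
        + Fintype.card F ^ 2 * (if P ∈ Tset (F := F) (eps F f) σ then 1 else 0) := by
  obtain ⟨⟨p, hpP⟩, hp0, hp⟩ := finrank_eq_one_iff'.1 hP
  have hp0' : p ≠ 0 := by rintro rfl; exact hp0 rfl
  have hpgen : ∀ x ∈ P, ∃ l : F, x = l • p := by
    intro x hx
    obtain ⟨m, hm⟩ := hp ⟨x, hx⟩
    exact ⟨m, (congrArg Subtype.val hm).symm⟩
  have hpuv : p.1 ≠ 0 ∨ p.2 ≠ 0 := by
    by_contra! h
    exact hp0' (Prod.ext h.1 h.2)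
  have hpQ := hPQ p hpP
  have hmem : P ∈ Tset (F := F) (eps F f) σ ↔ eps F f p = σ := by
    constructor
    · intro h; exact h.2 p hpP hp0'
    · intro h
      refine ⟨hP, fun w hw hw0 => ?_⟩
      obtain ⟨l, rfl⟩ := hpgen w hw
      rw [eps_smul hq hdim f hf (by rintro rfl; simp at hw0), h]
  have hσ0 : σ ≠ 0 := by rcases hσ with rfl | rfl <;> norm_num
  let D : ℤ → Finset (E × E) := fun τ => Finset.univ.filter fun w => eps F f w = τ ∧
    Algebra.trace F E (p.1 * w.2) + Algebra.trace F E (p.2 * w.1) = 0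
  have hset : {R ∈ Tset (F := F) (eps F f) σ | ∀ u ∈ P, ∀ w ∈ R,
      Algebra.trace F E (u.1 * w.2) + Algebra.trace F E (u.2 * w.1) = 0}
      = {R : Submodule F (E × E) | Module.finrank F R = 1 ∧ ∀ w ∈ R, w ≠ 0 → w ∈ D σ} := by
    ext R
    simp only [Tset, Set.mem_ofPred_eq, D, Finset.mem_filter, Finset.mem_univ, true_and]
    constructor
    · rintro ⟨⟨h1, h2⟩, h3⟩
      exact ⟨h1, fun w hw hw0 => ⟨h2 w hw hw0, h3 p hpP w hw⟩⟩
    · rintro ⟨h1, h2⟩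
      refine ⟨⟨h1, fun w hw hw0 => (h2 w hw hw0).1⟩, ?_⟩
      intro u hu w hw
      by_cases hw0 : w = 0
      · subst hw0; simp
      obtain ⟨l, rfl⟩ := hpgen u hu
      have := (h2 w hw hw0).2
      rw [Prod.smul_fst, Prod.smul_snd, tr_smul_mul, tr_smul_mul, ← mul_add, this, mul_zero]
  have hproj := proj_count (F := F) (D σ) (by
      simp only [D, Finset.mem_filter, Finset.mem_univ, true_and, not_and]
      intro h
      exfalso
      apply hσ0
      rw [← h]; simp [eps]) (by
      intro l w hl hw
      simp only [D, Finset.mem_filter, Finset.mem_univ, true_and] at hw ⊢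
      rw [eps_smul hq hdim f hf hl]
      refine ⟨hw.1, ?_⟩
      rw [Prod.smul_fst, Prod.smul_snd, tr_mul_smul, tr_mul_smul, ← mul_add, hw.2, mul_zero])
  rw [hset]
  have hM := (eps_sum (F := F) f p.1 p.2).trans (hsum p.1 p.2 hpuv hpQ)
  have hN := count_main hdim hpuv hpQ
  have hep : eps F f p = quadraticChar E p.1 * f (p.1 * p.2) := by simp [eps, hpQ]
  rw [← hep] at hM
  have hM' : ((D 1).card : ℤ) - (D (-1)).card = ∑ w : E × E,
      if Algebra.trace F E (p.1 * w.2) + Algebra.trace F E (p.2 * w.1) = 0 then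
      eps F f w else 0 := by
    simp only [D]
    rw [← Finset.sum_boole, ← Finset.sum_boole, ← Finset.sum_sub_distrib]
    refine Finset.sum_congr rfl fun w _ => ?_
    rcases eps_cases f hf0 hfpm w with h | ⟨h | h, _⟩
    · simp [h.1]
    · simp [h]
    · simp [h]
      split_ifs <;> simp
  have hN' : ((D 1).card : ℤ) + (D (-1)).card = ((Finset.univ.filter fun w : E × E =>
      w.1 ≠ 0 ∧ w.2 ≠ 0 ∧ Algebra.trace F E (w.1 * w.2) = 0 ∧
      Algebra.trace F E (p.1 * w.2) + Algebra.trace F E (p.2 * w.1) = 0).card : ℤ) := by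
    simp only [D]
    rw [← Finset.sum_boole, ← Finset.sum_boole, ← Finset.sum_boole, ← Finset.sum_add_distrib]
    refine Finset.sum_congr rfl fun w _ => ?_
    rcases eps_cases f hf0 hfpm w with ⟨h, h'⟩ | ⟨h | h, h1, h2, h3⟩
    · have : ¬ (w.1 ≠ 0 ∧ w.2 ≠ 0 ∧ Algebra.trace F E (w.1 * w.2) = 0 ∧
        Algebra.trace F E (p.1 * w.2) + Algebra.trace F E (p.2 * w.1) = 0) := by tauto
      rw [if_neg this]
      simp [h]
    · simp [h, h1, h2, h3]
    · simp [h, h1, h2, h3]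
  rw [hM] at hM'
  rw [hN] at hN'
  have hq1 : 1 < Fintype.card F := Fintype.one_lt_card
  obtain ⟨m, hm⟩ : ∃ m, Fintype.card F = 4 * m + 1 := ⟨Fintype.card F / 4, by omega⟩
  have hhalf : (Fintype.card F ^ 2 - 1) / 2 = 8 * m ^ 2 + 4 * m := by
    have : Fintype.card F ^ 2 = 2 * (8 * m ^ 2 + 4 * m) + 1 := by rw [hm]; ring
    omega
  rw [hhalf]
  have hproj' : (({R : Submodule F (E × E) | Module.finrank F R = 1 ∧
      ∀ w ∈ R, w ≠ 0 → w ∈ D σ}.ncard : ℕ) : ℤ) * (4 * m) = (D σ).card := by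
    rw [← hproj, hm]; push_cast; simp
  have hm0 : (m : ℤ) ≠ 0 := by
    intro h
    have : m = 0 := by exact_mod_cast h
    omega
  have hqm : (Fintype.card F : ℤ) = 4 * m + 1 := by rw [hm]; push_cast; rfl
  have hif : (if p.1 * p.2 ≠ 0 then (1 : ℤ) else 0) + σ * eps F f p
      = 2 * (if P ∈ Tset (F := F) (eps F f) σ then 1 else 0) := by
    simp only [hmem]
    rcases eps_cases f hf0 hfpm p with ⟨h, h'⟩ | ⟨h, h1, h2, h3⟩
    · have : p.1 * p.2 = 0 := by
        by_contra h0
        exact h' ⟨left_ne_zero_of_mul h0, right_ne_zero_of_mul h0, hpQ⟩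
      rw [h]
      simp [this, hσ0.symm]
    · have : p.1 * p.2 ≠ 0 := mul_ne_zero h1 h2
      rcases h with h | h <;> rcases hσ with rfl | rfl <;> rw [h] <;> norm_num [h1, h2]
  have hDσ : 2 * ((D σ).card : ℤ) = ((D 1).card + (D (-1)).card)
      + σ * ((D 1).card - (D (-1)).card) := by
    rcases hσ with rfl | rfl <;> ring
  rw [hM', hN', ← hproj'] at hDσ
  have hfin : ((({R : Submodule F (E × E) | Module.finrank F R = 1 ∧
      ∀ w ∈ R, w ≠ 0 → w ∈ D σ}.ncard : ℕ) : ℤ))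
      = (8 * m ^ 2 + 4 * m) * (Fintype.card F + 1) + (Fintype.card F : ℤ) ^ 2 *
        (if P ∈ Tset (F := F) (eps F f) σ then 1 else 0) := by
    generalize (({R : Submodule F (E × E) | Module.finrank F R = 1 ∧
      ∀ w ∈ R, w ≠ 0 → w ∈ D σ}.ncard : ℕ) : ℤ) = n at *
    apply mul_left_cancel₀ (mul_ne_zero (by norm_num : (8 : ℤ) ≠ 0) hm0)
    rw [hqm] at hDσ ⊢
    linear_combination hDσ + (4 * m) * (4 * m + 1) ^ 2 * hif
  refine Nat.cast_injective (R := ℤ) (hfin.trans ?_)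
  split_ifs <;> push_cast <;> ring

end final

end CL

/-- main theorem.  Let `q ≡ 5 or 9 (mod 12)` be a prime
power, `F = 𝔽_q`, `E = 𝔽_{q³}` and `T x = x^{q²} + x^q + x` the relative trace.
On `V = E × E`, a 6-dimensional `F`-space, consider the quadratic form
`Q (u,v) = T (u v)` with polar form `B ((u₁,v₁),(u₂,v₂)) = T(u₁v₂) + T(v₁u₂)`.
Let `𝒬` be the set of projective points (1-dimensional `F`-subspaces) on which
`Q` vanishes, and `π₁ = {[(x,0)]}`, `π₂ = {[(0,y)]}` two disjoint generators of
the hyperbolic quadric `𝒬 = Q⁺(5,q)`.  Then `𝒬` decomposes as the disjoint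
union `π₁ ∪ π₂ ∪ 𝒯₁ ∪ 𝒯₂` where each `𝒯ₘ` is a `((q²−1)/2)`-tight set: for
every `p ∈ 𝒬`, the number of `r ∈ 𝒯ₘ` with `B` vanishing on `p × r` equals
`((q²−1)/2)(q+1) + q²·[p ∈ 𝒯ₘ]`; moreover `𝒯₁` and `𝒯₂` are mapped to each
other by a projective similarity of the quadric. -/
theorem stmt_16 {q : ℕ} (hq12 : q % 12 = 5 ∨ q % 12 = 9)
    (hpp : ∃ p n : ℕ, p.Prime ∧ 0 < n ∧ q = p ^ n)
    {F E : Type*} [Field F] [Fintype F] [Field E] [Fintype E] [Algebra F E]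
    (hF : Fintype.card F = q) (hdim : Module.finrank F E = 3)
    (T : E → E) (hT : ∀ x, T x = x ^ q ^ 2 + x ^ q + x)
    (Qset π₁ π₂ : Set (Submodule F (E × E)))
    (hQset : Qset = {P : Submodule F (E × E) | Module.finrank F P = 1 ∧ ∀ w ∈ P, T (w.1 * w.2) = 0})
    (hπ₁ : π₁ = {P : Submodule F (E × E) | Module.finrank F P = 1 ∧ ∀ w ∈ P, w.2 = 0})
    (hπ₂ : π₂ = {P : Submodule F (E × E) | Module.finrank F P = 1 ∧ ∀ w ∈ P, w.1 = 0}) :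
    ∃ T₁ T₂ : Set (Submodule F (E × E)),
      T₁ ⊆ Qset ∧ T₂ ⊆ Qset ∧
      Disjoint T₁ T₂ ∧ Disjoint T₁ (π₁ ∪ π₂) ∧ Disjoint T₂ (π₁ ∪ π₂) ∧
      π₁ ∪ π₂ ∪ T₁ ∪ T₂ = Qset ∧
      (∀ Tm ∈ [T₁, T₂], ∀ P ∈ Qset,
        {R ∈ Tm | ∀ u ∈ P, ∀ w ∈ R, T (u.1 * w.2) + T (u.2 * w.1) = 0}.ncard
          = (q ^ 2 - 1) / 2 * (q + 1) + q ^ 2 * (if P ∈ Tm then 1 else 0)) ∧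
      ∃ g : (E × E) ≃ₗ[F] (E × E),
        (∃ c : F, c ≠ 0 ∧ ∀ w : E × E,
          T ((g w).1 * (g w).2) = algebraMap F E c * T (w.1 * w.2)) ∧
        T₂ = (fun P => Submodule.map (g : (E × E) →ₗ[F] (E × E)) P) '' T₁ := by
  have hq4 : Fintype.card F % 4 = 1 := by rw [hF]; omega
  have hTtr : ∀ x, T x = algebraMap F E (Algebra.trace F E x) := by
    intro x
    rw [hT, FiniteField.algebraMap_trace_eq_sum_pow, hdim, Nat.card_eq_fintype_card, hF]
    simp only [Finset.sum_range_succ, Finset.sum_range_zero, pow_zero, pow_one]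
    ring
  have hTz : ∀ x, T x = 0 ↔ Algebra.trace F E x = 0 := by
    intro x; rw [hTtr]; simp
  have hTz2 : ∀ x y, T x + T y = 0 ↔ Algebra.trace F E x + Algebra.trace F E y = 0 := by
    intro x y; rw [hTtr, hTtr, ← map_add]
    exact map_eq_zero_iff _ (algebraMap F E).injective
  obtain ⟨f, hf0, hf, hfpm, hsum⟩ := CL.exists_f (F := F) (E := E) hq4 hdim
  obtain ⟨c, hc⟩ := quadraticChar_exists_neg_one (F := F) (CL.ringChar_ne_two_of (by omega))
  have hc0 : c ≠ 0 := by rintro rfl; simp at hc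
  have hsub : ∀ σ : ℤ, σ ≠ 0 → ∀ R ∈ CL.Tset (F := F) (CL.eps F f) σ, ∀ w ∈ R, w ≠ 0 →
      w.1 ≠ 0 ∧ w.2 ≠ 0 ∧ Algebra.trace F E (w.1 * w.2) = 0 := by
    intro σ hσ R hR w hw hw0
    have h1 := hR.2 w hw hw0
    rcases CL.eps_cases f hf0 hfpm w with h | h
    · exact absurd (h1.symm.trans h.1) hσ
    · exact h.2
  have hnz : ∀ R : Submodule F (E × E), Module.finrank F R = 1 → ∃ w ∈ R, w ≠ 0 ∧
      ∀ x ∈ R, ∃ l : F, x = l • w := by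
    intro R hR
    obtain ⟨⟨p, hpP⟩, hp0, hp⟩ := finrank_eq_one_iff'.1 hR
    refine ⟨p, hpP, by rintro rfl; exact hp0 rfl, ?_⟩
    intro x hx
    obtain ⟨m, hm⟩ := hp ⟨x, hx⟩
    exact ⟨m, (congrArg Subtype.val hm).symm⟩
  have hQ : ∀ σ : ℤ, σ ≠ 0 → CL.Tset (F := F) (CL.eps F f) σ ⊆ Qset := by
    intro σ hσ R hR
    rw [hQset]
    refine ⟨hR.1, fun w hw => ?_⟩
    rw [hTz]
    by_cases hw0 : w = 0
    · simp [hw0]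
    · exact (hsub σ hσ R hR w hw hw0).2.2
  have hdis : ∀ σ : ℤ, σ ≠ 0 → Disjoint (CL.Tset (F := F) (CL.eps F f) σ) (π₁ ∪ π₂) := by
    intro σ hσ
    rw [Set.disjoint_left]
    intro R hR hR2
    obtain ⟨w, hw, hw0, _⟩ := hnz R hR.1
    have h1 := hsub σ hσ R hR w hw hw0
    rcases hR2 with h | h
    · rw [hπ₁] at h; exact h1.2.1 (h.2 w hw)
    · rw [hπ₂] at h; exact h1.1 (h.2 w hw)
  refine ⟨CL.Tset (CL.eps F f) 1, CL.Tset (CL.eps F f) (-1), hQ 1 (by norm_num),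
    hQ (-1) (by norm_num), ?_, hdis 1 (by norm_num), hdis (-1) (by norm_num), ?_, ?_, ?_⟩
  · rw [Set.disjoint_left]
    intro R hR hR2
    obtain ⟨w, hw, hw0, _⟩ := hnz R hR.1
    have := (hR.2 w hw hw0).symm.trans (hR2.2 w hw hw0)
    norm_num at this
  · apply Set.Subset.antisymm
    · apply Set.union_subset (Set.union_subset (Set.union_subset ?_ ?_) (hQ 1 (by norm_num)))
        (hQ (-1) (by norm_num))
      · rw [hπ₁, hQset]
        rintro R ⟨h1, h2⟩
        refine ⟨h1, fun w hw => ?_⟩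
        rw [hTz, h2 w hw]; simp
      · rw [hπ₂, hQset]
        rintro R ⟨h1, h2⟩
        refine ⟨h1, fun w hw => ?_⟩
        rw [hTz, h2 w hw]; simp
    · intro R hR
      rw [hQset] at hR
      obtain ⟨h1, h2⟩ := hR
      obtain ⟨p, hp, hp0, hgen⟩ := hnz R h1
      have hmem : ∀ σ : ℤ, CL.eps F f p = σ → R ∈ CL.Tset (F := F) (CL.eps F f) σ := by
        intro σ h
        refine ⟨h1, fun w hw hw0 => ?_⟩
        obtain ⟨l, rfl⟩ := hgen w hw
        rw [CL.eps_smul hq4 hdim f hf (by rintro rfl; simp at hw0), h]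
      rcases CL.eps_cases f hf0 hfpm p with ⟨h, h'⟩ | ⟨h | h, _⟩
      · left; left
        by_cases hp2 : p.2 = 0
        · left
          rw [hπ₁]
          refine ⟨h1, fun w hw => ?_⟩
          obtain ⟨l, rfl⟩ := hgen w hw
          rw [Prod.smul_snd, hp2, smul_zero]
        · right
          have hp1 : p.1 = 0 := by
            by_contra hp1
            exact h' ⟨hp1, hp2, (hTz _).1 (h2 p hp)⟩
          rw [hπ₂]
          refine ⟨h1, fun w hw => ?_⟩
          obtain ⟨l, rfl⟩ := hgen w hw
          rw [Prod.smul_fst, hp1, smul_zero]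
      · left; right; exact hmem 1 h
      · right; exact hmem (-1) h
  · intro Tm hTm P hP
    rw [hQset] at hP
    obtain ⟨hP1, hP2⟩ := hP
    have hP3 : ∀ w ∈ P, Algebra.trace F E (w.1 * w.2) = 0 := fun w hw => (hTz _).1 (hP2 w hw)
    simp only [List.mem_cons, List.not_mem_nil, or_false] at hTm
    obtain ⟨σ, hσ, rfl⟩ : ∃ σ : ℤ, (σ = 1 ∨ σ = -1) ∧ Tm = CL.Tset (F := F) (CL.eps F f) σ := by
      rcases hTm with h | h
      · exact ⟨1, Or.inl rfl, h⟩
      · exact ⟨-1, Or.inr rfl, h⟩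
    have := CL.tight hq4 hdim f hf0 hf hfpm hsum hσ P hP1 hP3
    rw [hF] at this
    simp only [hTz2]
    exact this
  · let g : (E × E) ≃ₗ[F] (E × E) := LinearEquiv.prodCongr
      (LinearEquiv.smulOfNeZero F E c hc0) (LinearEquiv.smulOfNeZero F E c⁻¹ (inv_ne_zero hc0))
    have hg : ∀ w, g w = (c • w.1, c⁻¹ • w.2) := fun w => rfl
    have hgm : ∀ w, (g w).1 * (g w).2 = w.1 * w.2 := by
      intro w
      rw [hg, smul_mul_smul_comm, mul_inv_cancel₀ hc0, one_smul]
    have hge : ∀ w, CL.eps F f (g w) = - CL.eps F f w := by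
      intro w
      simp only [CL.eps, hgm]
      rw [hg, Algebra.smul_def, CL.chi_mul, CL.eta_algebraMap hq4 hdim, hc]
      split_ifs <;> ring
    have hmap : ∀ σ : ℤ, ∀ R ∈ CL.Tset (F := F) (CL.eps F f) σ,
        Submodule.map (g : (E × E) →ₗ[F] (E × E)) R ∈ CL.Tset (F := F) (CL.eps F f) (-σ) := by
      intro σ R hR
      refine ⟨(LinearEquiv.finrank_map_eq g R).trans hR.1, ?_⟩
      rintro _ ⟨w, hw, rfl⟩ hw0
      have hw0' : w ≠ 0 := by rintro rfl; simp at hw0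
      rw [LinearEquiv.coe_coe, hge, hR.2 w hw hw0']
    refine ⟨g, ⟨1, one_ne_zero, fun w => by rw [hgm, map_one, one_mul]⟩, ?_⟩
    apply Set.Subset.antisymm
    · intro R hR
      refine ⟨Submodule.map (g.symm : (E × E) →ₗ[F] (E × E)) R, ?_, ?_⟩
      · refine ⟨(LinearEquiv.finrank_map_eq g.symm R).trans hR.1, ?_⟩
        rintro _ ⟨w, hw, rfl⟩ hw0
        have hw0' : w ≠ 0 := by rintro rfl; simp at hw0
        have h1 := hge (g.symm w)
        rw [LinearEquiv.apply_symm_apply, hR.2 w hw hw0'] at h1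
        rw [LinearEquiv.coe_coe]
        linarith
      · ext x
        simp
    · rintro _ ⟨R, hR, rfl⟩
      exact hmap 1 R hR
end
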